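/- Let G be a reductive algebraic group over an algebraically closed field of characteristic 0 acting on finite-dimensional spaces V1, V2, and let T be a maximal torus of the identity component G⁰. If Hom(V1, V2) has a nonzero T-invariant element and V1, V2 are minuscule as G⁰-representations, then there is a nonzero G⁰-equivariant homomorphism V1 → V2. -/

import Mathlib

/-! Concrete model of linear algebraic groups: Zariski-closed subgroups of `GL n F`. -/

variable {F : Type} [Field F]

/-- A subset of `GL n F` is Zariski closed if it is the vanishing locus (inside
`GL n F`) of a family of polynomials in the matrix entries. -/
def IsZClosed {n : ℕ} (S : Set (GL (Fin n) F)) : Prop :=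
  ∃ I : Set (MvPolynomial (Fin n × Fin n) F),
    S = {g | ∀ p ∈ I, MvPolynomial.eval
      (fun q => ((g : GL (Fin n) F) : Matrix (Fin n) (Fin n) F) q.1 q.2) p = 0}

/-- Connectedness of a subset of `GL n F` for the Zariski topology. -/
def IsZConnected {n : ℕ} (S : Set (GL (Fin n) F)) : Prop :=
  ∀ C₁ C₂ : Set (GL (Fin n) F), IsZClosed C₁ → IsZClosed C₂ → S ⊆ C₁ ∪ C₂ →
    (S ∩ C₁).Nonempty → (S ∩ C₂).Nonempty → (S ∩ (C₁ ∩ C₂)).Nonempty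

/-- `C` is the Zariski closure of `S`. -/
def IsZClosure {n : ℕ} (S C : Set (GL (Fin n) F)) : Prop :=
  IsZClosed C ∧ S ⊆ C ∧ ∀ D : Set (GL (Fin n) F), IsZClosed D → S ⊆ D → C ⊆ D

/-- An element of `GL n F` is unipotent. -/
def IsUnipotentElem {n : ℕ} (g : GL (Fin n) F) : Prop :=
  ((g : Matrix (Fin n) (Fin n) F) - 1) ^ n = 0

/-- An element of `GL n F` is semisimple (diagonalizable; over an algebraically closed
field of characteristic zero this is the usual notion). -/
def IsSemisimpleElem {n : ℕ} (g : GL (Fin n) F) : Prop :=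
  ∃ P : GL (Fin n) F,
    Matrix.IsDiag ((P⁻¹ * g * P : GL (Fin n) F) : Matrix (Fin n) (Fin n) F)

/-- A closed subgroup `G` is reductive if its only Zariski-closed connected normal
subgroup consisting of unipotent elements is trivial. -/
def IsReductive {n : ℕ} (G : Subgroup (GL (Fin n) F)) : Prop :=
  ∀ H : Subgroup (GL (Fin n) F), H ≤ G → IsZClosed (H : Set (GL (Fin n) F)) →
    IsZConnected (H : Set (GL (Fin n) F)) → (∀ h ∈ H, IsUnipotentElem h) →
    (∀ g ∈ G, ∀ h ∈ H, g * h * g⁻¹ ∈ H) → H = ⊥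

/-- A torus: a Zariski-closed connected commutative subgroup all of whose elements are
semisimple. -/
def IsTorus {n : ℕ} (T : Subgroup (GL (Fin n) F)) : Prop :=
  IsZClosed (T : Set (GL (Fin n) F)) ∧ IsZConnected (T : Set (GL (Fin n) F)) ∧
    (∀ t ∈ T, IsSemisimpleElem t) ∧ ∀ a ∈ T, ∀ b ∈ T, a * b = b * a

/-- A maximal torus of `G`. -/
def IsMaximalTorus {n : ℕ} (G T : Subgroup (GL (Fin n) F)) : Prop :=
  T ≤ G ∧ IsTorus T ∧ ∀ T' : Subgroup (GL (Fin n) F), T' ≤ G → IsTorus T' → T ≤ T' → T' = T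

/-- `G0` is the identity component of `G`. -/
def IsIdentityComponent {n : ℕ} (G0 G : Subgroup (GL (Fin n) F)) : Prop :=
  G0 ≤ G ∧ IsZClosed (G0 : Set (GL (Fin n) F)) ∧ IsZConnected (G0 : Set (GL (Fin n) F)) ∧
    ∀ H : Subgroup (GL (Fin n) F), H ≤ G → IsZClosed (H : Set (GL (Fin n) F)) →
      IsZConnected (H : Set (GL (Fin n) F)) → H ≤ G0

/-- A representation `ρ : G → GL m F` is algebraic: its matrix entries are polynomial
functions of the matrix entries of `g` and of `g⁻¹`. -/
def IsAlgebraicRep {n m : ℕ} (G : Subgroup (GL (Fin n) F)) (ρ : G →* GL (Fin m) F) : Prop :=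
  ∀ i j : Fin m, ∃ p : MvPolynomial ((Fin n × Fin n) ⊕ (Fin n × Fin n)) F, ∀ g : G,
    ((ρ g : GL (Fin m) F) : Matrix (Fin m) (Fin m) F) i j =
      MvPolynomial.eval (Sum.elim
        (fun q => (((g : GL (Fin n) F)) : Matrix (Fin n) (Fin n) F) q.1 q.2)
        (fun q => (((g : GL (Fin n) F)⁻¹) : Matrix (Fin n) (Fin n) F) q.1 q.2)) p

/-- A submodule invariant under the representation. -/
def RepInvariant {n m : ℕ} {G : Subgroup (GL (Fin n) F)} (ρ : G →* GL (Fin m) F)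
    (U : Submodule F (Fin m → F)) : Prop :=
  ∀ g : G, ∀ v ∈ U, Matrix.mulVec ((ρ g : GL (Fin m) F) : Matrix (Fin m) (Fin m) F) v ∈ U

/-- `U` is a nonzero irreducible subrepresentation. -/
def IsIrreducibleOn {n m : ℕ} {G : Subgroup (GL (Fin n) F)} (ρ : G →* GL (Fin m) F)
    (U : Submodule F (Fin m → F)) : Prop :=
  U ≠ ⊥ ∧ RepInvariant ρ U ∧
    ∀ U' : Submodule F (Fin m → F), U' ≤ U → RepInvariant ρ U' → U' = ⊥ ∨ U' = U

/-- `v ∈ U` is a weight vector for the torus `T` with weight (character) `c`; the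
character is recorded as a function on all of `GL n F`, only its values on `T`
being relevant. -/
def IsWeightVector {n m : ℕ} {G : Subgroup (GL (Fin n) F)} (T : Subgroup (GL (Fin n) F))
    (ρ : G →* GL (Fin m) F) (U : Submodule F (Fin m → F)) (c : GL (Fin n) F → F)
    (v : Fin m → F) : Prop :=
  v ∈ U ∧ v ≠ 0 ∧ ∀ t : G, (t : GL (Fin n) F) ∈ T →
    Matrix.mulVec ((ρ t : GL (Fin m) F) : Matrix (Fin m) (Fin m) F) v = c t • v

/-- The subrepresentation `U` is minuscule: the Weyl group `N_G(T)/T` acts transitively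
on its `T`-weights. -/
def IsMinusculeOn {n m : ℕ} (G : Subgroup (GL (Fin n) F)) (T : Subgroup (GL (Fin n) F))
    (ρ : G →* GL (Fin m) F) (U : Submodule F (Fin m → F)) : Prop :=
  ∀ (c c' : GL (Fin n) F → F) (v v' : Fin m → F),
    IsWeightVector T ρ U c v → IsWeightVector T ρ U c' v' →
    ∃ w : GL (Fin n) F, w ∈ G ∧ w ∈ Subgroup.normalizer T ∧
      ∀ t ∈ T, c' t = c (w * t * w⁻¹)

/-- A representation is minuscule if all its irreducible factors are. -/
def IsMinuscule {n m : ℕ} (G : Subgroup (GL (Fin n) F)) (T : Subgroup (GL (Fin n) F))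
    (ρ : G →* GL (Fin m) F) : Prop :=
  ∀ U : Submodule F (Fin m → F), IsIrreducibleOn ρ U → IsMinusculeOn G T ρ U

set_option linter.unusedSectionVars false
variable {F : Type} [Field F]

namespace RG
open Module

/-- Axioms for the coordinate ring `R` of an abstract group `Γ`. -/
class Good {Γ : Type} [Group Γ] (R : Subalgebra F (Γ → F)) : Prop where
  comul : ∀ f : R, ∃ (k : ℕ) (a b : Fin k → R), ∀ g h, f.1 (g * h) = ∑ i, (a i).1 g * (b i).1 h
  inv : ∀ f : R, (fun g => f.1 g⁻¹) ∈ R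
  fg : R.FG
  dom : ∀ f g : R, f * g = 0 → f = 0 ∨ g = 0
  points : ∀ θ : R →ₐ[F] F, ∃ γ, ∀ f : R, θ f = f.1 γ

section framework
variable {Γ : Type} [Group Γ] {R : Subalgebra F (Γ → F)}

/-- Left invariance of an operator on `R`. -/
def LInv (P : R → R) : Prop :=
  ∀ (γ : Γ) (f f' : R), (∀ h, f'.1 h = f.1 (γ * h)) → ∀ h, (P f').1 h = (P f).1 (γ * h)

lemma LInv.comp {P Q : R → R} (hP : LInv P) (hQ : LInv Q) : LInv (fun f => P (Q f)) :=
  fun γ f f' h => hP γ _ _ (hQ γ f f' h)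

variable (R) in
/-- Left invariant derivations. -/
def lieG : LieSubalgebra F (Derivation F R R) where
  carrier := {D | LInv D}
  zero_mem' := by intro γ f f' _ h; simp
  add_mem' := by
    intro a b ha hb γ f f' hf h
    simp [ha γ f f' hf h, hb γ f f' hf h]
  smul_mem' := by
    intro c a ha γ f f' hf h
    simp [ha γ f f' hf h]
  lie_mem' := by
    intro a b ha hb γ f f' hf h
    have h1 := ha.comp hb γ f f' hf h
    have h2 := hb.comp ha γ f f' hf h
    simp only [Derivation.commutator_apply]
    simp at h1 h2 ⊢
    rw [h1, h2]

lemma lieG_linv (D : lieG R) : LInv D.1 := D.2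

/-- Right translation. -/
lemma right_mem [hR : Good R] (f : R) (γ : Γ) : (fun h => f.1 (h * γ)) ∈ R := by
  obtain ⟨k, a, b, hab⟩ := hR.comul f
  have : (fun h => f.1 (h * γ)) = ∑ i, (b i).1 γ • (a i).1 := by
    funext h; rw [hab]; simp [Finset.sum_apply, mul_comm]
  rw [this]
  exact R.sum_mem fun i _ => R.smul_mem (a i).2 _

lemma left_mem [hR : Good R] (f : R) (γ : Γ) : (fun h => f.1 (γ * h)) ∈ R := by
  obtain ⟨k, a, b, hab⟩ := hR.comul f
  have : (fun h => f.1 (γ * h)) = ∑ i, (a i).1 γ • (b i).1 := by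
    funext h; rw [hab]; simp [Finset.sum_apply]
  rw [this]
  exact R.sum_mem fun i _ => R.smul_mem (b i).2 _

/-- Right translation as an algebra automorphism. -/
def rt [Good R] (γ : Γ) : R →ₐ[F] R where
  toFun f := ⟨fun h => f.1 (h * γ), right_mem f γ⟩
  map_one' := rfl
  map_mul' _ _ := rfl
  map_zero' := rfl
  map_add' _ _ := rfl
  commutes' _ := rfl

def lt [Good R] (γ : Γ) : R →ₐ[F] R where
  toFun f := ⟨fun h => f.1 (γ * h), left_mem f γ⟩
  map_one' := rfl
  map_mul' _ _ := rfl
  map_zero' := rfl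
  map_add' _ _ := rfl
  commutes' _ := rfl

@[simp] lemma rt_apply [Good R] (γ : Γ) (f : R) (h : Γ) : (rt γ f).1 h = f.1 (h * γ) := rfl
@[simp] lemma lt_apply [Good R] (γ : Γ) (f : R) (h : Γ) : (lt γ f).1 h = f.1 (γ * h) := rfl

lemma R_ext {f g : R} (h : ∀ γ, f.1 γ = g.1 γ) : f = g := Subtype.ext (funext h)

lemma rt_mul [Good R] (γ δ : Γ) (f : R) : rt (γ * δ) f = rt γ (rt δ f) :=
  R_ext fun h => by simp [mul_assoc]

@[simp] lemma rt_one [Good R] (f : R) : rt 1 f = f := R_ext fun h => by simp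

lemma linv_rt [Good R] (γ : Γ) : LInv (rt γ : R → R) := by
  intro δ f f' hf h
  simp [hf, mul_assoc]

lemma LInv.lt [Good R] {P : R → R} (hP : LInv P) (γ : Γ) (f : R) : P (lt γ f) = RG.lt γ (P f) :=
  R_ext fun h => hP γ f _ (fun _ => rfl) h

/-- Adjoint action. -/
def AdD [Good R] (γ : Γ) (D : Derivation F R R) : Derivation F R R :=
  Derivation.mk' ((rt γ).toLinearMap ∘ₗ (D : R →ₗ[F] R) ∘ₗ (rt γ⁻¹).toLinearMap) (by
    intro a b
    simp only [LinearMap.comp_apply, AlgHom.toLinearMap_apply, map_mul, Derivation.coeFn_coe,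
      Derivation.leibniz, map_add, smul_eq_mul, ← rt_mul, mul_inv_cancel, rt_one])

lemma AdD_apply [Good R] (γ : Γ) (D : Derivation F R R) (f : R) :
    AdD γ D f = rt γ (D (rt γ⁻¹ f)) := rfl

variable (R) in
/-- The adjoint representation. -/
def adRep [Good R] : Representation F Γ (lieG R) where
  toFun γ :=
    { toFun := fun D => ⟨AdD γ D.1, (linv_rt γ).comp (D.2.comp (linv_rt γ⁻¹))⟩
      map_add' := by intro a b; ext f; simp [AdD_apply]
      map_smul' := by intro c a; ext f; simp [AdD_apply] }
  map_one' := by ext D f; simp [AdD_apply]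
  map_mul' := by intro a b; ext D f; simp [AdD_apply, rt_mul]

lemma adRep_apply [Good R] (γ : Γ) (D : lieG R) (f : R) :
    (adRep R γ D).1 f = rt γ (D.1 (rt γ⁻¹ f)) := rfl

section reps
variable {V V' : Type} [AddCommGroup V] [Module F V]
  [AddCommGroup V'] [Module F V']
variable {ρ : Representation F Γ V} {ρ' : Representation F Γ V'}

/-- Rational representation. -/
def Rat (R : Subalgebra F (Γ → F)) (ρ : Representation F Γ V) : Prop :=
  ∀ (ξ : Dual F V) (v : V), (fun γ => ξ (ρ γ v)) ∈ R

def coef (hρ : Rat R ρ) (ξ : Dual F V) (v : V) : R := ⟨fun γ => ξ (ρ γ v), hρ ξ v⟩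

@[simp] lemma coef_apply (hρ : Rat R ρ) (ξ : Dual F V) (v : V) (γ : Γ) :
    (coef hρ ξ v).1 γ = ξ (ρ γ v) := rfl

/-- Coefficient map, linear in the vector. -/
def coefL (hρ : Rat R ρ) (ξ : Dual F V) : V →ₗ[F] R where
  toFun v := coef hρ ξ v
  map_add' a b := R_ext fun γ => by simp
  map_smul' c a := R_ext fun γ => by simp

@[simp] lemma coefL_apply (hρ : Rat R ρ) (ξ : Dual F V) (v : V) : coefL hρ ξ v = coef hρ ξ v := rfl

lemma eq_of_coef (hρ : Rat R ρ) {v w : V} (h : ∀ ξ, coef hρ ξ v = coef hρ ξ w) : v = w := by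
  rw [← sub_eq_zero, ← Module.forall_dual_apply_eq_zero_iff F]
  intro ξ
  have := congrArg (fun f : R => f.1 1) (h ξ)
  simpa [sub_eq_zero] using this

variable [FiniteDimensional F V] [FiniteDimensional F V']

noncomputable def act (hρ : Rat R ρ) (P : R →ₗ[F] R) : V →ₗ[F] V :=
  (evalEquiv F V).symm.toLinearMap ∘ₗ LinearMap.mk₂ F (fun v ξ => (P (coef hρ ξ v)).1 1)
    (by intro a b ξ
        have : coef hρ ξ (a + b) = coef hρ ξ a + coef hρ ξ b := (coefL hρ ξ).map_add a b
        simp [this])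
    (by intro c a ξ
        have : coef hρ ξ (c • a) = c • coef hρ ξ a := (coefL hρ ξ).map_smul c a
        simp [this])
    (by intro a ξ η
        have : coef hρ (ξ + η) a = coef hρ ξ a + coef hρ η a := R_ext fun γ => by simp
        simp [this])
    (by intro c a ξ
        have : coef hρ (c • ξ) a = c • coef hρ ξ a := R_ext fun γ => by simp
        simp [this])

lemma act_spec (hρ : Rat R ρ) (P : R →ₗ[F] R) (ξ : Dual F V) (v : V) :
    ξ (act hρ P v) = (P (coef hρ ξ v)).1 1 := by
  have : ξ (act hρ P v) = (evalEquiv F V (act hρ P v)) ξ := by simp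
  rw [this, act]; simp

lemma coef_act (hρ : Rat R ρ) {P : R →ₗ[F] R} (hP : LInv P) (ξ : Dual F V) (v : V) :
    coef hρ ξ (act hρ P v) = P (coef hρ ξ v) := by
  refine R_ext fun γ => ?_
  have h1 := act_spec hρ P (ξ ∘ₗ ρ γ) v
  have h2 := hP γ (coef hρ ξ v) (coef hρ (ξ ∘ₗ ρ γ) v) (fun h => by simp) 1
  rw [mul_one] at h2
  rw [← h2, ← h1]; simp

lemma act_eq_iff (hρ : Rat R ρ) {P : R →ₗ[F] R} (hP : LInv P) (v w : V) :
    act hρ P v = w ↔ ∀ ξ, P (coef hρ ξ v) = coef hρ ξ w := by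
  constructor
  · rintro rfl ξ; rw [coef_act hρ hP]
  · intro h; refine eq_of_coef hρ fun ξ => ?_
    rw [coef_act hρ hP, h]

lemma act_comp (hρ : Rat R ρ) {P Q : R →ₗ[F] R} (hP : LInv P) (hQ : LInv Q) :
    act hρ (P ∘ₗ Q) = act hρ P ∘ₗ act hρ Q := by
  ext v
  have hPQ : LInv ((P ∘ₗ Q : R →ₗ[F] R) : R → R) := LInv.comp (P := P) (Q := Q) hP hQ
  rw [act_eq_iff hρ hPQ]
  intro ξ
  simp [coef_act hρ hP, coef_act hρ hQ]

lemma act_natural (hρ : Rat R ρ) (hρ' : Rat R ρ') (P : R →ₗ[F] R) (f : V →ₗ[F] V')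
    (hf : ∀ γ v, f (ρ γ v) = ρ' γ (f v)) (v : V) : act hρ' P (f v) = f (act hρ P v) := by
  rw [← sub_eq_zero, ← Module.forall_dual_apply_eq_zero_iff F]
  intro ξ
  rw [map_sub, sub_eq_zero, act_spec]
  have := act_spec hρ P (ξ ∘ₗ f) v
  simp only [LinearMap.comp_apply] at this
  rw [this]
  have h2 : coef hρ' ξ (f v) = coef hρ (ξ ∘ₗ f) v := R_ext fun γ => by simp [hf]
  rw [h2]

lemma act_rt [Good R] (hρ : Rat R ρ) (γ : Γ) : act hρ (rt γ).toLinearMap = ρ γ := by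
  ext v
  rw [act_eq_iff hρ (linv_rt γ)]
  intro ξ
  exact R_ext fun h => by simp

/-- The differential of a rational representation. -/
noncomputable def dact (hρ : Rat R ρ) : lieG R →ₗ[F] End F V where
  toFun D := act hρ (D.1 : R →ₗ[F] R)
  map_add' a b := by
    ext v; refine eq_of_coef hρ fun ξ => R_ext fun γ => ?_
    rw [coef_act hρ (a + b).2]
    simp only [coef_apply, LinearMap.add_apply, map_add]
    have h1 := congrArg (fun f : R => f.1 γ) (coef_act hρ a.2 ξ v)
    have h2 := congrArg (fun f : R => f.1 γ) (coef_act hρ b.2 ξ v)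
    simp only [coef_apply] at h1 h2
    rw [h1, h2]; simp
  map_smul' c a := by
    ext v; refine eq_of_coef hρ fun ξ => R_ext fun γ => ?_
    rw [coef_act hρ (c • a).2]
    simp only [coef_apply, LinearMap.smul_apply, map_smul]
    have h1 := congrArg (fun f : R => f.1 γ) (coef_act hρ a.2 ξ v)
    simp only [coef_apply] at h1
    simp [h1]

lemma dact_apply (hρ : Rat R ρ) (D : lieG R) : dact hρ D = act hρ (D.1 : R →ₗ[F] R) := rfl

lemma coef_dact (hρ : Rat R ρ) (D : lieG R) (ξ : Dual F V) (v : V) :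
    coef hρ ξ (dact hρ D v) = D.1 (coef hρ ξ v) := coef_act hρ D.2 ξ v

lemma dact_lie (hρ : Rat R ρ) (a b : lieG R) :
    dact hρ ⁅a, b⁆ = dact hρ a * dact hρ b - dact hρ b * dact hρ a := by
  ext v; refine eq_of_coef hρ fun ξ => ?_
  change coef hρ ξ (act hρ _ v) = coefL hρ ξ _
  rw [coef_act hρ ⁅a, b⁆.2, LinearMap.sub_apply, map_sub]
  simp only [Module.End.mul_apply, coefL_apply, coef_dact]
  exact Derivation.commutator_apply (D1 := a.1) (D2 := b.1) (a := coef hρ ξ v)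

lemma dact_natural (hρ : Rat R ρ) (hρ' : Rat R ρ') (D : lieG R) (f : V →ₗ[F] V')
    (hf : ∀ γ v, f (ρ γ v) = ρ' γ (f v)) (v : V) : dact hρ' D (f v) = f (dact hρ D v) :=
  act_natural hρ hρ' _ f hf v

lemma dact_ad [Good R] (hρ : Rat R ρ) (γ : Γ) (D : lieG R) (v : V) :
    dact hρ (adRep R γ D) v = ρ γ (dact hρ D (ρ γ⁻¹ v)) := by
  rw [dact_apply, act_eq_iff hρ (adRep R γ D).2]
  intro ξ
  change rt γ (D.1 (rt γ⁻¹ _)) = _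
  refine R_ext fun h => ?_
  have h1 : rt γ⁻¹ (coef hρ ξ v) = coef hρ ξ (ρ γ⁻¹ v) := R_ext fun h => by simp
  rw [h1, ← coef_dact]
  simp

lemma rho_inv (ρ : Representation F Γ V) (γ : Γ) (v : V) : ρ γ⁻¹ (ρ γ v) = v := by
  simp [← Module.End.mul_apply, ← map_mul]

lemma rho_inv' (ρ : Representation F Γ V) (γ : Γ) (v : V) : ρ γ (ρ γ⁻¹ v) = v := by
  simp [← Module.End.mul_apply, ← map_mul]

end reps

end framework
end RG

namespace RG
open Module Polynomial

lemma lift_gen {F K B : Type} [Field F] [CharZero F] [Field K] [Algebra F K]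
    [Algebra.EssFiniteType F K] [CommRing B] [Algebra F B] (π : B →ₐ[F] K)
    (hπ : Function.Surjective π) (hker : IsNilpotent (RingHom.ker π)) (r : K)
    (hr : Transcendental F r) (b : B) (hb : π b = r) :
    ∃ s : K →ₐ[F] B, (∀ x, π (s x) = x) ∧ s r = b := by
  letI i1 : Algebra F[X] B := (aeval b).toRingHom.toAlgebra
  letI i2 : Algebra F[X] K := (aeval r).toRingHom.toAlgebra
  have e1 : ∀ p : F[X], algebraMap F[X] B p = aeval b p := fun _ => rfl
  have e2 : ∀ p : F[X], algebraMap F[X] K p = aeval r p := fun _ => rfl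
  have inj : Function.Injective (algebraMap F[X] K) := transcendental_iff_injective.1 hr
  haveI : FaithfulSMul F[X] K := (faithfulSMul_iff_algebraMap_injective _ _).2 inj
  haveI t1 : IsScalarTower F F[X] K := IsScalarTower.of_algebraMap_eq fun x => by
    rw [e2]; simp
  letI i3 : Algebra (FractionRing F[X]) K := FractionRing.liftAlgebra F[X] K
  haveI t2 : IsScalarTower F[X] (FractionRing F[X]) K := FractionRing.isScalarTower_liftAlgebra _ _
  haveI t3 : IsScalarTower F (FractionRing F[X]) K := by
    refine IsScalarTower.of_algebraMap_eq fun x => ?_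
    rw [IsScalarTower.algebraMap_apply F F[X] (FractionRing F[X]),
      ← IsScalarTower.algebraMap_apply F[X] (FractionRing F[X]) K,
      ← IsScalarTower.algebraMap_apply F F[X] K]
  haveI : Algebra.EssFiniteType (FractionRing F[X]) K := Algebra.EssFiniteType.of_comp F _ _
  haveI : CharZero (FractionRing F[X]) := by
    exact charZero_of_injective_algebraMap (R := F) (FaithfulSMul.algebraMap_injective F _)
  haveI : Algebra.FormallySmooth (FractionRing F[X]) K := inferInstance
  haveI : Algebra.FormallySmooth F[X] (FractionRing F[X]) :=
    .of_isLocalization (nonZeroDivisors F[X])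
  haveI : Algebra.FormallySmooth F[X] K := .comp _ (FractionRing F[X]) _
  let g : B →ₐ[F[X]] K := { π with
    commutes' := fun p => by
      change π (aeval b p) = aeval r p
      rw [← hb, aeval_algHom_apply] }
  let s := Algebra.FormallySmooth.liftOfSurjective (AlgHom.id F[X] K) g hπ hker
  have hs : ∀ x, g (s x) = x := fun x =>
    Algebra.FormallySmooth.liftOfSurjective_apply (AlgHom.id F[X] K) g hπ hker x
  refine ⟨{ s with
    commutes' := fun x => ?_ }, hs, ?_⟩
  · change s (algebraMap F K x) = _
    have h1 : algebraMap F K x = algebraMap F[X] K (C x) := by rw [e2]; simp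
    rw [h1, s.commutes, e1]; simp
  · change s r = b
    have h1 : r = algebraMap F[X] K X := by rw [e2]; simp
    rw [h1, s.commutes, e1]; simp

lemma exists_derivation {F K : Type} [Field F] [CharZero F] [Field K] [Algebra F K]
    [Algebra.EssFiniteType F K] (r : K) (hr : Transcendental F r) :
    ∃ d : Derivation F K K, d r = 1 := by
  obtain ⟨s, h1, h2⟩ := lift_gen (F := F) (TrivSqZeroExt.fstHom F K K)
    (TrivSqZeroExt.fst_surjective) ⟨2, by
      rw [pow_two, Ideal.zero_eq_bot, eq_bot_iff, Ideal.mul_le]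
      intro x hx y hy
      rw [RingHom.mem_ker] at hx hy
      simp at hx hy
      rw [Ideal.mem_bot]
      ext <;> simp [hx, hy]⟩ r hr
    (TrivSqZeroExt.inl r + TrivSqZeroExt.inr 1) (by simp)
  simp at h1
  refine ⟨Derivation.mk' (TrivSqZeroExt.sndHom K K |>.restrictScalars F |>.comp s.toLinearMap) ?_, ?_⟩
  · intro a b
    simp [h1, mul_comm]
  · simp [h2]

section core
variable {F : Type} [Field F] {Γ : Type} [Group Γ] {R : Subalgebra F (Γ → F)}

/-- Convolution with a functional: a left invariant operator. -/
def conv [hR : Good R] (δ : R →ₗ[F] F) : R →ₗ[F] R where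
  toFun f := ⟨fun h => δ (lt h f), by
    obtain ⟨k, a, b, hab⟩ := hR.comul f
    have h1 : ∀ h, lt h f = ∑ i, (a i).1 h • b i := fun h => R_ext fun x => by
      rw [lt_apply, hab]
      simp [Finset.sum_apply]
    have : (fun h => δ (lt h f)) = ∑ i, δ (b i) • (a i).1 := by
      funext h; rw [h1]; simp [Finset.sum_apply, mul_comm]
    rw [this]
    exact R.sum_mem fun i _ => R.smul_mem (a i).2 _⟩
  map_add' f g := R_ext fun h => by simp
  map_smul' c f := R_ext fun h => by simp

@[simp] lemma conv_apply [Good R] (δ : R →ₗ[F] F) (f : R) (h : Γ) :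
    (conv δ f).1 h = δ (lt h f) := rfl

lemma linv_conv [Good R] (δ : R →ₗ[F] F) : LInv (conv δ : R → R) := by
  intro γ f f' hf h
  simp only [conv_apply]
  congr 1
  exact R_ext fun x => by simp [hf, mul_assoc]

/-- Left invariant derivation from a point derivation at `1`. -/
def ofPoint [Good R] (δ : R →ₗ[F] F) (hδ : ∀ f g : R, δ (f * g) = f.1 1 * δ g + g.1 1 * δ f) :
    lieG R :=
  ⟨Derivation.mk' (conv δ) (by
    intro a b
    refine R_ext fun h => ?_
    simp [hδ]), linv_conv δ⟩

@[simp] lemma ofPoint_apply [Good R] (δ : R →ₗ[F] F) (hδ) (f : R) (h : Γ) :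
    ((ofPoint δ hδ).1 f).1 h = δ (lt h f) := rfl

instance [hR : Good R] : IsDomain R := by
  haveI : NoZeroDivisors R := ⟨fun {a b} h => hR.dom a b h⟩
  haveI : Nontrivial R := ⟨⟨0, 1, fun h => by
    have := congrArg (fun f : R => f.1 1) h
    simp at this⟩⟩
  exact NoZeroDivisors.to_isDomain R

instance [hR : Good R] : Algebra.FiniteType F R := (R.fg_iff_finiteType).1 hR.fg

lemma clear_denom {A : Type} [CommRing A] [IsDomain A] [Algebra F A] [hA : Algebra.FiniteType F A]
    (d : Derivation F (FractionRing A) (FractionRing A)) :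
    ∃ (m : A) (e : Derivation F A A), m ≠ 0 ∧
      ∀ f, algebraMap A (FractionRing A) (e f) =
        algebraMap A (FractionRing A) m * d (algebraMap A (FractionRing A) f) := by
  classical
  obtain ⟨s, hs⟩ := hA.out
  obtain ⟨m, hm⟩ := IsLocalization.exist_integer_multiples_of_finset (nonZeroDivisors A)
    (s.image fun x => d (algebraMap A (FractionRing A) x))
  have inj := IsFractionRing.injective A (FractionRing A)
  have key : ∀ f : A, ∃ g : A, algebraMap A (FractionRing A) g =
      algebraMap A (FractionRing A) m * d (algebraMap A (FractionRing A) f) := by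
    intro f
    have hf : f ∈ Algebra.adjoin F (s : Set A) := by rw [hs]; trivial
    induction hf using Algebra.adjoin_induction with
    | mem x hx =>
      obtain ⟨g, hg⟩ := hm _ (Finset.mem_image_of_mem _ hx)
      exact ⟨g, by rw [hg, Algebra.smul_def]⟩
    | algebraMap r =>
      refine ⟨0, ?_⟩
      rw [← IsScalarTower.algebraMap_apply F A (FractionRing A)]
      simp
    | add x y _ _ hx hy =>
      obtain ⟨g, hg⟩ := hx; obtain ⟨g', hg'⟩ := hy
      exact ⟨g + g', by rw [map_add, map_add, map_add, hg, hg', mul_add]⟩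
    | mul x y _ _ hx hy =>
      obtain ⟨g, hg⟩ := hx; obtain ⟨g', hg'⟩ := hy
      refine ⟨x * g' + y * g, ?_⟩
      simp only [map_mul, map_add, hg, hg', Derivation.leibniz, smul_eq_mul]
      ring
  choose e he using key
  refine ⟨m, Derivation.mk'
    { toFun := e
      map_add' := fun x y => inj (by simp only [map_add, he]; ring)
      map_smul' := fun c x => inj (by
        have : algebraMap A (FractionRing A) (c • x) = c • algebraMap A (FractionRing A) x := by
          simp [Algebra.smul_def, ← IsScalarTower.algebraMap_apply F A (FractionRing A)]
        have h2 : algebraMap A (FractionRing A) (c • e x) = c • algebraMap A (FractionRing A) (e x) := by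
          simp [Algebra.smul_def, ← IsScalarTower.algebraMap_apply F A (FractionRing A)]
        rw [RingHom.id_apply, h2, he, he, this, Derivation.map_smul, mul_smul_comm]) }
    (fun a b => inj (by
      change algebraMap A (FractionRing A) (e (a * b)) =
        algebraMap A (FractionRing A) (a * e b + b * e a)
      simp only [map_mul, map_add, he, Derivation.leibniz, smul_eq_mul]; ring)),
    nonZeroDivisors.ne_zero m.2, he⟩

lemma core_alg [IsAlgClosed F] [CharZero F] {A : Type} [CommRing A] [IsDomain A] [Algebra F A]
    [hA : Algebra.FiniteType F A] (a b : A) (hb : b ≠ 0) :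
    (∃ c : F, a = c • b) ∨ ∃ e : Derivation F A A, b * e a - a * e b ≠ 0 := by
  have inj := IsFractionRing.injective A (FractionRing A)
  have hbK : algebraMap A (FractionRing A) b ≠ 0 := fun hh => hb (inj (by rw [hh, map_zero]))
  obtain ⟨r, hr⟩ : ∃ r : FractionRing A, algebraMap A (FractionRing A) a =
      r * algebraMap A (FractionRing A) b :=
    ⟨algebraMap A (FractionRing A) a / algebraMap A (FractionRing A) b,
      (div_mul_cancel₀ _ hbK).symm⟩
  by_cases htr : Transcendental F r
  · right
    haveI : Algebra.EssFiniteType A (FractionRing A) :=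
      Algebra.EssFiniteType.of_isLocalization _ (nonZeroDivisors A)
    haveI : Algebra.EssFiniteType F (FractionRing A) := Algebra.EssFiniteType.comp F A _
    obtain ⟨d, hd⟩ := exists_derivation r htr
    obtain ⟨m, e, hm, he⟩ := clear_denom (A := A) d
    refine ⟨e, fun h0 => ?_⟩
    have h2 := congrArg (algebraMap A (FractionRing A)) h0
    rw [map_sub, map_mul, map_mul, he, he, hr, Derivation.leibniz, hd, map_zero] at h2
    have hmK : algebraMap A (FractionRing A) m ≠ 0 := fun hh => hm (inj (by rw [hh, map_zero]))
    have h3 : algebraMap A (FractionRing A) m * algebraMap A (FractionRing A) b *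
        algebraMap A (FractionRing A) b = 0 := by
      rw [← h2]; simp only [smul_eq_mul]; ring
    exact mul_ne_zero (mul_ne_zero hmK hbK) hbK h3
  · left
    have hal : IsIntegral F r := (not_not.1 htr).isIntegral
    have hdeg := IsAlgClosed.degree_eq_one_of_irreducible F (minpoly.irreducible hal)
    obtain ⟨c, hc⟩ := minpoly.mem_range_of_degree_eq_one F r hdeg
    refine ⟨c, inj ?_⟩
    rw [hr, Algebra.smul_def, map_mul, ← IsScalarTower.algebraMap_apply F A (FractionRing A), hc]

lemma core [IsAlgClosed F] [CharZero F] [hR : Good R] (a b : R) (hb : b ≠ 0)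
    (h : ∀ D : lieG R, b * D.1 a = a * D.1 b) : ∃ c : F, a = c • b := by
  rcases core_alg (F := F) a b hb with hc | ⟨e, h1⟩
  · exact hc
  · exfalso
    obtain ⟨γ, hγ⟩ : ∃ γ, (b * e a - a * e b).1 γ ≠ 0 := by
      by_contra! hh
      exact h1 (R_ext fun γ => by rw [hh]; rfl)
    let δ : R →ₗ[F] F :=
      { toFun := fun f => (e (lt γ⁻¹ f)).1 γ
        map_add' := fun f g => by simp
        map_smul' := fun c f => by simp }
    have hδ : ∀ f g : R, δ (f * g) = f.1 1 * δ g + g.1 1 * δ f := by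
      intro f g
      change (e (lt γ⁻¹ (f * g))).1 γ = f.1 1 * (e (lt γ⁻¹ g)).1 γ + g.1 1 * (e (lt γ⁻¹ f)).1 γ
      rw [map_mul, Derivation.leibniz]
      simp
    have hv : ∀ f : R, ((ofPoint δ hδ).1 f).1 γ = (e f).1 γ := by
      intro f
      rw [ofPoint_apply]
      change (e (lt γ⁻¹ (lt γ f))).1 γ = _
      have hff : lt γ⁻¹ (lt γ f) = f := R_ext fun x => by simp
      rw [hff]
    apply hγ
    have h3 := congrArg (fun f : R => f.1 γ) (h (ofPoint δ hδ))
    change b.1 γ * ((ofPoint δ hδ).1 a).1 γ = a.1 γ * ((ofPoint δ hδ).1 b).1 γ at h3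
    rw [hv, hv] at h3
    change b.1 γ * (e a).1 γ - a.1 γ * (e b).1 γ = 0
    rw [h3, sub_self]
end core
end RG

namespace RG
open Module Polynomial
section core
variable {F : Type} [Field F] {Γ : Type} [Group Γ] {R : Subalgebra F (Γ → F)}
variable {V V' : Type} [AddCommGroup V] [Module F V] [FiniteDimensional F V]
  [AddCommGroup V'] [Module F V'] [FiniteDimensional F V']
variable {ρ : Representation F Γ V} {ρ' : Representation F Γ V'}

lemma fixed_of_dact [IsAlgClosed F] [CharZero F] [hR : Good R] (hρ : Rat R ρ) (v : V)
    (h : ∀ D : lieG R, dact hρ D v = 0) (γ : Γ) : ρ γ v = v := by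
  rw [← sub_eq_zero, ← Module.forall_dual_apply_eq_zero_iff F]
  intro ξ
  obtain ⟨c, hc⟩ := core (R := R) (coef hρ ξ v) 1 one_ne_zero (fun D => by
    rw [← coef_dact, h]
    rw [Derivation.map_one_eq_zero, mul_zero, one_mul]
    exact R_ext fun γ => by simp)
  have h1 := congrArg (fun f : R => f.1 γ) hc
  have h2 := congrArg (fun f : R => f.1 1) hc
  simp at h1 h2
  rw [map_sub, h1, h2, sub_self]

lemma det_deriv {A : Type} [CommRing A] [Algebra F A] (D : Derivation F A A) {k : ℕ}
    (M N X : Matrix (Fin k) (Fin k) A) (hM : M.map D = M * X) (hN : N.map D = N * X) :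
    N.det * D M.det = M.det * D N.det := by
  let φ : A →+* TrivSqZeroExt A A :=
    { toFun := fun f => TrivSqZeroExt.inl f + TrivSqZeroExt.inr (D f)
      map_one' := by ext <;> simp
      map_mul' := fun a b => by ext <;> simp [mul_comm]
      map_zero' := by ext <;> simp
      map_add' := fun a b => by ext <;> simp }
  have key : ∀ M : Matrix (Fin k) (Fin k) A, M.map D = M * X →
      φ.mapMatrix M = (TrivSqZeroExt.inlHom A A).mapMatrix M *
        (1 + (TrivSqZeroExt.inr 1 : TrivSqZeroExt A A) • (TrivSqZeroExt.inlHom A A).mapMatrix X) := by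
    intro M hM
    rw [mul_add, mul_one, mul_smul_comm, ← map_mul, ← hM]
    ext i j <;> simp [φ]
  have h1 := φ.map_det M
  have h2 := φ.map_det N
  rw [key M hM, Matrix.det_mul, ← RingHom.map_det] at h1
  rw [key N hN, Matrix.det_mul, ← RingHom.map_det] at h2
  have h3 : φ M.det * TrivSqZeroExt.inl N.det = φ N.det * TrivSqZeroExt.inl M.det := by
    rw [h1, h2]
    simp only [TrivSqZeroExt.inlHom_apply]; ring
  have h4 := congrArg TrivSqZeroExt.snd h3
  simpa [φ, mul_comm] using h4

lemma stable_of_dact [IsAlgClosed F] [CharZero F] [hR : Good R] (hρ : Rat R ρ) (M : Submodule F V)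
    (h : ∀ D : lieG R, ∀ v ∈ M, dact hρ D v ∈ M) (γ : Γ) : ∀ v ∈ M, ρ γ v ∈ M := by
  classical
  let b := Module.finBasis F M
  set k := finrank F M
  have hx : ∀ i, ∃ ξ : Dual F V, ∀ j, ξ (b j) = if j = i then 1 else 0 := by
    intro i
    obtain ⟨ξ, hξ⟩ := LinearMap.exists_extend (b.coord i)
    refine ⟨ξ, fun j => ?_⟩
    have := LinearMap.congr_fun hξ (b j)
    simp at this
    rw [this, Finsupp.single_apply]
  choose ξ hξ using hx
  let mat (η : Fin k → Dual F V) : Matrix (Fin k) (Fin k) R := Matrix.of fun i j => coef hρ (η i) (b j)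
  have hmat : ∀ (D : lieG R) (η : Fin k → Dual F V), (mat η).map D.1 = mat η *
      Matrix.of (fun l j => algebraMap F R (b.repr ⟨dact hρ D (b j), h D _ (b j).2⟩ l)) := by
    intro D η
    ext1 i j
    rw [Matrix.map_apply, Matrix.mul_apply]
    change D.1 (coef hρ (η i) (b j)) = ∑ l, coef hρ (η i) (b l) * _
    rw [← coef_dact]
    have h1 : dact hρ D (b j) = ∑ l, b.repr ⟨dact hρ D (b j), h D _ (b j).2⟩ l • (b l : V) := by
      have := congrArg (Submodule.subtype M) (b.sum_repr ⟨dact hρ D (b j), h D _ (b j).2⟩)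
      rw [map_sum] at this
      simpa using this.symm
    conv_lhs => rw [h1]
    rw [← coefL_apply, map_sum]
    refine Finset.sum_congr rfl fun l _ => ?_
    rw [map_smul, coefL_apply, Matrix.of_apply, mul_comm, ← Algebra.smul_def]
  have ev : ∀ η : Fin k → Dual F V, ((mat η).det).1 1 =
      (Matrix.of fun i j => η i (b j)).det := by
    intro η
    let e1 : R →+* F := (Pi.evalRingHom (fun _ : Γ => F) 1).comp R.val.toRingHom
    change e1 ((mat η).det) = _
    rw [RingHom.map_det]
    congr 1
    ext i j
    change η i (ρ 1 (b j)) = _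
    simp
  have hdet1 : ((mat ξ).det).1 1 = 1 := by
    have h1 : (Matrix.of fun i j => ξ i (b j)) = (1 : Matrix (Fin k) (Fin k) F) := by
      ext i j
      simp [hξ, Matrix.one_apply, eq_comm]
    rw [ev, h1, Matrix.det_one]
  have hdet : (mat ξ).det ≠ 0 := fun h0 => by
    rw [h0] at hdet1; simp at hdet1
  have key : ∀ η : Dual F V, (∀ v ∈ M, η v = 0) → ∀ j, coef hρ η (b j) = 0 := by
    intro η hη
    have hz : ∀ i, (mat (Function.update ξ i η)).det = 0 := by
      intro i
      obtain ⟨c, hc⟩ := core (mat (Function.update ξ i η)).det (mat ξ).det hdet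
        (fun D => det_deriv D.1 _ _ _ (hmat D _) (hmat D _))
      have h0 : ((mat (Function.update ξ i η)).det).1 1 = 0 := by
        rw [ev]
        apply Matrix.det_eq_zero_of_row_eq_zero i
        intro j
        simp [hη _ (b j).2]
      rw [hc] at h0
      have : c = 0 := by
        change c * ((mat ξ).det).1 1 = 0 at h0
        simpa [hdet1] using h0
      rw [hc, this, zero_smul]
    have hu : ∀ i, mat (Function.update ξ i η) =
        (mat ξ).updateRow i (fun j => coef hρ η (b j)) := by
      intro i
      ext1 a j
      by_cases ha : a = i
      · subst ha; simp [mat]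
      · simp [mat, ha]
    have hcr := Matrix.mulVec_cramer (mat ξ).transpose (fun j => coef hρ η (b j))
    have hc0 : Matrix.cramer (mat ξ).transpose (fun j => coef hρ η (b j)) = 0 := by
      ext1 i
      rw [Matrix.cramer_transpose_apply, ← hu, hz]; rfl
    rw [hc0, Matrix.mulVec_zero, Matrix.det_transpose] at hcr
    intro j
    have := congrFun hcr j
    simp only [Pi.zero_apply, Pi.smul_apply, smul_eq_mul] at this
    exact (mul_eq_zero.1 this.symm).resolve_left hdet
  intro v hv
  by_contra hnot
  obtain ⟨η, hη1, hη2⟩ := Submodule.exists_dual_map_eq_bot_of_notMem hnot inferInstance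
  apply hη1
  have hη : ∀ v ∈ M, η v = 0 := fun w hw => by
    have : η w ∈ M.map η := Submodule.mem_map_of_mem hw
    exact (Submodule.mem_bot F).1 (hη2 ▸ this)
  have hv2 : v = ∑ j, b.repr ⟨v, hv⟩ j • (b j : V) := by
    have := congrArg (Submodule.subtype M) (b.sum_repr ⟨v, hv⟩)
    rw [map_sum] at this
    simpa using this.symm
  rw [hv2]
  simp only [map_sum, map_smul]
  refine Finset.sum_eq_zero fun j _ => ?_
  have := congrArg (fun f : R => f.1 γ) (key η hη j)
  simp at this
  rw [this, smul_zero]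

end core
end RG

namespace RG
open Module Polynomial
section clos
variable {F : Type} [Field F] {Γ : Type} [Group Γ] {R : Subalgebra F (Γ → F)}
variable {V V' : Type} [AddCommGroup V] [Module F V] [AddCommGroup V'] [Module F V'] 
variable {ρ : Representation F Γ V} {ρ' : Representation F Γ V'}

/-- A stable submodule. -/
def Stab (ρ : Representation F Γ V) (U : Submodule F V) : Prop := ∀ γ, ∀ v ∈ U, ρ γ v ∈ U

/-- Subrepresentation. -/
def subRep (ρ : Representation F Γ V) (U : Submodule F V) (hU : Stab ρ U) : Representation F Γ U where
  toFun γ := (ρ γ).restrict (hU γ)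
  map_one' := by ext v; simp
  map_mul' a b := by ext v; simp

@[simp] lemma subRep_apply (U : Submodule F V) (hU : Stab ρ U) (γ : Γ) (v : U) :
    (subRep ρ U hU γ v : V) = ρ γ v := rfl

/-- Quotient representation. -/
def quoRep (ρ : Representation F Γ V) (U : Submodule F V) (hU : Stab ρ U) :
    Representation F Γ (V ⧸ U) where
  toFun γ := U.mapQ U (ρ γ) (hU γ)
  map_one' := by ext v; simp
  map_mul' a b := by ext v; simp

@[simp] lemma quoRep_mk (U : Submodule F V) (hU : Stab ρ U) (γ : Γ) (v : V) :
    quoRep ρ U hU γ (Submodule.Quotient.mk v) = Submodule.Quotient.mk (ρ γ v) := rfl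

lemma Rat.of_inj (hρ' : Rat R ρ') (f : V →ₗ[F] V') (hf : ∀ γ v, f (ρ γ v) = ρ' γ (f v))
    (hinj : Function.Injective f) : Rat R ρ := by
  intro ξ v
  obtain ⟨g, hg⟩ := f.exists_leftInverse_of_injective (LinearMap.ker_eq_bot.2 hinj)
  have : (fun γ => ξ (ρ γ v)) = fun γ => (ξ ∘ₗ g) (ρ' γ (f v)) := by
    funext γ
    rw [← hf]
    have := LinearMap.congr_fun hg (ρ γ v)
    simp at this
    simp [this]
  rw [this]; exact hρ' _ _

lemma Rat.of_surj (hρ : Rat R ρ) (f : V →ₗ[F] V') (hf : ∀ γ v, f (ρ γ v) = ρ' γ (f v))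
    (hsurj : Function.Surjective f) : Rat R ρ' := by
  intro ξ v
  obtain ⟨w, rfl⟩ := hsurj v
  simp only [← hf]
  exact hρ (ξ ∘ₗ f) w

lemma Rat.sub (hρ : Rat R ρ) (U : Submodule F V) (hU : Stab ρ U) : Rat R (subRep ρ U hU) :=
  hρ.of_inj U.subtype (fun _ _ => rfl) Subtype.val_injective

lemma Rat.quo (hρ : Rat R ρ) (U : Submodule F V) (hU : Stab ρ U) : Rat R (quoRep ρ U hU) :=
  hρ.of_surj U.mkQ (fun _ _ => rfl) U.mkQ_surjective

/-- Product representation. -/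
def prodRep (ρ : Representation F Γ V) (ρ' : Representation F Γ V') :
    Representation F Γ (V × V') where
  toFun γ := (ρ γ).prodMap (ρ' γ)
  map_one' := by ext v <;> simp
  map_mul' a b := by ext v <;> simp

@[simp] lemma prodRep_apply (γ : Γ) (v : V × V') :
    prodRep ρ ρ' γ v = (ρ γ v.1, ρ' γ v.2) := rfl

lemma Rat.prod (hρ : Rat R ρ) (hρ' : Rat R ρ') : Rat R (prodRep ρ ρ') := by
  intro ξ v
  have : (fun γ => ξ (prodRep ρ ρ' γ v)) =
      (fun γ => (ξ ∘ₗ LinearMap.inl F V V') (ρ γ v.1)) + 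
      (fun γ => (ξ ∘ₗ LinearMap.inr F V V') (ρ' γ v.2)) := by
    funext γ
    simp [← map_add]
  rw [this]
  exact R.add_mem (hρ _ _) (hρ' _ _)

variable [FiniteDimensional F V] [FiniteDimensional F V']

lemma Rat.of_sep (S : Set (Dual F V)) (hS : ∀ v, (∀ ξ ∈ S, ξ v = 0) → v = 0)
    (h : ∀ ξ ∈ S, ∀ v, (fun γ => ξ (ρ γ v)) ∈ R) : Rat R ρ := by
  let P : Submodule F (Dual F V) :=
    { carrier := {ξ | ∀ v, (fun γ => ξ (ρ γ v)) ∈ R}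
      zero_mem' := fun v => R.zero_mem
      add_mem' := fun ha hb v => R.add_mem (ha v) (hb v)
      smul_mem' := fun c a ha v => R.smul_mem (ha v) c }
  have hSP : S ⊆ P := fun ξ hξ => h ξ hξ
  have hP : P = ⊤ := by
    have h1 : P.dualCoannihilator = ⊥ := by
      rw [eq_bot_iff]
      intro v hv
      rw [Submodule.mem_dualCoannihilator] at hv
      exact (Submodule.mem_bot F).2 (hS v fun ξ hξ => hv ξ (hSP hξ))
    have h2 := Subspace.dualCoannihilator_dualAnnihilator_eq (W := P)
    rw [← h2, h1]
    simp
  intro ξ v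
  have : ξ ∈ P := by rw [hP]; trivial
  exact this v

lemma Rat.linHom [hR : Good R] (hρ : Rat R ρ) (hρ' : Rat R ρ') :
    Rat R (Representation.linHom ρ ρ') := by
  let b := Module.finBasis F V
  refine Rat.of_sep {ξ | ∃ (η : Dual F V') (v : V), ∀ φ, ξ φ = η (φ v)} ?_ ?_
  · intro φ hφ
    ext v
    rw [LinearMap.zero_apply, ← Module.forall_dual_apply_eq_zero_iff F]
    intro η
    exact hφ (η ∘ₗ LinearMap.applyₗ v) ⟨η, v, fun _ => rfl⟩
  · rintro ξ ⟨η, v, hξ⟩ φ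
    have : (fun γ => ξ (Representation.linHom ρ ρ' γ φ)) =
        ∑ k, (fun γ => (coef hρ (b.coord k) v).1 γ⁻¹) * (coef hρ' η (φ (b k))).1 := by
      funext γ
      rw [hξ, Representation.linHom_apply]
      simp only [LinearMap.comp_apply, Finset.sum_apply, Pi.mul_apply, coef_apply]
      conv_lhs => rw [← b.sum_repr (ρ γ⁻¹ v)]
      simp only [map_sum, map_smul, smul_eq_mul, Basis.coord_apply]
    rw [this]
    exact R.sum_mem fun k _ => R.mul_mem (hR.inv _) (coef hρ' η (φ (b k))).2

lemma dact_sub (hρ : Rat R ρ) (U : Submodule F V) (hU : Stab ρ U) (D : lieG R) (v : U) :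
    (dact (hρ.sub U hU) D v : V) = dact hρ D v :=
  (dact_natural (hρ.sub U hU) hρ D U.subtype (fun _ _ => rfl) v).symm

lemma dact_quo (hρ : Rat R ρ) (U : Submodule F V) (hU : Stab ρ U) (D : lieG R) (v : V) :
    dact (hρ.quo U hU) D (Submodule.Quotient.mk v) = Submodule.Quotient.mk (dact hρ D v) :=
  (dact_natural hρ (hρ.quo U hU) D U.mkQ (fun _ _ => rfl) v)

lemma dact_mem (hρ : Rat R ρ) (U : Submodule F V) (hU : Stab ρ U) (D : lieG R) (v : V) (hv : v ∈ U) :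
    dact hρ D v ∈ U := by
  have := dact_sub hρ U hU D ⟨v, hv⟩
  rw [← this]; exact SetLike.coe_mem _

lemma dact_prod (hρ : Rat R ρ) (hρ' : Rat R ρ') (D : lieG R) (v : V × V') :
    dact (hρ.prod hρ') D v = (dact hρ D v.1, dact hρ' D v.2) := by
  have h1 := dact_natural (hρ.prod hρ') hρ D (LinearMap.fst F V V') (fun _ _ => rfl) v
  have h2 := dact_natural (hρ.prod hρ') hρ' D (LinearMap.snd F V V') (fun _ _ => rfl) v
  exact Prod.ext h1.symm h2.symm

lemma Stab.smulk {U : Submodule F V} (hU : Stab ρ U) (γ : Γ) {v : V} (h : ρ γ v ∈ U) : v ∈ U := by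
  have := hU γ⁻¹ _ h
  rwa [rho_inv] at this

end clos
end RG

namespace RG
open Module Polynomial
section lin
variable {F : Type} [Field F] {V : Type} [AddCommGroup V] [Module F V]

lemma exists_diag {ι : Type} (N : ι → Submodule F V) (h1 : iSupIndep N) (h2 : iSup N = ⊤)
    (c : ι → F) : ∃ Q : V →ₗ[F] V, ∀ i, ∀ x ∈ N i, Q x = c i • x := by
  classical
  have hI := DirectSum.isInternal_submodule_of_iSupIndep_of_iSup_eq_top h1 h2
  let e := LinearEquiv.ofBijective (DirectSum.coeLinearMap N) hI
  refine ⟨(DirectSum.toModule F ι V fun i => c i • (N i).subtype) ∘ₗ e.symm.toLinearMap, ?_⟩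
  intro i x hx
  have : e.symm x = DirectSum.lof F ι (fun i => N i) i ⟨x, hx⟩ := by
    rw [LinearEquiv.symm_apply_eq]
    exact (DirectSum.coeLinearMap_lof N i ⟨x, hx⟩).symm
  simp [this]

lemma trace_genEig [CharZero F] [FiniteDimensional F V] (f : End F V) (μ : F)
    (hf : Set.MapsTo f (f.maxGenEigenspace μ) (f.maxGenEigenspace μ)) :
    LinearMap.trace F _ (f.restrict hf) = μ * finrank F (f.maxGenEigenspace μ) := by
  have h1 := f.isNilpotent_restrict_maxGenEigenspace_sub_algebraMap μ
  have h2 := (LinearMap.isNilpotent_trace_of_isNilpotent h1).eq_zero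
  have h3 : f.restrict hf = (f - algebraMap F (End F V) μ).restrict
      (f.mapsTo_maxGenEigenspace_of_comm (Algebra.mul_sub_algebraMap_commutes f μ) μ) + μ • 1 := by
    ext v
    change f v.1 = (f v.1 - μ • v.1) + μ • v.1
    abel
  rw [h3, map_add, map_smul, h2]
  simp

lemma nilp_of_trace [IsAlgClosed F] [CharZero F] [FiniteDimensional F V] (f : End F V)
    (g : (F →ₗ[ℚ] ℚ) → End F V)
    (hg : ∀ φ μ, ∀ x ∈ f.maxGenEigenspace μ, g φ x = ((φ μ : ℚ) : F) • x)
    (htr : ∀ φ, LinearMap.trace F V (f ∘ₗ g φ) = 0) : IsNilpotent f := by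
  classical
  have hI := DirectSum.isInternal_submodule_of_iSupIndep_of_iSup_eq_top
    f.independent_maxGenEigenspace f.iSup_maxGenEigenspace_eq_top
  have hfin : {μ | f.maxGenEigenspace μ ≠ ⊥}.Finite :=
    WellFoundedGT.finite_ne_bot_of_iSupIndep hI.submodule_iSupIndep
  have hmf : ∀ μ, Set.MapsTo f (f.maxGenEigenspace μ) (f.maxGenEigenspace μ) := fun μ =>
    f.mapsTo_maxGenEigenspace_of_comm (Commute.refl _) μ
  have key : ∀ φ : F →ₗ[ℚ] ℚ, ∑ μ ∈ hfin.toFinset,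
      ((φ μ : ℚ) : F) * (μ * finrank F (f.maxGenEigenspace μ)) = 0 := by
    intro φ
    have hm : ∀ μ, Set.MapsTo (f ∘ₗ g φ) (f.maxGenEigenspace μ) (f.maxGenEigenspace μ) := by
      intro μ x hx
      rw [LinearMap.comp_apply, hg φ μ x hx, map_smul]
      exact Submodule.smul_mem _ _ (hmf μ hx)
    rw [← htr φ, LinearMap.trace_eq_sum_trace_restrict' hI hfin hm]
    refine Finset.sum_congr rfl fun μ _ => ?_
    have : (f ∘ₗ g φ).restrict (hm μ) = ((φ μ : ℚ) : F) • f.restrict (hmf μ) := by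
      ext x
      change f (g φ x.1) = ((φ μ : ℚ) : F) • f x.1
      rw [hg φ μ x.1 x.2, map_smul]
    rw [this, map_smul, trace_genEig, smul_eq_mul]
  have hz : ∀ μ, f.maxGenEigenspace μ ≠ ⊥ → μ = 0 := by
    intro μ hμ
    rw [← Module.forall_dual_apply_eq_zero_iff ℚ]
    intro φ
    have h1 := congrArg φ (key φ)
    rw [map_zero, map_sum] at h1
    have h2 : ∑ μ ∈ hfin.toFinset, (φ μ) ^ 2 * (finrank F (f.maxGenEigenspace μ) : ℚ) = 0 := by
      rw [← h1]
      refine Finset.sum_congr rfl fun ν _ => ?_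
      have : ((φ ν : ℚ) : F) * (ν * finrank F (f.maxGenEigenspace ν)) =
          (φ ν * (finrank F (f.maxGenEigenspace ν) : ℚ)) • ν := by
        rw [Algebra.smul_def]; simp; ring
      rw [this, map_smul, smul_eq_mul]; ring
    rw [Finset.sum_eq_zero_iff_of_nonneg (fun _ _ => by positivity)] at h2
    have h3 := h2 μ (by simpa using hμ)
    have h4 : finrank F (f.maxGenEigenspace μ) ≠ 0 := by
      rw [Ne, Submodule.finrank_eq_zero]; exact hμ
    simpa [h4] using h3
  have htop : f.maxGenEigenspace 0 = ⊤ := by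
    rw [eq_top_iff, ← f.iSup_maxGenEigenspace_eq_top]
    refine iSup_le fun μ => ?_
    by_cases hμ : f.maxGenEigenspace μ = ⊥
    · rw [hμ]; exact bot_le
    · rw [hz μ hμ]
  refine ⟨finrank F V, ?_⟩
  have := f.maxGenEigenspace_eq_genEigenspace_finrank 0
  rw [htop] at this
  ext v
  have hv : v ∈ (f.genEigenspace 0) (finrank F V : ℕ∞) := by
    rw [← this]; trivial
  simpa [Module.End.mem_genEigenspace_nat] using hv

end lin

section reps
variable {F : Type} [Field F] {Γ : Type} [Group Γ] {R : Subalgebra F (Γ → F)}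
variable {V V' : Type} [AddCommGroup V] [Module F V] [FiniteDimensional F V]
  [AddCommGroup V'] [Module F V'] [FiniteDimensional F V']
variable {ρ : Representation F Γ V} {ρ' : Representation F Γ V'}

lemma coef_genEig (hρ : Rat R ρ) {P : R →ₗ[F] R} (hP : LInv P) (μ : F) {v : V}
    (hv : v ∈ End.maxGenEigenspace (act hρ P) μ) (ξ : Dual F V) :
    coef hρ ξ v ∈ End.maxGenEigenspace P μ := by
  rw [End.mem_maxGenEigenspace] at hv ⊢
  obtain ⟨k, hk⟩ := hv
  refine ⟨k, ?_⟩
  have : ∀ k : ℕ, ∀ w, coefL hρ ξ (((act hρ P - μ • 1) ^ k) w) = ((P - μ • 1 : End F R) ^ k) (coef hρ ξ w) := by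
    intro k
    induction k with
    | zero => intro w; simp
    | succ k ih =>
      intro w
      rw [pow_succ, End.mul_apply, ih, pow_succ, End.mul_apply]
      congr 1
      rw [LinearMap.sub_apply, ← coefL_apply, map_sub]
      simp [coef_act hρ hP]
  rw [← this, hk, map_zero]

/-- Right regular span of a function, as a rational finite-dimensional representation. -/
lemma exists_fd [hR : Good R] (f : R) : ∃ (W : Type) (_ : AddCommGroup W) (_ : Module F W)
    (_ : FiniteDimensional F W) (σ : Representation F Γ W) (hσ : Rat R σ) (ξ : Dual F W) (w : W),
    coef hσ ξ w = f := by
  let W : Submodule F R := Submodule.span F (Set.range fun γ => rt γ f)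
  have hfd : FiniteDimensional F W := by
    obtain ⟨k, a, b, hab⟩ := hR.comul f
    have hle : W ≤ Submodule.span F (Set.range a) := by
      refine Submodule.span_le.2 ?_
      rintro _ ⟨γ, rfl⟩
      have : rt γ f = ∑ i, (b i).1 γ • a i := R_ext fun x => by
        rw [rt_apply, hab]
        simp [Finset.sum_apply, mul_comm]
      change rt γ f ∈ _
      rw [this]
      exact Submodule.sum_mem _ fun i _ => Submodule.smul_mem _ _ (Submodule.subset_span ⟨i, rfl⟩)
    haveI : FiniteDimensional F (Submodule.span F (Set.range a)) :=
      FiniteDimensional.span_of_finite F (Set.finite_range a)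
    exact Submodule.finiteDimensional_of_le hle
  have hst : ∀ γ, ∀ w ∈ W, (rt γ).toLinearMap w ∈ W := by
    intro γ w hw
    have : W ≤ W.comap (rt γ).toLinearMap := by
      refine Submodule.span_le.2 ?_
      rintro _ ⟨δ, rfl⟩
      refine Submodule.subset_span ⟨γ * δ, ?_⟩
      exact rt_mul γ δ f
    exact this hw
  let σ : Representation F Γ W :=
    { toFun := fun γ => (rt γ).toLinearMap.restrict (hst γ)
      map_one' := by ext w; simp
      map_mul' := fun a b => by ext w; simp [rt_mul] }
  let ev : Γ → Dual F W := fun h => 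
    { toFun := fun w => w.1.1 h
      map_add' := fun _ _ => rfl
      map_smul' := fun _ _ => rfl }
  have hσ : @Rat F _ Γ _ W _ _ R σ := by
    refine Rat.of_sep (Set.range ev) ?_ ?_
    · intro v hv
      exact Subtype.ext (R_ext fun h => hv _ ⟨h, rfl⟩)
    · rintro _ ⟨h, rfl⟩ v
      exact (lt h v.1).2
  refine ⟨W, inferInstance, inferInstance, hfd, σ, hσ, ev 1, ⟨f, Submodule.subset_span ⟨1, rt_one f⟩⟩, ?_⟩
  refine R_ext fun γ => ?_
  change f.1 (1 * γ) = _
  rw [one_mul]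

lemma iSup_genEig_R [IsAlgClosed F] [Good R] {P : R →ₗ[F] R} (hP : LInv P) :
    ⨆ μ, End.maxGenEigenspace P μ = ⊤ := by
  rw [eq_top_iff]
  intro f _
  obtain ⟨W, _, _, _, σ, hσ, ξ, w, rfl⟩ := exists_fd f
  have hw : w ∈ ⨆ μ, End.maxGenEigenspace (act hσ P) μ := by
    rw [End.iSup_maxGenEigenspace_eq_top]; trivial
  induction hw using Submodule.iSup_induction' with
  | mem μ x hx => exact Submodule.mem_iSup_of_mem μ (coef_genEig hσ hP μ hx ξ)
  | zero => rw [← coefL_apply, map_zero]; exact Submodule.zero_mem _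
  | add x y _ _ hx hy =>
    rw [← coefL_apply, map_add]; exact Submodule.add_mem _ (hx trivial) (hy trivial)

lemma genEig_mul (D : Derivation F R R) {μ ν : F} {f g : R}
    (hf : f ∈ End.maxGenEigenspace (D : R →ₗ[F] R) μ)
    (hg : g ∈ End.maxGenEigenspace (D : R →ₗ[F] R) ν) :
    f * g ∈ End.maxGenEigenspace (D : R →ₗ[F] R) (μ + ν) := by
  rw [End.mem_maxGenEigenspace] at hf hg ⊢
  obtain ⟨i, hi⟩ := hf
  obtain ⟨j, hj⟩ := hg
  let E (c : F) : End F R := (D : R →ₗ[F] R) - c • 1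
  have hE : ∀ f g : R, E (μ + ν) (f * g) = E μ f * g + f * E ν g := by
    intro f g
    change D (f * g) - (μ + ν) • (f * g) = (D f - μ • f) * g + f * (D g - ν • g)
    rw [Derivation.leibniz]
    simp only [smul_eq_mul, Algebra.smul_def, map_add]
    ring
  have key : ∀ n i j : ℕ, i + j ≤ n → ∀ f g : R, ((E μ) ^ i) f = 0 → ((E ν) ^ j) g = 0 →
      ((E (μ + ν)) ^ n) (f * g) = 0 := by
    intro n
    induction n with
    | zero =>
      intro i j hij f g hf hg
      obtain rfl : i = 0 := by omega
      simp at hf; simp [hf]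
    | succ n ih =>
      intro i j hij f g hf hg
      rw [pow_succ, End.mul_apply, hE, map_add]
      have h1 : ((E (μ + ν)) ^ n) (E μ f * g) = 0 := by
        cases i with
        | zero => simp at hf; simp [hf]
        | succ i => exact ih i j (by omega) _ _ (by rwa [pow_succ, End.mul_apply] at hf) hg
      have h2 : ((E (μ + ν)) ^ n) (f * E ν g) = 0 := by
        cases j with
        | zero => simp at hg; simp [hg]
        | succ j => exact ih i j (by omega) _ _ hf (by rwa [pow_succ, End.mul_apply] at hg)
      rw [h1, h2, add_zero]
  exact ⟨i + j, key _ i j le_rfl f g hi hj⟩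

/-- Replace the eigenvalues of `D` by their images under an additive map. -/
lemma exists_phi [IsAlgClosed F] [CharZero F] [Good R] (D : lieG R) (φ : F →+ F) :
    ∃ E : lieG R, ∀ μ, ∀ f ∈ End.maxGenEigenspace (D.1 : R →ₗ[F] R) μ, E.1 f = φ μ • f := by
  obtain ⟨Q, hQ⟩ := exists_diag _ (End.independent_maxGenEigenspace (D.1 : R →ₗ[F] R))
    (iSup_genEig_R D.2) φ
  have ind : ∀ (p : R → Prop), (∀ μ, ∀ f ∈ End.maxGenEigenspace (D.1 : R →ₗ[F] R) μ, p f) →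
      p 0 → (∀ f g, p f → p g → p (f + g)) → ∀ f, p f := by
    intro p h1 h2 h3 f
    have hf : f ∈ ⨆ μ, End.maxGenEigenspace (D.1 : R →ₗ[F] R) μ := by
      rw [iSup_genEig_R D.2]; trivial
    exact Submodule.iSup_induction _ (motive := p) hf h1 h2 h3
  have hder : ∀ f g : R, Q (f * g) = f • Q g + g • Q f := by
    intro f g
    revert g
    refine ind (fun f => ∀ g : R, Q (f * g) = f • Q g + g • Q f) ?_ ?_ ?_ f
    · intro μ f hf
      refine ind _ ?_ ?_ ?_
      · intro ν g hg
        rw [hQ μ f hf, hQ ν g hg, hQ _ _ (genEig_mul D.1 hf hg), map_add]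
        simp only [smul_eq_mul, Algebra.smul_def, map_add]
        ring
      · simp
      · intro a b ha hb
        rw [mul_add, map_add, ha, hb, map_add]; simp only [smul_eq_mul]; ring
    · simp
    · intro a b ha hb g
      rw [add_mul, map_add, ha, hb, map_add]; simp only [smul_eq_mul]; ring
  refine ⟨⟨Derivation.mk' Q hder, ?_⟩, fun μ f hf => hQ μ f hf⟩
  intro γ f f' hf
  obtain rfl : f' = lt γ f := R_ext hf
  suffices h : Q (lt γ f) = lt γ (Q f) by
    intro x
    change (Q (lt γ f)).1 x = (lt γ (Q f)).1 x
    rw [h]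
  refine ind (fun f => Q (lt γ f) = lt γ (Q f)) ?_ ?_ ?_ f
  · intro μ f hf
    have h1 : lt γ f ∈ End.maxGenEigenspace (D.1 : R →ₗ[F] R) μ := by
      rw [End.mem_maxGenEigenspace] at hf ⊢
      obtain ⟨k, hk⟩ := hf
      have : ∀ k : ℕ, ∀ f, (((D.1 : R →ₗ[F] R) - μ • (1 : End F R)) ^ k) (lt γ f) =
          lt γ ((((D.1 : R →ₗ[F] R) - μ • (1 : End F R)) ^ k) f) := by
        intro k
        induction k with
        | zero => intro w; simp
        | succ k ih =>
          intro w
          rw [pow_succ, End.mul_apply, End.mul_apply, ← ih]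
          congr 1
          simp only [LinearMap.sub_apply, LinearMap.smul_apply, End.one_apply,
            Derivation.coeFn_coe, map_sub, map_smul]
          rw [D.2.lt γ w]
      exact ⟨k, by rw [this, hk, map_zero]⟩
    rw [hQ _ _ h1, hQ _ _ hf, map_smul]
  · simp
  · intro a b ha hb
    simp only [map_add, ha, hb]

noncomputable def phiD [IsAlgClosed F] [CharZero F] [Good R] (D : lieG R) (φ : F →+ F) : lieG R :=
  (exists_phi D φ).choose

lemma dact_phiD [IsAlgClosed F] [CharZero F] [Good R] (hρ : Rat R ρ) (D : lieG R) (φ : F →+ F) (μ : F)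
    (v : V) (hv : v ∈ End.maxGenEigenspace (dact hρ D) μ) : dact hρ (phiD D φ) v = φ μ • v := by
  rw [dact_apply, act_eq_iff hρ (phiD D φ).2]
  intro ξ
  have h1 := (exists_phi D φ).choose_spec μ _ (coef_genEig hρ D.2 μ hv ξ)
  rw [← coefL_apply, ← coefL_apply, map_smul]
  exact h1

/-- rational additive maps as additive maps into `F` -/
noncomputable def qphi [CharZero F] (φ : F →ₗ[ℚ] ℚ) : F →+ F :=
  (Rat.castHom F).toAddMonoidHom.comp φ.toAddMonoidHom

lemma nilp_of_trace_phi [IsAlgClosed F] [CharZero F] [Good R] (hρ : Rat R ρ) (D : lieG R)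
    (h : ∀ φ, LinearMap.trace F V (dact hρ D ∘ₗ dact hρ (phiD D (qphi φ))) = 0) :
    IsNilpotent (dact hρ D) :=
  nilp_of_trace _ (fun φ => dact hρ (phiD D (qphi φ)))
    (fun φ μ x hx => dact_phiD hρ D (qphi φ) μ x hx) h

end reps
end RG

namespace RG
open Module Polynomial

/-- Sealed copy of the Lie algebra (keeps instance unification cheap). -/
def Lg {F : Type} [Field F] {Γ : Type} [Group Γ] (R : Subalgebra F (Γ → F)) : Type := lieG R

section reps
variable {F : Type} [Field F] {Γ : Type} [Group Γ] {R : Subalgebra F (Γ → F)}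

instance instLieRingLg : LieRing (Lg R) := inferInstanceAs (LieRing (lieG R))
instance instLieAlgebraLg : LieAlgebra F (Lg R) := inferInstanceAs (LieAlgebra F (lieG R))

/-- underlying derivation -/
def der (D : Lg R) : Derivation F R R := (show lieG R from D).1

lemma der_linv (D : Lg R) : LInv (der D) := (show lieG R from D).2

def mkLg (D : Derivation F R R) (h : LInv D) : Lg R := (⟨D, h⟩ : lieG R)

lemma der_mk (D : Derivation F R R) (h : LInv D) : der (mkLg D h) = D := rfl

lemma Lg_ext {D E : Lg R} (h : ∀ f, der D f = der E f) : D = E :=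
  Subtype.ext (Derivation.ext h)

lemma der_add (a b : Lg R) : der (a + b) = der a + der b := rfl
lemma der_zero : der (0 : Lg R) = 0 := rfl
lemma der_smul (c : F) (b : Lg R) : der (c • b) = c • der b := rfl
lemma der_lie (a b : Lg R) (f : R) : der ⁅a, b⁆ f = der a (der b f) - der b (der a f) :=
  Derivation.commutator_apply (D1 := der a) (D2 := der b) (a := f)

variable {V V' : Type} [AddCommGroup V] [Module F V] [FiniteDimensional F V]
  [AddCommGroup V'] [Module F V'] [FiniteDimensional F V']
variable {ρ : Representation F Γ V} {ρ' : Representation F Γ V'}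

variable (R) in
def Ad [Good R] : Representation F Γ (Lg R) where
  toFun γ :=
    { toFun := fun D => adRep R γ D
      map_add' := fun a b => (adRep R γ).map_add a b
      map_smul' := fun a b => (adRep R γ).map_smul a b }
  map_one' := LinearMap.ext fun D => by
    change adRep R 1 D = D
    rw [map_one]; rfl
  map_mul' a b := LinearMap.ext fun D => by
    change adRep R (a * b) D = adRep R a (adRep R b D)
    rw [map_mul]; rfl

lemma Ad_apply [Good R] (γ : Γ) (D : Lg R) (f : R) :
    der (Ad R γ D) f = rt γ (der D (rt γ⁻¹ f)) := rfl

lemma Ad_lie [Good R] (γ : Γ) (x y : Lg R) : Ad R γ ⁅x, y⁆ = ⁅Ad R γ x, Ad R γ y⁆ := by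
  refine Lg_ext fun f => ?_
  rw [Ad_apply, der_lie, der_lie]
  simp only [Ad_apply, map_sub, ← rt_mul, inv_mul_cancel, rt_one]

noncomputable def dg (hρ : Rat R ρ) : Lg R →ₗ[F] End F V where
  toFun D := act hρ (der D : R →ₗ[F] R)
  map_add' a b := (dact hρ).map_add a b
  map_smul' a b := (dact hρ).map_smul a b

lemma dg_apply (hρ : Rat R ρ) (D : Lg R) : dg hρ D = act hρ (der D : R →ₗ[F] R) := rfl

lemma coef_dg (hρ : Rat R ρ) (D : Lg R) (ξ : Dual F V) (v : V) :
    coef hρ ξ (dg hρ D v) = der D (coef hρ ξ v) := coef_act hρ (der_linv D) ξ v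

lemma dg_lie (hρ : Rat R ρ) (a b : Lg R) :
    dg hρ ⁅a, b⁆ = dg hρ a * dg hρ b - dg hρ b * dg hρ a := by
  ext v; refine eq_of_coef hρ fun ξ => ?_
  rw [coef_dg, der_lie, LinearMap.sub_apply]
  change _ = coefL hρ ξ _
  rw [map_sub]
  simp only [Module.End.mul_apply, coefL_apply, coef_dg]

lemma dg_natural (hρ : Rat R ρ) (hρ' : Rat R ρ') (D : Lg R) (f : V →ₗ[F] V')
    (hf : ∀ γ v, f (ρ γ v) = ρ' γ (f v)) (v : V) : dg hρ' D (f v) = f (dg hρ D v) :=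
  act_natural hρ hρ' _ f hf v

lemma dg_ad [Good R] (hρ : Rat R ρ) (γ : Γ) (D : Lg R) (v : V) :
    dg hρ (Ad R γ D) v = ρ γ (dg hρ D (ρ γ⁻¹ v)) := dact_ad hρ γ D v

lemma dg_sub (hρ : Rat R ρ) (U : Submodule F V) (hU : Stab ρ U) (D : Lg R) (v : U) :
    (dg (hρ.sub U hU) D v : V) = dg hρ D v :=
  (dg_natural (hρ.sub U hU) hρ D U.subtype (fun _ _ => rfl) v).symm

lemma dg_quo (hρ : Rat R ρ) (U : Submodule F V) (hU : Stab ρ U) (D : Lg R) (v : V) :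
    dg (hρ.quo U hU) D (Submodule.Quotient.mk v) = Submodule.Quotient.mk (dg hρ D v) :=
  (dg_natural hρ (hρ.quo U hU) D U.mkQ (fun _ _ => rfl) v)

lemma dg_mem (hρ : Rat R ρ) (U : Submodule F V) (hU : Stab ρ U) (D : Lg R) (v : V) (hv : v ∈ U) :
    dg hρ D v ∈ U := by
  have := dg_sub hρ U hU D ⟨v, hv⟩
  rw [← this]; exact SetLike.coe_mem _

lemma dg_prod (hρ : Rat R ρ) (hρ' : Rat R ρ') (D : Lg R) (v : V × V') :
    dg (hρ.prod hρ') D v = (dg hρ D v.1, dg hρ' D v.2) := dact_prod hρ hρ' D v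

lemma fixed_of_dg [IsAlgClosed F] [CharZero F] [hR : Good R] (hρ : Rat R ρ) (v : V)
    (h : ∀ D : Lg R, dg hρ D v = 0) (γ : Γ) : ρ γ v = v := fixed_of_dact hρ v h γ

lemma stable_of_dg [IsAlgClosed F] [CharZero F] [hR : Good R] (hρ : Rat R ρ) (M : Submodule F V)
    (h : ∀ D : Lg R, ∀ v ∈ M, dg hρ D v ∈ M) : Stab ρ M := stable_of_dact hρ M h

variable [IsAlgClosed F] [CharZero F] [Good R]

noncomputable def ph (D : Lg R) (φ : F →+ F) : Lg R := phiD D φ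

lemma der_ph (D : Lg R) (φ : F →+ F) (μ : F) (f : R)
    (hf : f ∈ End.maxGenEigenspace (der D : R →ₗ[F] R) μ) : der (ph D φ) f = φ μ • f :=
  (exists_phi D φ).choose_spec μ f hf

lemma dg_ph (hρ : Rat R ρ) (D : Lg R) (φ : F →+ F) (μ : F)
    (v : V) (hv : v ∈ End.maxGenEigenspace (dg hρ D) μ) : dg hρ (ph D φ) v = φ μ • v :=
  dact_phiD hρ D φ μ v hv

lemma nilp_of_trace_ph (hρ : Rat R ρ) (D : Lg R)
    (h : ∀ φ, LinearMap.trace F V (dg hρ D ∘ₗ dg hρ (ph D (qphi φ))) = 0) :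
    IsNilpotent (dg hρ D) := nilp_of_trace_phi hρ D h

end reps

attribute [irreducible] Lg

end RG

namespace RG
open Module Polynomial
lemma rho_inv0 {F Γ V : Type} [Field F] [Group Γ] [AddCommGroup V] [Module F V]
    (ρ : Representation F Γ V) (γ : Γ) (v : V) : ρ γ⁻¹ (ρ γ v) = v := by
  simp [← Module.End.mul_apply, ← map_mul]

lemma rho_inv0' {F Γ V : Type} [Field F] [Group Γ] [AddCommGroup V] [Module F V]
    (ρ : Representation F Γ V) (γ : Γ) (v : V) : ρ γ (ρ γ⁻¹ v) = v := by
  simp [← Module.End.mul_apply, ← map_mul]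

section engel
variable {F V : Type} [Field F] [AddCommGroup V] [Module F V] [FiniteDimensional F V]
attribute [local instance] LieRing.ofAssociativeRing

lemma engel_end [Nontrivial V] (S : Submodule F (End F V))
    (hS : ∀ a ∈ S, ∀ b ∈ S, a * b - b * a ∈ S) (hn : ∀ a ∈ S, IsNilpotent a) :
    ∃ v : V, v ≠ 0 ∧ ∀ a ∈ S, a v = 0 := by
  let L : LieSubalgebra F (End F V) := { S with lie_mem' := fun {a b} ha hb => hS a ha b hb }
  have h1 : LieModule.IsNilpotent L V := by
    rw [LieModule.isNilpotent_iff_forall' (R := F)]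
    rintro ⟨x, hx⟩
    exact hn x hx
  have h2 := LieModule.nontrivial_max_triv_of_isNilpotent F L V
  obtain ⟨w, hw⟩ := exists_ne (0 : LieModule.maxTrivSubmodule F L V)
  refine ⟨w.1, fun h => hw (Subtype.ext h), fun a ha => ?_⟩
  exact (LieModule.mem_maxTrivSubmodule F L V w.1).1 w.2 ⟨a, ha⟩

end engel

section reps
variable {F : Type} [Field F] {Γ : Type} [Group Γ] {R : Subalgebra F (Γ → F)}
variable {V V' : Type} [AddCommGroup V] [Module F V] [FiniteDimensional F V]
  [AddCommGroup V'] [Module F V'] [FiniteDimensional F V']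
variable {ρ : Representation F Γ V} {ρ' : Representation F Γ V'}

lemma engel_lie [Nontrivial V] (hρ : Rat R ρ) (i : Submodule F (Lg R))
    (hi : ∀ a ∈ i, ∀ b ∈ i, ⁅a, b⁆ ∈ i) (hn : ∀ a ∈ i, IsNilpotent (dg hρ a)) :
    ∃ v : V, v ≠ 0 ∧ ∀ a ∈ i, dg hρ a v = 0 := by
  obtain ⟨v, hv, h⟩ := engel_end (i.map (dg hρ)) (by
    rintro _ ⟨a, ha, rfl⟩ _ ⟨b, hb, rfl⟩
    exact ⟨⁅a, b⁆, hi a ha b hb, dg_lie hρ a b⟩) (by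
    rintro _ ⟨a, ha, rfl⟩; exact hn a ha)
  exact ⟨v, hv, fun a ha => h _ ⟨a, ha, rfl⟩⟩

/-- Irreducible stable submodule. -/
def Irr (ρ : Representation F Γ V) (U : Submodule F V) : Prop :=
  U ≠ ⊥ ∧ Stab ρ U ∧ ∀ U' ≤ U, Stab ρ U' → U' = ⊥ ∨ U' = U

lemma exists_irr (U : Submodule F V) (hU : U ≠ ⊥) (hs : Stab ρ U) : ∃ L ≤ U, Irr ρ L := by
  obtain ⟨L, ⟨h1, h2, h3⟩, hmin⟩ := WellFounded.has_min (wellFounded_lt (α := Submodule F V))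
    {L | L ≤ U ∧ L ≠ ⊥ ∧ Stab ρ L} ⟨U, le_rfl, hU, hs⟩
  refine ⟨L, h1, h2, h3, fun U' hU' hs' => ?_⟩
  by_cases hb : U' = ⊥
  · exact Or.inl hb
  · right
    by_contra hne
    exact hmin U' ⟨hU'.trans h1, hb, hs'⟩ (lt_of_le_of_ne hU' hne)

lemma dg_fixed (hρ : Rat R ρ) {v : V} (hv : ∀ γ, ρ γ v = v) (D : Lg R) : dg hρ D v = 0 := by
  refine eq_of_coef hρ fun ξ => ?_
  rw [coef_dg]
  have : coef hρ ξ v = algebraMap F R (ξ v) := R_ext fun γ => by rw [coef_apply, hv]; rfl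
  rw [this, Derivation.map_algebraMap]
  rw [← coefL_apply, map_zero]

/-- Engel for irreducible: an Ad-stable subalgebra acting nilpotently acts by zero. -/
lemma engel_irr [Good R] (hρ : Rat R ρ) {L : Submodule F V} (hL : Irr ρ L) (i : Submodule F (Lg R))
    (hi : ∀ a ∈ i, ∀ b ∈ i, ⁅a, b⁆ ∈ i) (had : Stab (Ad R) i)
    (hn : ∀ a ∈ i, IsNilpotent (dg (hρ.sub L hL.2.1) a)) :
    ∀ a ∈ i, ∀ v ∈ L, dg hρ a v = 0 := by
  haveI : Nontrivial L := Submodule.nontrivial_iff_ne_bot.2 hL.1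
  obtain ⟨v, hv, h⟩ := engel_lie (hρ.sub L hL.2.1) i hi hn
  let K : Submodule F V :=
    { carrier := {v | v ∈ L ∧ ∀ a ∈ i, dg hρ a v = 0}
      zero_mem' := ⟨L.zero_mem, fun a _ => map_zero _⟩
      add_mem' := fun hx hy => ⟨L.add_mem hx.1 hy.1, fun a ha => by
        rw [map_add, hx.2 a ha, hy.2 a ha, add_zero]⟩
      smul_mem' := fun c x hx => ⟨L.smul_mem c hx.1, fun a ha => by
        rw [map_smul, hx.2 a ha, smul_zero]⟩ }
  have hK : Stab ρ K := by
    rintro γ x ⟨hx, hx'⟩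
    refine ⟨hL.2.1 γ x hx, fun a ha => ?_⟩
    have h1 := dg_ad hρ γ⁻¹ a x
    rw [hx' _ (had γ⁻¹ a ha), inv_inv] at h1
    have h2 := congrArg (ρ γ) h1
    rw [map_zero, rho_inv'] at h2
    exact h2.symm
  have hvK : v.1 ∈ K := ⟨v.2, fun a ha => by
    rw [← dg_sub hρ L hL.2.1, h a ha]; rfl⟩
  rcases hL.2.2 K (fun x hx => hx.1) hK with h1 | h1
  · rw [h1] at hvK
    exact absurd (Subtype.ext ((Submodule.mem_bot F).1 hvK)) hv
  · intro a ha x hx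
    rw [← h1] at hx
    exact hx.2 a ha

/-- trace form -/
noncomputable def tf (hρ : Rat R ρ) : LinearMap.BilinForm F (Lg R) :=
  LinearMap.mk₂ F (fun x y => LinearMap.trace F V (dg hρ x * dg hρ y))
    (by intros; simp [add_mul]) (by intros; simp) (by intros; simp [mul_add]) (by intros; simp)

lemma tf_apply (hρ : Rat R ρ) (x y : Lg R) :
    tf hρ x y = LinearMap.trace F V (dg hρ x * dg hρ y) := rfl

lemma tf_comm (hρ : Rat R ρ) (x y : Lg R) : tf hρ x y = tf hρ y x := by
  rw [tf_apply, tf_apply, LinearMap.trace_mul_comm]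

lemma tf_lie (hρ : Rat R ρ) (x y z : Lg R) : tf hρ ⁅x, y⁆ z = tf hρ x ⁅y, z⁆ := by
  simp only [tf_apply, dg_lie, mul_sub, sub_mul, map_sub]
  rw [← mul_assoc, ← mul_assoc, mul_assoc (dg hρ y), LinearMap.trace_mul_comm F (dg hρ y)]

lemma dg_ad' [Good R] (hρ : Rat R ρ) (γ : Γ) (D : Lg R) :
    dg hρ (Ad R γ D) = ρ γ * dg hρ D * ρ γ⁻¹ := by
  ext v; exact dg_ad hρ γ D v

lemma tf_ad [Good R] (hρ : Rat R ρ) (γ : Γ) (x y : Lg R) :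
    tf hρ (Ad R γ x) (Ad R γ y) = tf hρ x y := by
  simp only [tf_apply, dg_ad']
  have : ρ γ * dg hρ x * ρ γ⁻¹ * (ρ γ * dg hρ y * ρ γ⁻¹) =
      ρ γ * (dg hρ x * dg hρ y * ρ γ⁻¹) := by
    have h : ρ γ⁻¹ * ρ γ = 1 := by rw [← map_mul]; simp
    simp only [mul_assoc]
    rw [← mul_assoc (ρ γ⁻¹), h, one_mul]
  rw [this, LinearMap.trace_mul_comm, mul_assoc]
  have h : ρ γ⁻¹ * ρ γ = 1 := by rw [← map_mul]; simp
  rw [h, mul_one]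

lemma tf_ad' [Good R] (hρ : Rat R ρ) (γ : Γ) (x y : Lg R) :
    tf hρ (Ad R γ x) y = tf hρ x (Ad R γ⁻¹ y) := by
  rw [← tf_ad hρ γ⁻¹, rho_inv0]

lemma nilp_of_tf [IsAlgClosed F] [CharZero F] [Good R] (hρ : Rat R ρ) (D : Lg R)
    (h : ∀ φ, tf hρ D (ph D (qphi φ)) = 0) : IsNilpotent (dg hρ D) :=
  nilp_of_trace_ph hρ D h

lemma ph_kill [IsAlgClosed F] [CharZero F] [Good R] (hρ : Rat R ρ) (D : Lg R) (φ) (v : V) (k : ℕ)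
    (h : (dg hρ D ^ k) v = 0) : dg hρ (ph D φ) v = 0 := by
  rw [dg_ph hρ D φ 0, map_zero, zero_smul]
  rw [End.mem_maxGenEigenspace]
  exact ⟨k, by simpa using h⟩

end reps
end RG

namespace RG
open Module Polynomial
lemma lie_smul_self {F L : Type} [Field F] [LieRing L] [LieAlgebra F L] (s t : F) (z : L) :
    ⁅s • z, t • z⁆ = 0 := by simp

section reps
variable {F : Type} [Field F] {Γ : Type} [Group Γ] {R : Subalgebra F (Γ → F)}
variable {W : Type} [AddCommGroup W] [Module F W] [FiniteDimensional F W]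
variable {ρ₀ : Representation F Γ W} {h₀ : Rat R ρ₀}

/-- Reductivity, expressed through a faithful representation. -/
structure Red [Good R] (h₀ : Rat R ρ₀) : Prop where
  faith : Function.Injective (dg h₀)
  red : ∀ i : Submodule F (Lg R), (∀ a ∈ i, ∀ b ∈ i, ⁅a, b⁆ ∈ i) → Stab (Ad R) i →
    (∀ a ∈ i, IsNilpotent (dg h₀ a)) → i = ⊥

variable {V : Type} [AddCommGroup V] [Module F V] [FiniteDimensional F V]
variable {ρ : Representation F Γ V}

lemma Red.fd [Good R] (hr : Red h₀) : FiniteDimensional F (Lg R) :=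
  FiniteDimensional.of_injective (dg h₀) hr.faith

/-- annihilator of a stable submodule -/
noncomputable def ann (hρ : Rat R ρ) (L : Submodule F V) : Submodule F (Lg R) where
  carrier := {D | ∀ v ∈ L, dg hρ D v = 0}
  zero_mem' := fun v _ => by simp
  add_mem' := fun ha hb v hv => by rw [map_add, LinearMap.add_apply, ha v hv, hb v hv, add_zero]
  smul_mem' := fun c a ha v hv => by rw [map_smul, LinearMap.smul_apply, ha v hv, smul_zero]

lemma mem_ann (hρ : Rat R ρ) (L : Submodule F V) (D : Lg R) :
    D ∈ ann hρ L ↔ ∀ v ∈ L, dg hρ D v = 0 := Iff.rfl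

lemma ann_ideal (hρ : Rat R ρ) {L : Submodule F V} (hL : Stab ρ L) (a : Lg R) (ha : a ∈ ann hρ L)
    (b : Lg R) : ⁅a, b⁆ ∈ ann hρ L := by
  intro v hv
  rw [dg_lie, LinearMap.sub_apply, End.mul_apply, End.mul_apply, ha v hv, map_zero, sub_zero,
    ha _ (dg_mem hρ L hL b v hv)]

lemma ann_stab [Good R] (hρ : Rat R ρ) {L : Submodule F V} (hL : Stab ρ L) :
    Stab (Ad R) (ann hρ L) := by
  intro γ D hD v hv
  rw [dg_ad, hD _ (hL _ v hv), map_zero]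

lemma orth_stab [Good R] {hρ : Rat R ρ} {k : Submodule F (Lg R)} (hk : Stab (Ad R) k) :
    Stab (Ad R) ((tf hρ).orthogonal k) := by
  intro γ D hD x hx
  change tf hρ x (Ad R γ D) = 0
  rw [tf_comm, tf_ad', tf_comm]
  exact hD _ (hk _ x hx)

lemma orth_lie [Good R] {hρ : Rat R ρ} {k : Submodule F (Lg R)} (hk : ∀ a ∈ k, ∀ b, ⁅a, b⁆ ∈ k)
    (a : Lg R) (ha : a ∈ (tf hρ).orthogonal k) (b : Lg R) : ⁅a, b⁆ ∈ (tf hρ).orthogonal k := by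
  intro x hx
  change tf hρ x ⁅a, b⁆ = 0
  have h1 : tf hρ x ⁅a, b⁆ = - tf hρ ⁅x, b⁆ a := by
    rw [← lie_skew, map_neg, ← tf_lie]
  rw [h1]
  have := ha _ (hk x hx b)
  change tf hρ _ _ = 0 at this
  rw [this, neg_zero]

lemma tf_refl (hρ : Rat R ρ) : (tf hρ).IsRefl := fun x y h => by rw [tf_comm, h]

variable [IsAlgClosed F] [CharZero F] [Good R]

lemma Red.compl (hr : Red h₀) (hρ : Rat R ρ) {L : Submodule F V} (hL : Stab ρ L) :
    IsCompl (ann hρ L) ((tf h₀).orthogonal (ann hρ L)) := by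
  haveI := hr.fd
  rw [LinearMap.BilinForm.isCompl_orthogonal_iff_disjoint (tf_refl h₀), disjoint_iff]
  refine hr.red _ ?_ ?_ ?_
  · intro a ha b hb
    exact ⟨ann_ideal hρ hL a ha.1 b, orth_lie (ann_ideal hρ hL) a ha.2 b⟩
  · intro γ D hD
    exact ⟨ann_stab hρ hL γ D hD.1, orth_stab (ann_stab hρ hL) γ D hD.2⟩
  · intro a ha
    refine nilp_of_tf h₀ a fun φ => ?_
    rw [tf_comm]
    refine ha.2 _ fun v hv => ?_
    exact ph_kill hρ a _ v 1 (by rw [pow_one]; exact ha.1 v hv)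

lemma Red.nondeg (hr : Red h₀) : (tf h₀).Nondegenerate := by
  have key : ∀ x, (∀ y, tf h₀ x y = 0) → x = 0 := by
    intro x hx
    have : (tf h₀).orthogonal ⊤ = ⊥ := by
      refine hr.red _ ?_ ?_ ?_
      · intro a ha b hb
        exact orth_lie (k := ⊤) (fun _ _ _ => Submodule.mem_top) a ha b
      · exact orth_stab (k := ⊤) (fun _ _ _ => Submodule.mem_top)
      · intro a ha
        refine nilp_of_tf h₀ a fun φ => ?_
        rw [tf_comm]
        exact ha _ trivial
    rw [← Submodule.mem_bot F, ← this]
    intro y _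
    change tf h₀ y x = 0
    rw [tf_comm, hx]
  exact ⟨key, fun x hx => key x fun y => by rw [tf_comm]; exact hx y⟩

lemma tf_radical (hρ : Rat R ρ) {L : Submodule F V} (hL : Irr ρ L) (x : Lg R)
    (hx : ∀ y, tf (hρ.sub L hL.2.1) x y = 0) : x ∈ ann hρ L := by
  refine engel_irr hρ hL ((tf (hρ.sub L hL.2.1)).orthogonal ⊤) ?_ ?_ ?_ x ?_
  · intro a ha b hb
    exact orth_lie (k := ⊤) (fun _ _ _ => Submodule.mem_top) a ha b
  · exact orth_stab (k := ⊤) (fun _ _ _ => Submodule.mem_top)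
  · intro a ha
    refine nilp_of_tf _ a fun φ => ?_
    rw [tf_comm]
    exact ha _ trivial
  · intro y _
    change tf (hρ.sub L hL.2.1) y x = 0
    rw [tf_comm, hx]

/-- Case where the Lie algebra acts trivially on `L`. -/
lemma Red.fix_triv (hr : Red h₀) (hρ : Rat R ρ) {L : Submodule F V} (hL : Stab ρ L)
    (hk : ∀ D : Lg R, ∀ v ∈ L, dg hρ D v = 0) (v₀ : V) (hv : ∀ γ, ρ γ v₀ - v₀ ∈ L) (γ : Γ) :
    ρ γ v₀ = v₀ := by
  haveI := hr.fd
  have hfix : ∀ v ∈ L, ∀ γ, ρ γ v = v := fun v hv => fixed_of_dg hρ v fun D => hk D v hv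
  have hDL : ∀ D : Lg R, dg hρ D v₀ ∈ L := by
    intro D
    rw [← Submodule.Quotient.mk_eq_zero, ← dg_quo hρ L hL]
    refine dg_fixed _ (fun γ => ?_) D
    rw [quoRep_mk, Submodule.Quotient.eq]
    exact hv γ
  refine fixed_of_dg hρ v₀ ?_ γ
  intro D
  rw [← Module.forall_dual_apply_eq_zero_iff F]
  intro ℓ
  let χ : Dual F (Lg R) := ℓ ∘ₗ LinearMap.applyₗ v₀ ∘ₗ dg hρ
  have hχ : ∀ D, χ D = ℓ (dg hρ D v₀) := fun D => rfl
  obtain ⟨z, hz⟩ : ∃ z, ∀ D, tf h₀ z D = χ D :=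
    ⟨((tf h₀).toDual hr.nondeg).symm χ, fun D => by
      rw [LinearMap.BilinForm.apply_toDual_symm_apply]⟩
  have hχad : ∀ γ D, χ (Ad R γ D) = χ D := by
    intro γ D
    rw [hχ, hχ, dg_ad]
    have h1 : dg hρ D (ρ γ⁻¹ v₀) = dg hρ D v₀ := by
      rw [← sub_eq_zero, ← map_sub]
      exact hk D _ (hv _)
    rw [h1, hfix _ (hDL D)]
  have hzad : ∀ γ, Ad R γ z = z := by
    intro γ
    rw [← sub_eq_zero]
    refine hr.nondeg.1 _ fun y => ?_
    rw [map_sub, LinearMap.sub_apply, tf_ad', hz, hz, hχad, sub_self]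
  have hz0 : F ∙ z = ⊥ := by
    refine hr.red _ ?_ ?_ ?_
    · intro a ha b hb
      rw [Submodule.mem_span_singleton] at ha hb
      obtain ⟨s, rfl⟩ := ha
      obtain ⟨t, rfl⟩ := hb
      rw [lie_smul_self]
      exact Submodule.zero_mem _
    · intro γ a ha
      rw [Submodule.mem_span_singleton] at ha
      obtain ⟨s, rfl⟩ := ha
      rw [map_smul, hzad]
      exact Submodule.smul_mem _ _ (Submodule.mem_span_singleton_self z)
    · intro a ha
      rw [Submodule.mem_span_singleton] at ha
      obtain ⟨s, rfl⟩ := ha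
      rw [map_smul]
      refine IsNilpotent.smul (nilp_of_tf h₀ z fun φ => ?_) s
      rw [hz, hχ, ph_kill hρ z _ v₀ 2, map_zero]
      rw [pow_two, End.mul_apply]
      exact hk z _ (hDL z)
  rw [Submodule.span_singleton_eq_bot] at hz0
  rw [← hχ, ← hz, hz0]; simp

end reps
end RG

namespace RG
open Module Polynomial
section reps
variable {F : Type} [Field F] {Γ : Type} [Group Γ] {R : Subalgebra F (Γ → F)}
variable {W : Type} [AddCommGroup W] [Module F W] [FiniteDimensional F W]
variable {ρ₀ : Representation F Γ W} {h₀ : Rat R ρ₀}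
variable {V : Type} [AddCommGroup V] [Module F V] [FiniteDimensional F V]
variable {ρ : Representation F Γ V}

variable [IsAlgClosed F] [CharZero F] [Good R]

/-- Schur -/
lemma schur {L : Submodule F V} (hL : Irr ρ L) (Ω : End F V) (hΩ : ∀ γ v, Ω (ρ γ v) = ρ γ (Ω v))
    (hm : ∀ v ∈ L, Ω v ∈ L) : ∃ c : F, ∀ v ∈ L, Ω v = c • v := by
  haveI : Nontrivial L := Submodule.nontrivial_iff_ne_bot.2 hL.1
  obtain ⟨c, hc⟩ := End.exists_eigenvalue (Ω.restrict hm)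
  obtain ⟨w, hw⟩ := hc.exists_hasEigenvector
  refine ⟨c, ?_⟩
  let K : Submodule F V := L ⊓ LinearMap.ker (Ω - c • 1)
  have hmem : ∀ v, v ∈ K ↔ v ∈ L ∧ Ω v = c • v := by
    intro v
    simp [K, sub_eq_zero]
  have hK : Stab ρ K := by
    intro γ v hv
    rw [hmem] at hv ⊢
    exact ⟨hL.2.1 γ v hv.1, by rw [hΩ, hv.2, map_smul]⟩
  have hwK : w.1 ∈ K := (hmem _).2 ⟨w.2, congrArg Subtype.val hw.apply_eq_smul⟩
  rcases hL.2.2 K inf_le_left hK with h | h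
  · rw [h] at hwK
    exact absurd (Subtype.ext ((Submodule.mem_bot F).1 hwK)) hw.2
  · intro v hv
    rw [← h] at hv
    exact ((hmem v).1 hv).2

/-- Irreducible case of the averaging argument. -/
lemma Red.fix_irr (hr : Red h₀) (hρ : Rat R ρ) {L : Submodule F V} (hL : Irr ρ L)
    (v₀ : V) (hv : ∀ γ, ρ γ v₀ - v₀ ∈ L) : ∃ l ∈ L, ∀ γ, ρ γ (v₀ + l) = v₀ + l := by
  classical
  haveI := hr.fd
  have hcompl := hr.compl hρ hL.2.1
  set k := ann hρ L with hk
  set h := (tf h₀).orthogonal k with hh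
  have hstab : Stab (Ad R) h := orth_stab (ann_stab hρ hL.2.1)
  by_cases hz : h = ⊥
  · have hkt : k = ⊤ := by
      have := hcompl.sup_eq_top
      rwa [hz, sup_bot_eq] at this
    refine ⟨0, L.zero_mem, fun γ => ?_⟩
    rw [add_zero]
    refine hr.fix_triv hρ hL.2.1 (fun D v hv' => ?_) v₀ hv γ
    have : D ∈ k := by rw [hkt]; trivial
    exact this v hv'
  have hDL : ∀ D : Lg R, dg hρ D v₀ ∈ L := by
    intro D
    rw [← Submodule.Quotient.mk_eq_zero, ← dg_quo hρ L hL.2.1]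
    refine dg_fixed _ (fun γ => ?_) D
    rw [quoRep_mk, Submodule.Quotient.eq]
    exact hv γ
  let hσ := hρ.sub L hL.2.1
  let B : LinearMap.BilinForm F h := (tf hσ).restrict h
  have hB : ∀ x y : h, B x y = tf hσ x.1 y.1 := fun x y => rfl
  have key : ∀ x : h, (∀ y, B x y = 0) → x = 0 := by
    intro x hx
    have hxk : x.1 ∈ k := by
      refine tf_radical hρ hL _ fun y => ?_
      have hy : y ∈ k ⊔ h := by rw [hcompl.sup_eq_top]; trivial
      obtain ⟨a, ha, b, hb, rfl⟩ := Submodule.mem_sup.1 hy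
      rw [map_add]
      have h1 := hx ⟨b, hb⟩
      rw [hB] at h1
      have h2 : dg hσ a = 0 := by
        ext v
        rw [dg_sub hρ L hL.2.1 a v, ha _ v.2]; rfl
      rw [h1, add_zero, tf_apply, h2, mul_zero, map_zero]
    have : x.1 ∈ k ⊓ h := ⟨hxk, x.2⟩
    rw [hcompl.inf_eq_bot, Submodule.mem_bot] at this
    exact Subtype.ext this
  have hBc : ∀ x y, B x y = B y x := fun x y => by rw [hB, hB, tf_comm]
  have hBn : B.Nondegenerate := ⟨key, fun x hx => key x fun y => by rw [hBc]; exact hx y⟩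
  let e := finBasis F h
  let e' := B.dualBasis hBn e
  have hx1 : ∀ x : h, x = ∑ i, B x (e i) • e' i := by
    intro x
    conv_lhs => rw [← e'.sum_repr x]
    simp only [e', LinearMap.BilinForm.dualBasis_repr_apply]
  have hdd : ∀ i j, B (e' i) (e j) = if j = i then 1 else 0 := fun i j =>
    LinearMap.BilinForm.apply_dualBasis_left hBn e i j
  have hx2 : ∀ x : h, x = ∑ i, B (e' i) x • e i := by
    intro x
    conv_lhs => rw [← e.sum_repr x]
    refine Finset.sum_congr rfl fun i _ => ?_
    congr 1
    have h5 := congrArg (B (e' i)) (e.sum_repr x)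
    rw [map_sum] at h5
    simp only [map_smul, hdd, smul_eq_mul, mul_ite, mul_one, mul_zero, Finset.sum_ite_eq',
      Finset.sum_ite_eq, Finset.mem_univ, if_true] at h5
    exact h5
  let ad : Γ → h → h := fun γ x => ⟨Ad R γ x.1, hstab γ x.1 x.2⟩
  have hadB : ∀ γ x y, B (ad γ x) y = B x (ad γ⁻¹ y) := fun γ x y => tf_ad' hσ γ x.1 y.1
  let d : h →ₗ[F] End F V := dg hρ ∘ₗ h.subtype
  let Ω : End F V := ∑ i, d (e i) * d (e' i)
  have hΩad : ∀ γ, ∑ i, d (ad γ (e i)) * d (ad γ (e' i)) = Ω := by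
    intro γ
    have h1 : ∀ y : h, ∑ j, B y (ad γ (e j)) • ad γ (e' j) = y := by
      intro y
      have h2 : ∀ j, B y (ad γ (e j)) = B (ad γ⁻¹ y) (e j) := fun j => by
        rw [hadB, inv_inv]
      simp only [h2]
      have h3 := hx1 (ad γ⁻¹ y)
      apply Subtype.ext
      have h4 := congrArg (fun x : h => Ad R γ x.1) h3
      simp only [ad, rho_inv0'] at h4
      rw [h4]
      simp [ad, map_sum]
    calc ∑ j, d (ad γ (e j)) * d (ad γ (e' j))
        = ∑ j, (∑ i, B (e' i) (ad γ (e j)) • d (e i)) * d (ad γ (e' j)) := by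
          refine Finset.sum_congr rfl fun j _ => ?_
          conv_lhs => rw [hx2 (ad γ (e j))]
          rw [map_sum]; simp only [map_smul]
      _ = ∑ i, d (e i) * d (∑ j, B (e' i) (ad γ (e j)) • ad γ (e' j)) := by
          simp only [Finset.sum_mul, map_sum, map_smul, Finset.mul_sum]
          rw [Finset.sum_comm]
          simp only [smul_mul_assoc, mul_smul_comm]
      _ = Ω := by simp only [h1]; rfl
  have hΩeq : ∀ γ v, Ω (ρ γ v) = ρ γ (Ω v) := by
    intro γ v
    conv_lhs => rw [← hΩad γ]
    rw [LinearMap.sum_apply]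
    change _ = ρ γ ((∑ i, d (e i) * d (e' i)) v)
    rw [LinearMap.sum_apply, map_sum]
    refine Finset.sum_congr rfl fun i _ => ?_
    change dg hρ (Ad R γ (e i).1) (dg hρ (Ad R γ (e' i).1) (ρ γ v)) = ρ γ (dg hρ _ (dg hρ _ v))
    rw [dg_ad, dg_ad, rho_inv, rho_inv]; rfl
  have hΩL : ∀ v, (∀ D, dg hρ D v ∈ L) → Ω v ∈ L := by
    intro v hv
    rw [LinearMap.sum_apply]
    exact Submodule.sum_mem _ fun i _ => dg_mem hρ L hL.2.1 _ _ (hv _)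
  have hΩL' : ∀ v ∈ L, Ω v ∈ L := fun v hv => hΩL v fun D => dg_mem hρ L hL.2.1 D v hv
  obtain ⟨c, hc⟩ := schur hL Ω hΩeq hΩL'
  have htr : c * finrank F L = finrank F h := by
    have h1 : ∑ i, dg hσ (e i).1 * dg hσ (e' i).1 = c • (1 : End F L) := by
      ext v
      have h2 := hc v.1 v.2
      rw [LinearMap.sum_apply] at h2
      rw [LinearMap.sum_apply, AddSubmonoidClass.coe_finset_sum]
      change _ = c • v.1
      rw [← h2]
      refine Finset.sum_congr rfl fun i _ => ?_
      rw [End.mul_apply, dg_sub hρ L hL.2.1, dg_sub hρ L hL.2.1]; rfl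
    have h3 := congrArg (LinearMap.trace F L) h1
    rw [map_sum, map_smul, LinearMap.trace_one, smul_eq_mul] at h3
    rw [← h3]
    have h4 : ∀ i, LinearMap.trace F L (dg hσ (e i).1 * dg hσ (e' i).1) = 1 := by
      intro i
      rw [← tf_apply, ← hB, hBc, hdd, if_pos rfl]
    simp [h4]
  have hc0 : c ≠ 0 := by
    rintro rfl
    rw [zero_mul] at htr
    have := htr.symm
    rw [Nat.cast_eq_zero, Submodule.finrank_eq_zero] at this
    exact hz this
  refine ⟨- (c⁻¹ • Ω v₀), L.neg_mem (L.smul_mem _ (hΩL _ hDL)), fun γ => ?_⟩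
  have h5 := hc _ (hv γ)
  rw [map_sub, hΩeq] at h5
  have h6 : ρ γ (Ω v₀) = Ω v₀ + c • (ρ γ v₀ - v₀) := by rw [← h5]; abel
  rw [map_add, map_neg, map_smul, h6, smul_add, smul_smul, inv_mul_cancel₀ hc0, one_smul]
  abel

lemma Red.fix_aux (hr : Red h₀) : ∀ (n : ℕ) (V : Type) [AddCommGroup V] [Module F V] [FiniteDimensional F V]
    (ρ : Representation F Γ V) (hρ : Rat R ρ) (K : Submodule F V) (hK : Stab ρ K), finrank F V = n →
    ∀ v₀ : V, (∀ γ, ρ γ v₀ - v₀ ∈ K) → ∃ l ∈ K, ∀ γ, ρ γ (v₀ + l) = v₀ + l := by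
  intro n
  induction n using Nat.strong_induction_on with
  | _ n ih =>
  intro V _ _ _ ρ hρ K hK hn v₀ hv
  by_cases hb : K = ⊥
  · refine ⟨0, K.zero_mem, fun γ => ?_⟩
    have := hv γ
    rw [hb, Submodule.mem_bot, sub_eq_zero] at this
    rw [add_zero, this]
  obtain ⟨L, hLK, hL⟩ := exists_irr K hb hK
  have hdim : finrank F (V ⧸ L) < n := by
    have h1 := L.finrank_quotient_add_finrank
    have h2 : finrank F L ≠ 0 := by rw [Ne, Submodule.finrank_eq_zero]; exact hL.1
    omega
  obtain ⟨l, hl, hfix⟩ := ih _ hdim (V ⧸ L) (quoRep ρ L hL.2.1) (hρ.quo L hL.2.1) (K.map L.mkQ)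
    (by
      rintro γ _ ⟨x, hx, rfl⟩
      exact ⟨ρ γ x, hK γ x hx, rfl⟩) rfl (L.mkQ v₀) (by
      intro γ
      exact ⟨ρ γ v₀ - v₀, hv γ, by rw [map_sub]; rfl⟩)
  obtain ⟨x, hx, rfl⟩ := hl
  obtain ⟨l', hl', hfix'⟩ := hr.fix_irr hρ hL (v₀ + x) (by
    intro γ
    have := hfix γ
    rw [← map_add] at this
    exact (Submodule.Quotient.eq L).1 this)
  exact ⟨x + l', K.add_mem hx (hLK hl'), fun γ => by rw [← add_assoc]; exact hfix' γ⟩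

/-- Complete reducibility. -/
theorem Red.exists_proj (hr : Red h₀) (hρ : Rat R ρ) (U : Submodule F V) (hU : Stab ρ U) :
    ∃ q : V →ₗ[F] V, (∀ γ v, q (ρ γ v) = ρ γ (q v)) ∧ (∀ v, q v ∈ U) ∧ ∀ u ∈ U, q u = u := by
  obtain ⟨p, hp⟩ := U.subtype.exists_leftInverse_of_injective U.ker_subtype
  let v₀ : V →ₗ[F] V := U.subtype ∘ₗ p
  have hv0 : ∀ u ∈ U, v₀ u = u := fun u hu =>
    congrArg Subtype.val (LinearMap.congr_fun hp ⟨u, hu⟩)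
  let K : Submodule F (V →ₗ[F] V) :=
    { carrier := {f | (∀ v, f v ∈ U) ∧ ∀ u ∈ U, f u = 0}
      zero_mem' := ⟨fun v => U.zero_mem, fun _ _ => rfl⟩
      add_mem' := fun ha hb => ⟨fun v => U.add_mem (ha.1 v) (hb.1 v), fun u hu => by
        rw [LinearMap.add_apply, ha.2 u hu, hb.2 u hu, add_zero]⟩
      smul_mem' := fun c a ha => ⟨fun v => U.smul_mem c (ha.1 v), fun u hu => by
        rw [LinearMap.smul_apply, ha.2 u hu, smul_zero]⟩ }
  have hK : Stab (Representation.linHom ρ ρ) K := by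
    intro γ f hf
    rw [Representation.linHom_apply]
    exact ⟨fun v => hU _ _ (hf.1 _), fun u hu => by
      rw [LinearMap.comp_apply, LinearMap.comp_apply, hf.2 _ (hU _ _ hu), map_zero]⟩
  obtain ⟨l, hl, hfix⟩ := hr.fix_aux _ _ (Representation.linHom ρ ρ) (hρ.linHom hρ) K hK rfl v₀ (by
    intro γ
    rw [Representation.linHom_apply]
    refine ⟨fun v => U.sub_mem (hU _ _ (p _).2) (p v).2, fun u hu => ?_⟩
    rw [LinearMap.sub_apply, LinearMap.comp_apply, LinearMap.comp_apply, hv0 _ (hU _ _ hu), rho_inv',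
      hv0 u hu, sub_self])
  refine ⟨v₀ + l, fun γ v => ?_, fun v => U.add_mem (p v).2 (hl.1 v), fun u hu => by
    rw [LinearMap.add_apply, hv0 u hu, hl.2 u hu, add_zero]⟩
  have h1 := LinearMap.congr_fun (hfix γ) (ρ γ v)
  rw [Representation.linHom_apply, LinearMap.comp_apply, LinearMap.comp_apply, rho_inv] at h1
  exact h1.symm

end reps
end RG

namespace RG
open Module Polynomial

lemma exists_ell {A ι : Type} [AddCommGroup A] [Finite ι] (v : ι → A)
    (h : ∀ i, ∀ k : ℤ, k ≠ 0 → k • v i ≠ 0) : ∃ l : A →+ ℚ, ∀ i, l (v i) ≠ 0 := by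
  let f := TensorProduct.mk ℤ ℚ A 1
  have hf : IsLocalizedModule (nonZeroDivisors ℤ) f :=
    (isLocalizedModule_iff_isBaseChange (nonZeroDivisors ℤ) ℚ f).2 (TensorProduct.isBaseChange ℤ A ℚ)
  obtain ⟨d, hd⟩ := Module.exists_dual_forall_apply_ne_zero (K := ℚ) (fun i => f (v i)) (by
    intro i hi
    obtain ⟨c, hc⟩ := (IsLocalizedModule.eq_zero_iff (nonZeroDivisors ℤ) f).1 hi
    exact h i c.1 (nonZeroDivisors.ne_zero c.2) hc)
  exact ⟨d.toAddMonoidHom.comp f.toAddMonoidHom, hd⟩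

/-- For a diagonalizable operator generalized eigenvectors are eigenvectors. -/
lemma genEig_le_of_diag {F V : Type} [Field F] [AddCommGroup V] [Module F V] (f : End F V)
    (h : ⨆ μ, f.eigenspace μ = ⊤) (μ : F) : f.maxGenEigenspace μ ≤ f.eigenspace μ := by
  intro v hv
  have h1 : v ∈ f.eigenspace μ ⊔ ⨆ (ν) (_ : ν ≠ μ), f.eigenspace ν := by
    have : f.eigenspace μ ⊔ ⨆ (ν) (_ : ν ≠ μ), f.eigenspace ν = ⊤ := by
      rw [eq_top_iff, ← h]
      refine iSup_le fun ν => ?_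
      by_cases hν : ν = μ
      · rw [hν]; exact le_sup_left
      · exact le_sup_of_le_right (le_iSup₂_of_le ν hν le_rfl)
    rw [this]; trivial
  obtain ⟨a, ha, b, hb, rfl⟩ := Submodule.mem_sup.1 h1
  have hle : ∀ ν, f.eigenspace ν ≤ f.maxGenEigenspace ν := fun ν =>
    (f.genEigenspace ν).mono le_top
  have hb1 : b ∈ f.maxGenEigenspace μ := by
    have := Submodule.sub_mem _ hv (hle μ ha)
    simpa using this
  have hb2 : b ∈ ⨆ (ν) (_ : ν ≠ μ), f.maxGenEigenspace ν :=
    (iSup₂_mono fun ν _ => hle ν) hb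
  have := (End.independent_maxGenEigenspace f μ).le_bot ⟨hb1, hb2⟩
  rw [Submodule.mem_bot] at this
  rw [this, add_zero]; exact ha

section reps
variable {F : Type} [Field F] {Γ : Type} [Group Γ] {R : Subalgebra F (Γ → F)}
variable {V V' : Type} [AddCommGroup V] [Module F V] [AddCommGroup V'] [Module F V']
variable {ρ : Representation F Γ V} {ρ' : Representation F Γ V'}

/-- weight spaces -/
def wt (T : Subgroup Γ) (ρ : Representation F Γ V) (χ : T →* Fˣ) : Submodule F V where
  carrier := {v | ∀ t : T, ρ t v = (χ t : F) • v}
  zero_mem' := fun t => by simp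
  add_mem' := fun ha hb t => by rw [map_add, ha, hb, smul_add]
  smul_mem' := fun c a ha t => by rw [map_smul, ha, smul_comm]

lemma mem_wt {T : Subgroup Γ} {χ : T →* Fˣ} {v : V} :
    v ∈ wt T ρ χ ↔ ∀ t : T, ρ t v = (χ t : F) • v := Iff.rfl

/-- properties of a maximal torus, in terms of the coordinate ring -/
structure MTor (R : Subalgebra F (Γ → F)) [Good R] (T : Subgroup Γ) : Prop where
  comm : ∀ a ∈ T, ∀ b ∈ T, a * b = b * a
  diag : ∀ t ∈ T, ⨆ μ, End.eigenspace (rt t : R →ₐ[F] R).toLinearMap μ = ⊤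
  tf : ∀ f : R, (∀ s ∈ T, ∀ t ∈ T, f.1 (s * t) = f.1 s * f.1 t) → ∀ k : ℕ, k ≠ 0 →
    (∀ t ∈ T, f.1 t ^ k = 1) → ∀ t ∈ T, f.1 t = 1
  cen : ∀ D : Lg R, (∀ t ∈ T, Ad R t D = D) → ∀ (f f' : R) (χ : T →* Fˣ) (μ μ' : F), f ≠ 0 → f' ≠ 0 →
    (∀ t : T, rt (t : Γ) f = (χ t : F) • f) → (∀ t : T, rt (t : Γ) f' = (χ t : F) • f') →
    der D f = μ • f → der D f' = μ' • f' → μ = μ'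

variable {T : Subgroup Γ} [FiniteDimensional F V] [FiniteDimensional F V']

lemma wt_genEig [Good R] (hT : MTor R T) (hρ : Rat R ρ) (t : T) (μ : F) (v : V)
    (hv : v ∈ End.maxGenEigenspace (ρ t) μ) : ρ t v = μ • v := by
  rw [← act_rt hρ (t : Γ)] at hv
  refine eq_of_coef hρ fun ξ => ?_
  have h1 := coef_genEig hρ (linv_rt (t : Γ)) μ hv ξ
  have h2 := genEig_le_of_diag _ (hT.diag t t.2) μ h1
  rw [End.mem_eigenspace_iff] at h2
  rw [← act_rt hρ (t : Γ), coef_act hρ (linv_rt (t : Γ)), h2]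
  exact ((coefL hρ ξ).map_smul μ v).symm

lemma commute_T [Good R] (hT : MTor R T) (ρ : Representation F Γ V) (s t : T) :
    Commute (ρ s) (ρ t) := by
  rw [commute_iff_eq, ← map_mul, ← map_mul, hT.comm s s.2 t t.2]

lemma wt_le (χ : T →* Fˣ) :
    wt T ρ χ ≤ ⨅ t : T, End.maxGenEigenspace (ρ t) ((fun t => (χ t : F)) t) := by
  intro v hv
  rw [Submodule.mem_iInf]
  intro t
  rw [End.mem_maxGenEigenspace]
  refine ⟨1, ?_⟩
  have := hv t
  simp [this]

lemma iSupIndep_wt [Good R] (hT : MTor R T) (ρ : Representation F Γ V) : iSupIndep (wt T ρ) := by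
  have h := End.independent_iInf_maxGenEigenspace_of_forall_mapsTo (fun t : T => ρ t)
    (fun i j φ => End.mapsTo_maxGenEigenspace_of_comm (commute_T hT ρ j i) φ)
  have hinj : Function.Injective (fun (χ : T →* Fˣ) (t : T) => (χ t : F)) := by
    intro a b hab
    ext t
    exact congrFun hab t
  exact (h.comp hinj).mono wt_le

lemma iSup_wt [IsAlgClosed F] [Good R] (hT : MTor R T) (hρ : Rat R ρ) : ⨆ χ, wt T ρ χ = ⊤ := by
  have h := End.iSup_iInf_maxGenEigenspace_eq_top_of_forall_mapsTo (fun t : T => ρ t)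
    (fun i j φ => End.mapsTo_maxGenEigenspace_of_comm (commute_T hT ρ j i) φ)
    (fun t => End.iSup_maxGenEigenspace_eq_top _)
  rw [eq_top_iff, ← h]
  refine iSup_le fun c => ?_
  intro v hv
  rw [Submodule.mem_iInf] at hv
  have hv' : ∀ t : T, ρ t v = c t • v := fun t => wt_genEig hT hρ t _ v (hv t)
  by_cases h0 : v = 0
  · rw [h0]; exact Submodule.zero_mem _
  let χ : T →* F :=
    { toFun := c
      map_one' := by
        have := hv' 1
        simp only [Subgroup.coe_one, map_one, End.one_apply] at this
        have h2 : (c 1 - 1) • v = 0 := by rw [sub_smul, ← this, one_smul, sub_self]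
        exact sub_eq_zero.1 ((smul_eq_zero.1 h2).resolve_right h0)
      map_mul' := by
        intro s t
        have h1 := hv' (s * t)
        rw [Subgroup.coe_mul, map_mul, End.mul_apply, hv' t, map_smul, hv' s, smul_smul] at h1
        have h2 : (c (s * t) - c s * c t) • v = 0 := by
          rw [sub_smul, ← h1, mul_comm (c s), sub_self]
        exact sub_eq_zero.1 ((smul_eq_zero.1 h2).resolve_right h0) }
  exact Submodule.mem_iSup_of_mem χ.toHomUnits (fun t => hv' t)

lemma dg_wt [Good R] (hρ : Rat R ρ) {α χ : T →* Fˣ} {D : Lg R} (hD : D ∈ wt T (Ad R) α) {v : V}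
    (hv : v ∈ wt T ρ χ) : dg hρ D v ∈ wt T ρ (α * χ) := by
  intro t
  have h1 := dg_ad hρ (t : Γ) D (ρ t v)
  rw [rho_inv0, hD t, hv t, map_smul, map_smul, LinearMap.smul_apply, smul_smul] at h1
  rw [← h1]; simp [mul_comm]

lemma Red.rat_Ad {W : Type} [AddCommGroup W] [Module F W] [FiniteDimensional F W]
    {ρ₀ : Representation F Γ W} {h₀ : Rat R ρ₀} [Good R] (hr : Red h₀) : Rat R (Ad R) := by
  haveI := hr.fd
  exact Rat.of_inj (h₀.linHom h₀) (dg h₀) (fun γ D => by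
    rw [dg_ad']; rfl) hr.faith

/-- torsion-freeness of weights -/
lemma wt_tf [Good R] (hT : MTor R T) (hρ : Rat R ρ) {χ : T →* Fˣ} (h : wt T ρ χ ≠ ⊥) (h1 : χ ≠ 1)
    (k : ℤ) (hk : k ≠ 0) : ¬ ∀ t, χ t ^ k = 1 := by
  intro hk1
  obtain ⟨v, hv, hv0⟩ := Submodule.exists_mem_ne_zero_of_ne_bot h
  obtain ⟨ξ, hξ⟩ : ∃ ξ : Dual F V, ξ v ≠ 0 := by
    by_contra hc
    push Not at hc
    exact hv0 ((Module.forall_dual_apply_eq_zero_iff F v).1 hc)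
  let f : R := (ξ v)⁻¹ • coef hρ ξ v
  have hf : ∀ t : T, f.1 t = χ t := by
    intro t
    change (ξ v)⁻¹ • ξ (ρ t v) = _
    rw [hv t, map_smul, smul_eq_mul, smul_eq_mul]
    field_simp
  have hk2 : ∀ t, χ t ^ k.natAbs = 1 := by
    intro t
    replace hk1 := hk1 t
    rcases Int.natAbs_eq k with h | h
    · rw [h, zpow_natCast] at hk1; exact hk1
    · rw [h, zpow_neg, zpow_natCast, inv_eq_one] at hk1; exact hk1
  apply h1
  ext t
  have := hT.tf f (fun s hs t ht => by
    rw [hf ⟨s, hs⟩, hf ⟨t, ht⟩]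
    rw [show s * t = ((⟨s, hs⟩ * ⟨t, ht⟩ : T) : Γ) from rfl, hf, map_mul, Units.val_mul]) k.natAbs
    (by simpa using hk) (fun s hs => by
      rw [hf ⟨s, hs⟩, ← Units.val_pow_eq_pow_val, hk2]; rfl) t t.2
  rw [hf] at this
  rw [this]; rfl

end reps
end RG

namespace RG
open Module Polynomial

lemma nilp_of_eig {F E : Type} [Field F] [IsAlgClosed F] [AddCommGroup E] [Module F E]
    [FiniteDimensional F E] (a : End F E) (h : ∀ (μ : F) (v : E), v ≠ 0 → a v = μ • v → μ = 0) :
    IsNilpotent a := by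
  have h1 : a.maxGenEigenspace 0 = ⊤ := by
    rw [← End.iSup_maxGenEigenspace_eq_top a]
    refine le_antisymm (le_iSup a.maxGenEigenspace 0) (iSup_le fun μ => ?_)
    by_cases hμ : μ = 0
    · rw [hμ]
    · have : a.maxGenEigenspace μ = ⊥ := by
        by_contra hne
        have h2 : a.HasEigenvalue μ := by
          refine a.hasEigenvalue_of_hasGenEigenvalue (μ := μ) (k := a.maxGenEigenspaceIndex μ) ?_
          rw [End.maxGenEigenspace_eq] at hne
          exact hne
        obtain ⟨v, hv⟩ := h2.exists_hasEigenvector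
        exact hμ (h μ v hv.2 hv.apply_eq_smul)
      rw [this]; exact bot_le
  refine ⟨a.maxGenEigenspaceIndex 0, ?_⟩
  ext v
  have hv : v ∈ a.maxGenEigenspace 0 := by rw [h1]; trivial
  rw [End.maxGenEigenspace_eq, End.mem_genEigenspace_nat] at hv
  simpa using hv

section reps
variable {F : Type} [Field F] {Γ : Type} [Group Γ] {R : Subalgebra F (Γ → F)}
variable {V V' : Type} [AddCommGroup V] [Module F V] [AddCommGroup V'] [Module F V']
variable {ρ : Representation F Γ V} {ρ' : Representation F Γ V'}
variable {T : Subgroup Γ} [FiniteDimensional F V] [FiniteDimensional F V']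
variable [IsAlgClosed F] [CharZero F] [Good R]

lemma exists_l {W : Type} [AddCommGroup W] [Module F W] [FiniteDimensional F W]
    {ρ₀ : Representation F Γ W} {h₀ : Rat R ρ₀} (hr : Red h₀) (hT : MTor R T) :
    ∃ l : Additive (T →* Fˣ) →+ ℚ, ∀ α : T →* Fˣ, wt T (Ad R) α ≠ ⊥ → α ≠ 1 →
      l (Additive.ofMul α) ≠ 0 := by
  haveI := hr.fd
  have hfin := WellFoundedGT.finite_ne_bot_of_iSupIndep (iSupIndep_wt hT (Ad R))
  have hfin2 : {α : T →* Fˣ | wt T (Ad R) α ≠ ⊥ ∧ α ≠ 1}.Finite := hfin.subset fun α h => h.1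
  haveI := hfin2.to_subtype
  obtain ⟨l, hl⟩ := exists_ell
    (fun α : {α : T →* Fˣ | wt T (Ad R) α ≠ ⊥ ∧ α ≠ 1} => Additive.ofMul α.1) (by
      rintro ⟨α, h1, h2⟩ k hk h0
      refine wt_tf hT hr.rat_Ad h1 h2 k hk fun t => ?_
      have h3 := congrArg (fun a : Additive (T →* Fˣ) => MonoidHom.eval t a.toMul) h0
      simp only [toMul_zsmul, map_zpow, toMul_ofMul, toMul_zero, map_one, MonoidHom.eval_apply_apply] at h3
      exact h3)
  exact ⟨l, fun α h1 h2 => hl ⟨α, h1, h2⟩⟩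


lemma cen_eig (hT : MTor R T) (hρ : Rat R ρ) (hρ' : Rat R ρ') {χ : T →* Fˣ} {D : Lg R}
    (hD : D ∈ wt T (Ad R) 1) {v : V} {v' : V'} (hv : v ∈ wt T ρ χ) (hv' : v' ∈ wt T ρ' χ)
    (h0 : v ≠ 0) (h0' : v' ≠ 0) {μ μ' : F} (h : dg hρ D v = μ • v) (h' : dg hρ' D v' = μ' • v') :
    μ = μ' := by
  have ex : ∀ {U : Type} [AddCommGroup U] [Module F U] (u : U), u ≠ 0 → ∃ ξ : Dual F U, ξ u ≠ 0 := by
    intro U _ _ u hu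
    by_contra hc
    push Not at hc
    exact hu ((Module.forall_dual_apply_eq_zero_iff F u).1 hc)
  obtain ⟨ξ, hξ⟩ := ex v h0
  obtain ⟨ξ', hξ'⟩ := ex v' h0'
  refine hT.cen D (fun t ht => ?_) (coef hρ ξ v) (coef hρ' ξ' v') χ μ μ' ?_ ?_ ?_ ?_ ?_ ?_
  · have := hD ⟨t, ht⟩
    simpa using this
  · intro h
    have := congrArg (fun f : R => f.1 1) h
    apply hξ; simpa using this
  · intro h
    have := congrArg (fun f : R => f.1 1) h
    apply hξ'; simpa using this
  · intro t
    refine R_ext fun γ => ?_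
    rw [rt_apply, coef_apply, map_mul, End.mul_apply, hv t, map_smul, map_smul]; rfl
  · intro t
    refine R_ext fun γ => ?_
    rw [rt_apply, coef_apply, map_mul, End.mul_apply, hv' t, map_smul, map_smul]; rfl
  · rw [← coef_dg, h]; exact (coefL hρ ξ).map_smul μ v
  · rw [← coef_dg, h']; exact (coefL hρ' ξ').map_smul μ' v'

lemma dg_wt1 (hρ : Rat R ρ) {χ : T →* Fˣ} {D : Lg R} (hD : D ∈ wt T (Ad R) 1) {v : V}
    (hv : v ∈ wt T ρ χ) : dg hρ D v ∈ wt T ρ χ := by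
  intro t
  have := dg_wt hρ hD hv t
  simpa using this

lemma lie_wt1 {D E : Lg R} (hD : D ∈ wt T (Ad R) 1) (hE : E ∈ wt T (Ad R) 1) :
    ⁅D, E⁆ ∈ wt T (Ad R) 1 := by
  intro t
  rw [Ad_lie, hD t, hE t]; simp

lemma exists_psi (hT : MTor R T) (hρ : Rat R ρ) {χ : T →* Fˣ} (hχ : wt T ρ χ ≠ ⊥) :
    ∃ ψ : Lg R →ₗ[F] F, (∀ D ∈ wt T (Ad R) 1, ∀ E ∈ wt T (Ad R) 1, ψ ⁅D, E⁆ = 0) ∧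
      ∀ D ∈ wt T (Ad R) 1, ∃ v ∈ wt T ρ χ, v ≠ 0 ∧ dg hρ D v = ψ D • v := by
  set E := wt T ρ χ with hE
  haveI : Nontrivial E := Submodule.nontrivial_iff_ne_bot.2 hχ
  obtain ⟨p, hp⟩ := E.subtype.exists_leftInverse_of_injective E.ker_subtype
  have hp' : ∀ v ∈ E, ((p v : E) : V) = v := fun v hv => by
    have := LinearMap.congr_fun hp ⟨v, hv⟩
    exact congrArg Subtype.val this
  let r : Lg R →ₗ[F] End F E :=
    { toFun := fun D => p ∘ₗ dg hρ D ∘ₗ E.subtype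
      map_add' := fun a b => by ext v; simp
      map_smul' := fun a b => by ext v; simp }
  have hr : ∀ D ∈ wt T (Ad R) 1, ∀ v : E, ((r D v : E) : V) = dg hρ D v := fun D hD v =>
    hp' _ (dg_wt1 hρ hD v.2)
  have hd : (finrank F E : F) ≠ 0 := by
    exact_mod_cast (finrank_pos (R := F) (M := E)).ne'
  refine ⟨(finrank F E : F)⁻¹ • (LinearMap.trace F E ∘ₗ r), ?_, ?_⟩
  · intro D hD D' hD'
    have : r ⁅D, D'⁆ = r D * r D' - r D' * r D := by
      ext v
      rw [hr _ (lie_wt1 hD hD'), dg_lie, LinearMap.sub_apply, LinearMap.sub_apply,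
        Submodule.coe_sub, End.mul_apply, End.mul_apply, End.mul_apply, End.mul_apply, hr _ hD,
        hr _ hD', hr _ hD', hr _ hD]
    rw [LinearMap.smul_apply, LinearMap.comp_apply, this, map_sub, LinearMap.trace_mul_comm,
      sub_self, smul_zero]
  · intro D hD
    obtain ⟨c, hc⟩ := End.exists_eigenvalue (r D)
    obtain ⟨w, hw⟩ := hc.exists_hasEigenvector
    have hw1 : dg hρ D w = c • (w : V) := by
      rw [← hr D hD, hw.apply_eq_smul]; rfl
    have hw0 : (w : V) ≠ 0 := fun h => hw.2 (Subtype.ext h)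
    have hn : IsNilpotent (r D - c • 1) := by
      refine nilp_of_eig _ fun μ v hv0 hv => ?_
      have h1 : dg hρ D v = (μ + c) • (v : V) := by
        rw [← hr D hD]
        have : r D v = (μ + c) • v := by
          rw [add_smul, ← hv]; simp
        rw [this]; rfl
      have := cen_eig hT hρ hρ hD v.2 w.2 (fun h => hv0 (Subtype.ext h)) hw0 h1 hw1
      simpa using this
    have htr := (LinearMap.isNilpotent_trace_of_isNilpotent hn).eq_zero
    rw [map_sub, map_smul, LinearMap.trace_one, sub_eq_zero] at htr
    refine ⟨w, w.2, hw0, ?_⟩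
    rw [hw1, LinearMap.smul_apply, LinearMap.comp_apply, htr]
    congr 1
    rw [smul_eq_mul, smul_eq_mul, mul_comm c, ← mul_assoc, inv_mul_cancel₀ hd, one_mul]

lemma common_vec (hT : MTor R T) (hρ : Rat R ρ) {χ : T →* Fˣ} (hχ : wt T ρ χ ≠ ⊥)
    (ψ : Lg R →ₗ[F] F) (h1 : ∀ D ∈ wt T (Ad R) 1, ∀ E ∈ wt T (Ad R) 1, ψ ⁅D, E⁆ = 0)
    (h2 : ∀ D ∈ wt T (Ad R) 1, ∀ v ∈ wt T ρ χ, v ≠ 0 → ∀ μ : F, dg hρ D v = μ • v → μ = ψ D) :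
    ∃ v ∈ wt T ρ χ, v ≠ 0 ∧ ∀ D ∈ wt T (Ad R) 1, dg hρ D v = ψ D • v := by
  set E := wt T ρ χ with hE
  haveI : Nontrivial E := Submodule.nontrivial_iff_ne_bot.2 hχ
  have hz : (0 : Lg R) ∈ wt T (Ad R) 1 := by intro t; simp
  have hs : ∀ (c : F) (D : Lg R), D ∈ wt T (Ad R) 1 → c • D ∈ wt T (Ad R) 1 := by
    intro c D hD t; rw [map_smul, hD t, smul_comm]
  let S : Submodule F (End F E) :=
    { carrier := {a | ∃ D ∈ wt T (Ad R) 1, ∀ v : E, ((a v : E) : V) = dg hρ D v - ψ D • (v : V)}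
      zero_mem' := ⟨0, hz, fun v => by simp⟩
      add_mem' := by
        rintro a b ⟨D, hD, ha⟩ ⟨D', hD', hb⟩
        refine ⟨D + D', Submodule.add_mem _ hD hD', fun v => ?_⟩
        rw [LinearMap.add_apply, Submodule.coe_add, ha, hb, map_add, map_add, LinearMap.add_apply,
          add_smul]
        abel
      smul_mem' := by
        rintro c a ⟨D, hD, ha⟩
        refine ⟨c • D, hs c D hD, fun v => ?_⟩
        rw [LinearMap.smul_apply, Submodule.coe_smul, ha, map_smul, map_smul, LinearMap.smul_apply,
          smul_sub, smul_assoc] }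
  obtain ⟨v, hv0, hv⟩ := engel_end S (by
    rintro a ⟨D, hD, ha⟩ b ⟨D', hD', hb⟩
    refine ⟨⁅D, D'⁆, lie_wt1 hD hD', fun v => ?_⟩
    rw [h1 D hD D' hD', dg_lie, LinearMap.sub_apply, LinearMap.sub_apply, End.mul_apply,
      End.mul_apply, End.mul_apply, End.mul_apply, Submodule.coe_sub, ha, hb, hb, ha]
    simp only [map_sub, map_smul, smul_sub, smul_smul, mul_comm (ψ D)]
    module) (by
    rintro a ⟨D, hD, ha⟩
    refine nilp_of_eig _ fun μ v hv0 hv => ?_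
    have h3 := ha v
    rw [hv] at h3
    have := h2 D hD v v.2 (fun h => hv0 (Subtype.ext h)) (μ + ψ D) (by
      rw [add_smul]; exact (sub_eq_iff_eq_add.1 h3.symm))
    simpa using this)
  refine ⟨v, v.2, fun h => hv0 (Subtype.ext h), fun D hD => ?_⟩
  let a : End F E := (dg hρ D).restrict (fun v hv => dg_wt1 hρ hD hv) - ψ D • 1
  have := hv a ⟨D, hD, fun v => by simp [a]⟩
  have h3 := congrArg Subtype.val this
  simp only [a] at h3
  exact sub_eq_zero.1 h3

end reps
end RG

namespace RG
open Module Polynomial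
section reps
variable {F : Type} [Field F] {Γ : Type} [Group Γ] {R : Subalgebra F (Γ → F)}
variable {V V' : Type} [AddCommGroup V] [Module F V] [AddCommGroup V'] [Module F V']
variable {ρ : Representation F Γ V} {ρ' : Representation F Γ V'}
variable {T : Subgroup Γ} [FiniteDimensional F V] [FiniteDimensional F V']
variable [IsAlgClosed F] [CharZero F] [Good R]

/-- from an invariant correspondence to a homomorphism -/
lemma graph_hom (M : Submodule F (V × V')) (hM : Stab (prodRep ρ ρ') M)
    (i1 : Irr ρ ⊤) (i2 : Irr ρ' ⊤) {v : V} {v' : V'} (hv : (v, v') ∈ M) (hv0 : v ≠ 0) (hv0' : v' ≠ 0)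
    (hn : ((0 : V), v') ∉ M) :
    ∃ f : V →ₗ[F] V', f ≠ 0 ∧ ∀ γ w, f (ρ γ w) = ρ' γ (f w) := by
  let N2 : Submodule F V' := M.comap (LinearMap.inr F V V')
  have hN2 : ∀ x, x ∈ N2 ↔ ((0 : V), x) ∈ M := fun x => Iff.rfl
  have s2 : Stab ρ' N2 := by
    intro γ x hx
    rw [hN2] at hx ⊢
    have := hM γ _ hx
    simpa using this
  have b2 : N2 = ⊥ := (i2.2.2 N2 le_top s2).resolve_right fun h => hn ((hN2 v').1 (by rw [h]; trivial))
  let N1 : Submodule F V := M.map (LinearMap.fst F V V')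
  have s1 : Stab ρ N1 := by
    rintro γ _ ⟨x, hx, rfl⟩
    exact ⟨_, hM γ x hx, rfl⟩
  have b1 : N1 = ⊤ := (i1.2.2 N1 le_top s1).resolve_left fun h => hv0 (by
    have : v ∈ N1 := ⟨_, hv, rfl⟩
    rw [h] at this; exact this)
  let e0 : M →ₗ[F] V := LinearMap.fst F V V' ∘ₗ M.subtype
  have hbij : Function.Bijective e0 := by
    constructor
    · rw [← LinearMap.ker_eq_bot, LinearMap.ker_eq_bot']
      rintro ⟨⟨a, b⟩, hab⟩ h
      have ha : a = 0 := h
      subst ha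
      have hb : b ∈ N2 := hab
      rw [b2, Submodule.mem_bot] at hb
      subst hb; rfl
    · intro x
      have : x ∈ N1 := by rw [b1]; trivial
      obtain ⟨y, hy, rfl⟩ := this
      exact ⟨⟨y, hy⟩, rfl⟩
  let e := LinearEquiv.ofBijective e0 hbij
  refine ⟨LinearMap.snd F V V' ∘ₗ M.subtype ∘ₗ e.symm.toLinearMap, ?_, ?_⟩
  · intro h
    have h1 : e.symm v = ⟨(v, v'), hv⟩ := by rw [LinearEquiv.symm_apply_eq]; rfl
    have h2 := LinearMap.congr_fun h v
    simp only [LinearMap.comp_apply, LinearEquiv.coe_coe, h1] at h2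
    exact hv0' h2
  · intro γ w
    obtain ⟨m, rfl⟩ := e.surjective w
    have h1 : e.symm (ρ γ (e m)) = ⟨prodRep ρ ρ' γ m, hM γ m m.2⟩ := by
      rw [LinearEquiv.symm_apply_eq]; rfl
    simp only [LinearMap.comp_apply, LinearEquiv.coe_coe, h1, LinearEquiv.symm_apply_apply]
    rfl

theorem highest_weight {W : Type} [AddCommGroup W] [Module F W] [FiniteDimensional F W]
    {ρ₀ : Representation F Γ W} {h₀ : Rat R ρ₀} (hr : Red h₀) (hT : MTor R T)
    (hρ : Rat R ρ) (hρ' : Rat R ρ') (i1 : Irr ρ ⊤) (i2 : Irr ρ' ⊤)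
    (hw : ∀ χ, wt T ρ χ ≠ ⊥ ↔ wt T ρ' χ ≠ ⊥) :
    ∃ f : V →ₗ[F] V', f ≠ 0 ∧ ∀ γ w, f (ρ γ w) = ρ' γ (f w) := by
  haveI := hr.fd
  obtain ⟨l, hl⟩ := exists_l hr hT
  let L : (T →* Fˣ) → ℚ := fun χ => l (Additive.ofMul χ)
  have hLmul : ∀ a b, L (a * b) = L a + L b := fun a b => l.map_add _ _
  have hfin := WellFoundedGT.finite_ne_bot_of_iSupIndep (iSupIndep_wt hT ρ)
  have hne : {χ | wt T ρ χ ≠ ⊥}.Nonempty := by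
    by_contra h
    rw [Set.not_nonempty_iff_eq_empty] at h
    have h1 : ∀ χ, wt T ρ χ = ⊥ := fun χ => by
      by_contra hc
      have : χ ∈ {χ | wt T ρ χ ≠ ⊥} := hc
      rw [h] at this; exact this
    have h2 := iSup_wt hT hρ
    simp only [h1, iSup_bot] at h2
    exact i1.1 h2.symm
  obtain ⟨χ, hχ, hmax⟩ := Set.exists_max_image _ L hfin hne
  have hmax' : ∀ κ, L χ < L κ → wt T (prodRep ρ ρ') κ = ⊥ := by
    intro κ hκ
    have h1 : wt T ρ κ = ⊥ := by
      by_contra hc; exact absurd (hmax κ hc) (not_le.2 hκ)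
    have h2 : wt T ρ' κ = ⊥ := by
      by_contra hc; exact absurd (hmax κ ((hw κ).2 hc)) (not_le.2 hκ)
    rw [eq_bot_iff]
    rintro ⟨a, b⟩ hab
    have ha : a ∈ wt T ρ κ := fun t => congrArg Prod.fst (hab t)
    have hb : b ∈ wt T ρ' κ := fun t => congrArg Prod.snd (hab t)
    rw [h1, Submodule.mem_bot] at ha
    rw [h2, Submodule.mem_bot] at hb
    rw [ha, hb]; exact Submodule.zero_mem _
  obtain ⟨ψ, hψ1, hψ2⟩ := exists_psi hT hρ hχ
  obtain ⟨v, hv, hv0, hvD⟩ := common_vec hT hρ hχ ψ hψ1 (by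
    intro D hD w hw hw0 μ h
    obtain ⟨u, hu, hu0, huD⟩ := hψ2 D hD
    exact cen_eig hT hρ hρ hD hw hu hw0 hu0 h huD)
  obtain ⟨v', hv', hv0', hvD'⟩ := common_vec hT hρ' ((hw χ).1 hχ) ψ hψ1 (by
    intro D hD w hw hw0 μ h
    obtain ⟨u, hu, hu0, huD⟩ := hψ2 D hD
    exact cen_eig hT hρ' hρ hD hw hu hw0 hu0 h huD)
  let hσ := hρ.prod hρ'
  let x : V × V' := (v, v')
  have hx : x ∈ wt T (prodRep ρ ρ') χ := fun t => Prod.ext (hv t) (hv' t)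
  let Gm : Set (Lg R) := {D | ∃ α, D ∈ wt T (Ad R) α ∧ L α < 0}
  let SS : Set (Submodule F (V × V')) := {N | x ∈ N ∧ ∀ D ∈ Gm, ∀ w ∈ N, dg hσ D w ∈ N}
  let M := sInf SS
  have hxM : x ∈ M := by
    rw [Submodule.mem_sInf]; exact fun N hN => hN.1
  have hMG : ∀ D ∈ Gm, ∀ w ∈ M, dg hσ D w ∈ M := by
    intro D hD w hw
    rw [Submodule.mem_sInf] at hw ⊢
    exact fun N hN => hN.2 D hD w (hw N hN)
  have hML : ∀ N ∈ SS, M ≤ N := fun N hN => sInf_le hN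
  have hDx : ∀ D : Lg R, dg hσ D x ∈ M := by
    have : (⊤ : Submodule F (Lg R)) ≤ M.comap ((dg hσ).flip x) := by
      rw [← iSup_wt hT hr.rat_Ad]
      refine iSup_le fun α D hD => ?_
      change dg hσ D x ∈ M
      by_cases hα : α = 1
      · subst hα
        rw [dg_prod hρ hρ', hvD D hD, hvD' D hD]
        exact M.smul_mem (ψ D) hxM
      by_cases hb : wt T (Ad R) α = ⊥
      · rw [hb, Submodule.mem_bot] at hD
        rw [hD, map_zero]; exact M.zero_mem
      rcases lt_or_gt_of_ne (hl α hb hα) with h | h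
      · exact hMG D ⟨α, hD, h⟩ x hxM
      · have h1 := dg_wt hσ hD hx
        rw [hmax' (α * χ) (by rw [hLmul]; exact lt_add_of_pos_left _ h), Submodule.mem_bot] at h1
        rw [h1]; exact M.zero_mem
    intro D
    exact this (Submodule.mem_top : D ∈ ⊤)
  have hMst : ∀ D : Lg R, ∀ w ∈ M, dg hσ D w ∈ M := by
    have h1 : M ≤ M ⊓ ⨅ D : Lg R, M.comap (dg hσ D) := by
      refine hML _ ⟨⟨hxM, ?_⟩, ?_⟩
      · simp only [SetLike.mem_coe, Submodule.mem_iInf]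
        exact hDx
      · rintro D hD w ⟨hw1, hw2⟩
        simp only [SetLike.mem_coe, Submodule.mem_iInf, Submodule.mem_comap] at hw2
        refine ⟨hMG D hD w hw1, ?_⟩
        simp only [SetLike.mem_coe, Submodule.mem_iInf, Submodule.mem_comap]
        intro E
        have h2 : dg hσ E (dg hσ D w) = dg hσ ⁅E, D⁆ w + dg hσ D (dg hσ E w) := by
          rw [dg_lie, LinearMap.sub_apply, End.mul_apply, End.mul_apply]; abel
        rw [h2]
        exact M.add_mem (hw2 _) (hMG D hD _ (hw2 E))
    intro D w hw
    have := (h1 hw).2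
    simp only [SetLike.mem_coe, Submodule.mem_iInf, Submodule.mem_comap] at this
    exact this D
  let Low : Submodule F (V × V') := ⨆ (κ) (_ : L κ < L χ), wt T (prodRep ρ ρ') κ
  have hMlow : M ≤ Submodule.span F {x} ⊔ Low := by
    refine hML _ ⟨Submodule.mem_sup_left (Submodule.mem_span_singleton_self x), ?_⟩
    rintro D ⟨α, hD, hα⟩
    have h1 : Submodule.span F {x} ⊔ Low ≤ Low.comap (dg hσ D) := by
      refine sup_le ?_ (iSup₂_le fun κ hκ => ?_)
      · rw [Submodule.span_singleton_le_iff_mem]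
        exact Submodule.mem_iSup_of_mem (α * χ) (Submodule.mem_iSup_of_mem
          (by rw [hLmul]; exact add_lt_of_neg_left _ hα) (dg_wt hσ hD hx))
      · intro w hw
        exact Submodule.mem_iSup_of_mem (α * κ) (Submodule.mem_iSup_of_mem
          (by rw [hLmul]; linarith) (dg_wt hσ hD hw))
    intro w hw
    exact Submodule.mem_sup_right (h1 hw)
  refine graph_hom M (stable_of_dg hσ M hMst) i1 i2 hxM hv0 hv0' fun hc => ?_
  obtain ⟨a, ha, u, hu, hau⟩ := Submodule.mem_sup.1 (hMlow hc)
  obtain ⟨c, rfl⟩ := Submodule.mem_span_singleton.1 ha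
  have hu2 : u = ((0 : V), v') - c • x := by rw [← hau]; abel
  have hu3 : u ∈ wt T (prodRep ρ ρ') χ := by
    rw [hu2]
    refine Submodule.sub_mem _ ?_ (Submodule.smul_mem _ _ hx)
    intro t
    refine Prod.ext ?_ (hv' t)
    simp
  have hu4 : u ∈ ⨆ (κ) (_ : κ ≠ χ), wt T (prodRep ρ ρ') κ := by
    refine (iSup₂_le fun κ hκ => ?_ : Low ≤ _) hu
    exact le_iSup₂_of_le κ (fun h => by rw [h] at hκ; exact lt_irrefl _ hκ) le_rfl
  have hu5 := (iSupIndep_wt hT (prodRep ρ ρ') χ).le_bot ⟨hu3, hu4⟩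
  rw [Submodule.mem_bot, hu2, sub_eq_zero] at hu5
  have h6 : (0 : V) = c • v := congrArg Prod.fst hu5
  have h7 : v' = c • v' := congrArg Prod.snd hu5
  rcases smul_eq_zero.1 h6.symm with h | h
  · rw [h, zero_smul] at h7; exact hv0' h7
  · exact hv0 h

end reps
end RG

variable {F : Type} [Field F]
namespace RG
open Module
section zar
variable {n : ℕ}

/-- The prime attached to a point of `GL n`. -/
noncomputable def pt (g : GL (Fin n) F) : PrimeSpectrum (MvPolynomial (Fin n × Fin n) F) :=
  ⟨RingHom.ker (MvPolynomial.eval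
      (fun q => ((g : GL (Fin n) F) : Matrix (Fin n) (Fin n) F) q.1 q.2)), RingHom.ker_isPrime _⟩

/-- Zariski topology. -/
noncomputable instance zt : TopologicalSpace (GL (Fin n) F) := TopologicalSpace.induced pt inferInstance

lemma pt_ind : Topology.IsInducing (pt : GL (Fin n) F → _) := ⟨rfl⟩

instance noeth_GL : TopologicalSpace.NoetherianSpace (GL (Fin n) F) := pt_ind.noetherianSpace

instance noeth_sub (S : Subgroup (GL (Fin n) F)) : TopologicalSpace.NoetherianSpace S :=
  (Topology.IsInducing.subtypeVal).noetherianSpace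

lemma zclosed_iff (S : Set (GL (Fin n) F)) : IsZClosed S ↔ IsClosed S := by
  rw [isClosed_induced_iff]
  constructor
  · rintro ⟨I, rfl⟩
    refine ⟨PrimeSpectrum.zeroLocus I, PrimeSpectrum.isClosed_zeroLocus _, ?_⟩
    ext g; simp only [Set.mem_preimage, PrimeSpectrum.mem_zeroLocus, Set.mem_setOf_eq]
    exact Iff.rfl
  · rintro ⟨t, ht, rfl⟩
    obtain ⟨I, rfl⟩ := (PrimeSpectrum.isClosed_iff_zeroLocus _).1 ht
    refine ⟨I, ?_⟩
    ext g; simp only [Set.mem_preimage, PrimeSpectrum.mem_zeroLocus, Set.mem_setOf_eq]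
    exact Iff.rfl

lemma zconn_iff (S : Set (GL (Fin n) F)) : IsZConnected S ↔ IsPreconnected S := by
  rw [isPreconnected_closed_iff]
  simp only [IsZConnected, zclosed_iff]

/-- Entries. -/
def en (i j : Fin n) : GL (Fin n) F → F := fun g => (g : Matrix (Fin n) (Fin n) F) i j
def en' (i j : Fin n) : GL (Fin n) F → F := fun g => ((g⁻¹ : GL (Fin n) F) : Matrix (Fin n) (Fin n) F) i j

variable (F n) in
def gens : Set (GL (Fin n) F → F) :=
  Set.range (fun q : Fin n × Fin n => en q.1 q.2) ∪ Set.range (fun q : Fin n × Fin n => en' q.1 q.2)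

variable (F n) in
/-- Regular functions on `GL n`. -/
def OO : Subalgebra F (GL (Fin n) F → F) := Algebra.adjoin F (gens F n)

lemma en_mem (i j : Fin n) : (en i j : GL (Fin n) F → F) ∈ OO F n :=
  Algebra.subset_adjoin (Or.inl ⟨(i, j), rfl⟩)
lemma en'_mem (i j : Fin n) : (en' i j : GL (Fin n) F → F) ∈ OO F n :=
  Algebra.subset_adjoin (Or.inr ⟨(i, j), rfl⟩)

lemma eval_mem (p : MvPolynomial (Fin n × Fin n) F) :
    (fun g : GL (Fin n) F => MvPolynomial.eval (fun q => (g : Matrix (Fin n) (Fin n) F) q.1 q.2) p) ∈ OO F n := by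
  induction p using MvPolynomial.induction_on with
  | C a =>
    have : (fun g : GL (Fin n) F => MvPolynomial.eval (fun q : Fin n × Fin n => (g : Matrix (Fin n) (Fin n) F) q.1 q.2) (MvPolynomial.C a))
      = algebraMap F _ a := by funext g; simp
    rw [this]; exact (OO F n).algebraMap_mem a
  | add p q hp hq => simp only [map_add]; exact (OO F n).add_mem hp hq
  | mul_X p q hp => simp only [map_mul, MvPolynomial.eval_X]; exact (OO F n).mul_mem hp (en_mem _ _)

lemma clear_det {f : GL (Fin n) F → F} (hf : f ∈ OO F n) :
    ∃ (N : ℕ) (p : MvPolynomial (Fin n × Fin n) F), ∀ g : GL (Fin n) F,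
      f g * (g : Matrix (Fin n) (Fin n) F).det ^ N =
        MvPolynomial.eval (fun q => (g : Matrix (Fin n) (Fin n) F) q.1 q.2) p := by
  let gm : Matrix (Fin n) (Fin n) (MvPolynomial (Fin n × Fin n) F) := Matrix.of fun i j => MvPolynomial.X (i, j)
  have hgm : ∀ g : GL (Fin n) F, (MvPolynomial.eval (fun q => (g : Matrix (Fin n) (Fin n) F) q.1 q.2)).mapMatrix gm = g := by
    intro g; ext i j; simp [gm]
  have hdet : ∀ g : GL (Fin n) F, MvPolynomial.eval (fun q => (g : Matrix (Fin n) (Fin n) F) q.1 q.2) gm.det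
      = (g : Matrix (Fin n) (Fin n) F).det := by
    intro g; rw [RingHom.map_det, hgm]
  have hadj : ∀ (g : GL (Fin n) F) i j, MvPolynomial.eval (fun q => (g : Matrix (Fin n) (Fin n) F) q.1 q.2) (gm.adjugate i j)
      = (g : Matrix (Fin n) (Fin n) F).adjugate i j := by
    intro g i j
    have := RingHom.map_adjugate (MvPolynomial.eval (fun q => (g : Matrix (Fin n) (Fin n) F) q.1 q.2)) gm
    rw [hgm] at this
    rw [← this]; rfl
  induction hf using Algebra.adjoin_induction with
  | mem f hf =>
    rcases hf with ⟨q, rfl⟩ | ⟨q, rfl⟩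
    · exact ⟨0, MvPolynomial.X q, fun g => by simp [en]⟩
    · refine ⟨1, gm.adjugate q.1 q.2, fun g => ?_⟩
      rw [hadj]
      have hd : IsUnit (g : Matrix (Fin n) (Fin n) F).det := (Matrix.isUnit_iff_isUnit_det _).1 g.isUnit
      simp only [en', pow_one, Matrix.coe_units_inv]
      rw [Matrix.inv_def, Matrix.smul_apply, smul_eq_mul, Ring.inverse_eq_inv]
      field_simp [hd.ne_zero]
  | algebraMap r => exact ⟨0, MvPolynomial.C r, fun g => by simp⟩
  | add f f' _ _ h h' =>
    obtain ⟨N, p, hp⟩ := h; obtain ⟨N', p', hp'⟩ := h'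
    refine ⟨N + N', p * gm.det ^ N' + p' * gm.det ^ N, fun g => ?_⟩
    simp only [map_add, map_mul, map_pow, hdet, ← hp, ← hp', Pi.add_apply]; ring
  | mul f f' _ _ h h' =>
    obtain ⟨N, p, hp⟩ := h; obtain ⟨N', p', hp'⟩ := h'
    refine ⟨N + N', p * p', fun g => ?_⟩
    simp only [map_mul, ← hp, ← hp', Pi.mul_apply]; ring

lemma closed_zero {f : GL (Fin n) F → F} (hf : f ∈ OO F n) : IsClosed {g | f g = 0} := by
  obtain ⟨N, p, hp⟩ := clear_det hf
  rw [← zclosed_iff]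
  refine ⟨{p}, ?_⟩
  ext g
  have hd : IsUnit (g : Matrix (Fin n) (Fin n) F).det := (Matrix.isUnit_iff_isUnit_det _).1 g.isUnit
  simp [← hp, hd.ne_zero]

lemma closed_exists {S : Set (GL (Fin n) F)} (hS : IsClosed S) {g : GL (Fin n) F} (hg : g ∉ S) :
    ∃ f ∈ OO F n, (∀ s ∈ S, f s = 0) ∧ f g ≠ 0 := by
  rw [← zclosed_iff] at hS
  obtain ⟨I, rfl⟩ := hS
  simp only [Set.mem_setOf_eq, not_forall] at hg
  obtain ⟨p, hp, hpg⟩ := hg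
  exact ⟨_, eval_mem p, fun s hs => hs p hp, hpg⟩

lemma continuous_of {φ : GL (Fin n) F → GL (Fin n) F} (h : ∀ f ∈ OO F n, f ∘ φ ∈ OO F n) : Continuous φ := by
  rw [continuous_iff_isClosed]
  intro S hS
  have : φ ⁻¹' S = ⋂ f : {f // f ∈ OO F n ∧ ∀ s ∈ S, f s = 0}, {g | (f.1 ∘ φ) g = 0} := by
    ext g
    simp only [Set.mem_preimage, Set.mem_iInter, Set.mem_setOf_eq]
    constructor
    · intro hg f; exact f.2.2 _ hg
    · intro hh
      by_contra hg
      obtain ⟨f, hf, h0, h1⟩ := closed_exists hS hg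
      exact h1 (hh ⟨f, hf, h0⟩)
  rw [this]
  exact isClosed_iInter fun f => closed_zero (h _ f.2.1)

lemma comp_mem {φ : GL (Fin n) F → GL (Fin n) F} (h : ∀ i j, en i j ∘ φ ∈ OO F n)
    (h' : ∀ i j, en' i j ∘ φ ∈ OO F n) : ∀ f ∈ OO F n, f ∘ φ ∈ OO F n := by
  intro f hf
  induction hf using Algebra.adjoin_induction with
  | mem f hf =>
    rcases hf with ⟨q, rfl⟩ | ⟨q, rfl⟩
    · exact h _ _
    · exact h' _ _
  | algebraMap r => exact (OO F n).algebraMap_mem r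
  | add f f' _ _ h h' => exact (OO F n).add_mem h h'
  | mul f f' _ _ h h' => exact (OO F n).mul_mem h h'

lemma sum_fun_mem {ι : Type} (s : Finset ι) (f : ι → GL (Fin n) F → F) (h : ∀ i ∈ s, f i ∈ OO F n) :
    (fun g => ∑ i ∈ s, f i g) ∈ OO F n := by
  have : (fun g => ∑ i ∈ s, f i g) = ∑ i ∈ s, f i := by funext g; simp
  rw [this]; exact (OO F n).sum_mem h

lemma const_mem (c : F) : (fun _ : GL (Fin n) F => c) ∈ OO F n := (OO F n).algebraMap_mem c

lemma comp_left (a : GL (Fin n) F) : ∀ f ∈ OO F n, f ∘ (fun g => a * g) ∈ OO F n := by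
  refine comp_mem ?_ ?_ <;> intro i j
  · have : (en i j ∘ fun g : GL (Fin n) F => a * g) = fun g => ∑ k, en i k a * en k j g := by
      funext g; simp [en, Matrix.mul_apply]
    rw [this]
    exact sum_fun_mem _ _ fun k _ => (OO F n).mul_mem (const_mem _) (en_mem _ _)
  · have : (en' i j ∘ fun g : GL (Fin n) F => a * g) = fun g => ∑ k, en' i k g * en' k j a := by
      funext g; simp only [en', Function.comp, mul_inv_rev]; rw [Units.val_mul, Matrix.mul_apply]
    rw [this]
    exact sum_fun_mem _ _ fun k _ => (OO F n).mul_mem (en'_mem _ _) (const_mem _)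

lemma comp_right (a : GL (Fin n) F) : ∀ f ∈ OO F n, f ∘ (fun g => g * a) ∈ OO F n := by
  refine comp_mem ?_ ?_ <;> intro i j
  · have : (en i j ∘ fun g : GL (Fin n) F => g * a) = fun g => ∑ k, en i k g * en k j a := by
      funext g; simp [en, Matrix.mul_apply]
    rw [this]
    exact sum_fun_mem _ _ fun k _ => (OO F n).mul_mem (en_mem _ _) (const_mem _)
  · have : (en' i j ∘ fun g : GL (Fin n) F => g * a) = fun g => ∑ k, en' i k a * en' k j g := by
      funext g; simp only [en', Function.comp, mul_inv_rev]; rw [Units.val_mul, Matrix.mul_apply]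
    rw [this]
    exact sum_fun_mem _ _ fun k _ => (OO F n).mul_mem (const_mem _) (en'_mem _ _)

lemma comp_inv : ∀ f ∈ OO F n, f ∘ (fun g => g⁻¹) ∈ OO F n := by
  refine comp_mem ?_ ?_ <;> intro i j
  · exact en'_mem i j
  · have : (en' i j ∘ fun g : GL (Fin n) F => g⁻¹) = en i j := by
      funext g; simp [en, en']
    rw [this]; exact en_mem _ _

lemma cont_left (a : GL (Fin n) F) : Continuous fun g : GL (Fin n) F => a * g := continuous_of (comp_left a)
lemma cont_right (a : GL (Fin n) F) : Continuous fun g : GL (Fin n) F => g * a := continuous_of (comp_right a)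
lemma cont_inv : Continuous fun g : GL (Fin n) F => g⁻¹ := continuous_of comp_inv
lemma cont_conj (a : GL (Fin n) F) : Continuous fun g : GL (Fin n) F => a * g * a⁻¹ :=
  (cont_right a⁻¹).comp (cont_left a)

lemma pow_conn {C : Subgroup (GL (Fin n) F)} : ∀ c : C, ∃ k : ℕ, 0 < k ∧ (c ^ k) ∈ connectedComponent (1 : C) := by
  intro c
  have hfin : (irreducibleComponents C).Finite := TopologicalSpace.NoetherianSpace.finite_irreducibleComponents
  have : ¬ Function.Injective (fun i : ℕ => irreducibleComponent (c ^ i)) := by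
    intro hinj
    exact Set.infinite_range_of_injective hinj (hfin.subset (by
      rintro _ ⟨i, rfl⟩; exact irreducibleComponent_mem_irreducibleComponents _))
  simp only [Function.Injective, not_forall] at this
  have hmain : ∀ i j : ℕ, i < j → irreducibleComponent (c ^ i) = irreducibleComponent (c ^ j) →
      ∃ k : ℕ, 0 < k ∧ (c ^ k) ∈ connectedComponent (1 : C) := by
    intro i j hlt hij
    refine ⟨j - i, by omega, ?_⟩
    have hc : Continuous (fun g : C => c⁻¹ ^ i * g) := by
      rw [Topology.IsInducing.subtypeVal.continuous_iff]
      exact (cont_left ((c⁻¹ ^ i : C) : GL (Fin n) F)).comp continuous_subtype_val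
    have h1 : c ^ j ∈ connectedComponent (c ^ i) :=
      irreducibleComponent_subset_connectedComponent (by rw [hij]; exact mem_irreducibleComponent)
    have h2 := hc.image_connectedComponent_subset (c ^ i) ⟨_, h1, rfl⟩
    have e1 : c⁻¹ ^ i * c ^ i = 1 := by rw [inv_pow, inv_mul_cancel]
    have e2 : c⁻¹ ^ i * c ^ j = c ^ (j - i) := by
      rw [inv_pow, inv_mul_eq_iff_eq_mul, ← pow_add]; congr 1; omega
    simp only [e1, e2] at h2
    exact h2
  obtain ⟨i, j, hij, hne⟩ := this
  rcases lt_or_gt_of_ne hne with h | h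
  · exact hmain i j h hij
  · exact hmain j i h hij.symm

/-- Identity component of a closed subgroup. -/
lemma lemmaL (C : Subgroup (GL (Fin n) F)) (hC : IsClosed (C : Set (GL (Fin n) F))) :
    ∃ C0 : Subgroup (GL (Fin n) F), C0 ≤ C ∧ IsClosed (C0 : Set (GL (Fin n) F)) ∧
      IsPreconnected (C0 : Set (GL (Fin n) F)) ∧
      (∀ T : Subgroup (GL (Fin n) F), T ≤ C → IsPreconnected (T : Set (GL (Fin n) F)) → T ≤ C0) ∧
      ∀ c ∈ C, ∃ k : ℕ, 0 < k ∧ c ^ k ∈ C0 := by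
  let X : Subgroup C :=
    { carrier := connectedComponent 1
      one_mem' := mem_connectedComponent
      mul_mem' := by
        intro a b ha hb
        have hc : Continuous (fun g : C => a * g) := by
          rw [Topology.IsInducing.subtypeVal.continuous_iff]
          exact (cont_left (a : GL (Fin n) F)).comp continuous_subtype_val
        have h2 := hc.image_connectedComponent_subset 1 ⟨_, hb, rfl⟩
        simp only [mul_one] at h2
        rwa [connectedComponent_eq ha]
      inv_mem' := by
        intro a ha
        have hc : Continuous (fun g : C => g⁻¹) := by
          rw [Topology.IsInducing.subtypeVal.continuous_iff]
          exact cont_inv.comp continuous_subtype_val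
        have h2 := hc.image_connectedComponent_subset 1 ⟨_, ha, rfl⟩
        simpa using h2 }
  have hX : ((X.map C.subtype : Subgroup _) : Set (GL (Fin n) F)) = Subtype.val '' (connectedComponent (1 : C)) := rfl
  refine ⟨X.map C.subtype, ?_, ?_, ?_, ?_, ?_⟩
  · rintro _ ⟨x, _, rfl⟩; exact x.2
  · rw [hX]
    exact hC.isClosedEmbedding_subtypeVal.isClosedMap _ isClosed_connectedComponent
  · rw [hX]
    exact isPreconnected_connectedComponent.image _ continuous_subtype_val.continuousOn
  · intro T hT hTc t ht
    have h1 : IsPreconnected (Subtype.val ⁻¹' (T : Set (GL (Fin n) F)) : Set C) := by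
      rw [← Topology.IsInducing.subtypeVal.isPreconnected_image]
      have e : (Subtype.val '' (Subtype.val ⁻¹' (T : Set (GL (Fin n) F)) : Set C)) = (T : Set (GL (Fin n) F)) := by
        ext x; constructor
        · rintro ⟨y, hy, rfl⟩; exact hy
        · intro hx; exact ⟨⟨x, hT hx⟩, hx, rfl⟩
      exact (congrArg IsPreconnected e).mpr hTc
    have h2 := h1.subset_connectedComponent (x := (1 : C)) T.one_mem
    exact ⟨⟨t, hT ht⟩, h2 (by exact ht), rfl⟩
  · intro c hc
    obtain ⟨k, hk, h⟩ := pow_conn ⟨c, hc⟩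
    exact ⟨k, hk, ⟨_, h, rfl⟩⟩

end zar
end RG

variable {F : Type} [Field F]
namespace RG
open Module
section zar
variable {n : ℕ} (H : Subgroup (GL (Fin n) F))

def resH : (GL (Fin n) F → F) →ₐ[F] (H → F) where
  toFun f h := f h
  map_one' := rfl
  map_mul' _ _ := rfl
  map_zero' := rfl
  map_add' _ _ := rfl
  commutes' _ := rfl

/-- The coordinate ring of `H`. -/
def cr : Subalgebra F (H → F) := (OO F n).map (resH H)

variable {H}

lemma mem_cr {f : H → F} : f ∈ cr H ↔ ∃ f' ∈ OO F n, ∀ h : H, f' h = f h := by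
  constructor
  · rintro ⟨f', hf', rfl⟩; exact ⟨f', hf', fun h => rfl⟩
  · rintro ⟨f', hf', h⟩; exact ⟨f', hf', funext h⟩

lemma cr_eq : cr H = Algebra.adjoin F (resH H '' gens F n) := by
  rw [cr, OO, AlgHom.map_adjoin]

def enH (i j : Fin n) : cr H := ⟨fun h => en i j h, mem_cr.2 ⟨_, en_mem i j, fun _ => rfl⟩⟩
def enH' (i j : Fin n) : cr H := ⟨fun h => en' i j h, mem_cr.2 ⟨_, en'_mem i j, fun _ => rfl⟩⟩

/-- induction principle for `cr H`. -/
lemma cr_ind {S : Subalgebra F (cr H)} (h : ∀ i j, enH i j ∈ S) (h' : ∀ i j, enH' i j ∈ S) (f : cr H) : f ∈ S := by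
  have key : cr H ≤ S.map (cr H).val := by
    refine cr_eq.le.trans (Algebra.adjoin_le_iff.2 ?_)
    rintro _ ⟨f, hf, rfl⟩
    rcases hf with ⟨q, rfl⟩ | ⟨q, rfl⟩
    · exact ⟨_, h q.1 q.2, rfl⟩
    · exact ⟨_, h' q.1 q.2, rfl⟩
  obtain ⟨g, hg, e⟩ := key f.2
  have : g = f := Subtype.ext e
  rwa [← this]

lemma closedH_zero {f : H → F} (hf : f ∈ cr H) : IsClosed {h : H | f h = 0} := by
  obtain ⟨f', hf', h⟩ := mem_cr.1 hf
  have := (closed_zero hf').preimage (continuous_subtype_val : Continuous (Subtype.val : H → _))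
  simpa [Set.preimage, h] using this

lemma cr_comul (f : cr H) : ∃ (k : ℕ) (a b : Fin k → cr H), ∀ g h, f.1 (g * h) = ∑ i, (a i).1 g * (b i).1 h := by
  let p1 : cr H →ₐ[F] (H × H → F) :=
    { toFun := fun f x => f.1 x.1, map_one' := rfl, map_mul' := fun _ _ => rfl, map_zero' := rfl,
      map_add' := fun _ _ => rfl, commutes' := fun _ => rfl }
  let p2 : cr H →ₐ[F] (H × H → F) :=
    { toFun := fun f x => f.1 x.2, map_one' := rfl, map_mul' := fun _ _ => rfl, map_zero' := rfl,
      map_add' := fun _ _ => rfl, commutes' := fun _ => rfl }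
  let m : cr H →ₐ[F] (H × H → F) :=
    { toFun := fun f x => f.1 (x.1 * x.2), map_one' := rfl, map_mul' := fun _ _ => rfl, map_zero' := rfl,
      map_add' := fun _ _ => rfl, commutes' := fun _ => rfl }
  let P := Algebra.TensorProduct.productMap p1 p2
  have hP : ∀ a b, P (TensorProduct.tmul F a b) = p1 a * p2 b := fun a b => Algebra.TensorProduct.productMap_apply_tmul _ _ _ _
  have key : f ∈ P.range.comap m := by
    refine cr_ind ?_ ?_ f <;> intro i j
    · refine ⟨∑ k, TensorProduct.tmul F (enH i k) (enH k j), ?_⟩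
      change P _ = _
      rw [map_sum]; simp only [hP]
      funext x
      rw [Finset.sum_apply]
      exact (Matrix.mul_apply (M := ((x.1 : GL (Fin n) F) : Matrix (Fin n) (Fin n) F))
        (N := ((x.2 : GL (Fin n) F) : Matrix (Fin n) (Fin n) F)) (i := i) (k := j)).symm
    · refine ⟨∑ k, TensorProduct.tmul F (enH' k j) (enH' i k), ?_⟩
      change P _ = _
      rw [map_sum]; simp only [hP]
      funext x
      rw [Finset.sum_apply]
      change _ = (((x.1 : GL (Fin n) F) * (x.2 : GL (Fin n) F))⁻¹ : GL (Fin n) F) i j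
      rw [mul_inv_rev, Units.val_mul, Matrix.mul_apply]
      exact Finset.sum_congr rfl fun k _ => mul_comm _ _
  obtain ⟨x, hx⟩ := key
  obtain ⟨S, rfl⟩ := TensorProduct.exists_finset x
  refine ⟨S.card, fun i => (S.equivFin.symm i).1.1, fun i => (S.equivFin.symm i).1.2, fun g h => ?_⟩
  have h1 := congrFun hx (g, h)
  change P _ (g, h) = f.1 (g * h) at h1
  rw [← h1, map_sum]; simp only [hP]
  rw [Finset.sum_apply, ← Finset.sum_coe_sort]
  rw [← S.equivFin.symm.sum_comp]
  rfl

lemma cr_inv (f : cr H) : (fun g => f.1 g⁻¹) ∈ cr H := by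
  obtain ⟨f', hf', h⟩ := mem_cr.1 f.2
  exact mem_cr.2 ⟨_, comp_inv f' hf', fun g => by rw [← h]; rfl⟩

lemma cr_fg : (cr H).FG := by
  rw [cr_eq]
  refine Subalgebra.fg_def.2 ⟨_, ?_, rfl⟩
  refine Set.Finite.image _ ?_
  exact (Set.finite_range _).union (Set.finite_range _)

lemma cr_points (hcl : IsClosed (H : Set (GL (Fin n) F))) (θ : cr H →ₐ[F] F) : ∃ γ, ∀ f : cr H, θ f = f.1 γ := by
  let A : Matrix (Fin n) (Fin n) F := Matrix.of fun i j => θ (enH i j)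
  let B : Matrix (Fin n) (Fin n) F := Matrix.of fun i j => θ (enH' i j)
  have hd : ∀ i j, (∑ k, enH i k * enH' k j : cr H) = if i = j then 1 else 0 := by
    intro i j
    refine R_ext fun γ => ?_
    have h1 := congrArg (fun u : GL (Fin n) F => (u : Matrix (Fin n) (Fin n) F) i j) (mul_inv_cancel (γ : GL (Fin n) F))
    beta_reduce at h1
    rw [Units.val_mul, Matrix.mul_apply, Units.val_one, Matrix.one_apply] at h1
    have : (∑ k, enH i k * enH' k j : cr H).1 γ = ∑ k, en i k γ * en' k j γ := by
      simp [enH, enH']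
    rw [this]
    refine Eq.trans h1 ?_
    split_ifs <;> rfl
  have hAB : A * B = 1 := by
    ext i j
    rw [Matrix.mul_apply, Matrix.one_apply]
    have := congrArg θ (hd i j)
    simp only [map_sum, map_mul] at this
    simp only [A, B, Matrix.of_apply, this]
    split_ifs <;> simp
  let g : GL (Fin n) F := ⟨A, B, hAB, mul_eq_one_comm.1 hAB⟩
  have hgen : ∀ f ∈ OO F n, ∀ hf : (fun h : H => f h) ∈ cr H, θ ⟨_, hf⟩ = f g := by
    intro f hf
    induction hf using Algebra.adjoin_induction with
    | mem f hf =>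
      rcases hf with ⟨q, rfl⟩ | ⟨q, rfl⟩
      · intro _; rfl
      · intro _; rfl
    | algebraMap r => intro h; exact θ.commutes r
    | add f f' hf hf' h h' =>
      intro _
      have e1 := h (mem_cr.2 ⟨f, hf, fun _ => rfl⟩)
      have e2 := h' (mem_cr.2 ⟨f', hf', fun _ => rfl⟩)
      rw [Pi.add_apply, ← e1, ← e2, ← map_add]; rfl
    | mul f f' hf hf' h h' =>
      intro _
      have e1 := h (mem_cr.2 ⟨f, hf, fun _ => rfl⟩)
      have e2 := h' (mem_cr.2 ⟨f', hf', fun _ => rfl⟩)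
      rw [Pi.mul_apply, ← e1, ← e2, ← map_mul]; rfl
  have hgH : g ∈ H := by
    by_contra hg
    obtain ⟨f, hf, h0, h1⟩ := closed_exists hcl hg
    apply h1
    rw [← hgen f hf (mem_cr.2 ⟨f, hf, fun _ => rfl⟩)]
    have : (⟨fun h : H => f h, mem_cr.2 ⟨f, hf, fun _ => rfl⟩⟩ : cr H) = 0 := R_ext fun γ => h0 _ γ.2
    rw [this, map_zero]
  refine ⟨⟨g, hgH⟩, fun f => ?_⟩
  obtain ⟨f', hf', h⟩ := mem_cr.1 f.2
  have h1 := hgen f' hf' (mem_cr.2 ⟨f', hf', fun _ => rfl⟩)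
  have : (⟨fun h : H => f' h, mem_cr.2 ⟨f', hf', fun _ => rfl⟩⟩ : cr H) = f := R_ext h
  rw [this] at h1
  rw [h1, ← h]

def leftHomeo (a : H) : H ≃ₜ H where
  toFun h := a * h
  invFun h := a⁻¹ * h
  left_inv h := by simp
  right_inv h := by simp
  continuous_toFun := by
    rw [Topology.IsInducing.subtypeVal.continuous_iff]
    exact (cont_left (a : GL (Fin n) F)).comp continuous_subtype_val
  continuous_invFun := by
    rw [Topology.IsInducing.subtypeVal.continuous_iff]
    exact (cont_left ((a⁻¹ : H) : GL (Fin n) F)).comp continuous_subtype_val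

lemma comp_img {Z : Set H} (hZ : Z ∈ irreducibleComponents H) (a : H) : leftHomeo a '' Z ∈ irreducibleComponents H := by
  refine ⟨hZ.1.image _ (leftHomeo a).continuous.continuousOn, ?_⟩
  intro W hW hle
  have h1 : IsIrreducible ((leftHomeo a).symm '' W) := hW.image _ (leftHomeo a).symm.continuous.continuousOn
  have h2 : Z ≤ (leftHomeo a).symm '' W := by
    intro z hz; exact ⟨_, hle ⟨z, hz, rfl⟩, by simp⟩
  have h3 := hZ.2 h1 h2
  intro w hw
  exact ⟨_, h3 ⟨w, hw, rfl⟩, by simp⟩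

lemma irred_of_conn (hconn : IsPreconnected (H : Set (GL (Fin n) F))) : IsPreirreducible (Set.univ : Set H) := by
  haveI : PreconnectedSpace H := isPreconnected_iff_preconnectedSpace.1 hconn
  have hfin : (irreducibleComponents H).Finite := TopologicalSpace.NoetherianSpace.finite_irreducibleComponents
  let Z : Set H := irreducibleComponent 1
  have hZ : Z ∈ irreducibleComponents H := irreducibleComponent_mem_irreducibleComponents _
  -- a point only in Z
  obtain ⟨x0, hx0, hx0'⟩ : ∃ x0 ∈ Z, ∀ W ∈ irreducibleComponents H, x0 ∈ W → W = Z := by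
    by_contra hcon
    push Not at hcon
    have hf2 : ({W | W ∈ irreducibleComponents H ∧ W ≠ Z} : Set (Set H)).Finite := hfin.subset fun W h => h.1
    obtain ⟨W, hW, hZW⟩ := isIrreducible_iff_sUnion_isClosed.1 hZ.1 hf2.toFinset
      (by intro W hW; exact isClosed_of_mem_irreducibleComponents _ (hf2.mem_toFinset.1 hW).1)
      (by
        intro x hx
        obtain ⟨W, hW, hxW, hne⟩ := hcon x hx
        exact ⟨W, by simpa using ⟨hW, hne⟩, hxW⟩)
    have hW' := hf2.mem_toFinset.1 hW
    exact hW'.2 (le_antisymm (hZ.2 hW'.1.1 hZW) hZW)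
  have huniq : ∀ x : H, ∀ W ∈ irreducibleComponents H, ∀ W' ∈ irreducibleComponents H, x ∈ W → x ∈ W' → W = W' := by
    intro x W hW W' hW' hx hx'
    have e : ∀ W ∈ irreducibleComponents H, x ∈ W → leftHomeo (x0 * x⁻¹) '' W = Z := by
      intro W hW hx
      exact hx0' _ (comp_img hW _) ⟨x, hx, by simp [leftHomeo]⟩
    exact (leftHomeo (x0 * x⁻¹)).injective.image_injective ((e W hW hx).trans (e W' hW' hx').symm)
  have hop : IsClosed Zᶜ := by
    have : Zᶜ = ⋃₀ {W | W ∈ irreducibleComponents H ∧ W ≠ Z} := by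
      ext x
      constructor
      · intro hx
        exact ⟨irreducibleComponent x, ⟨irreducibleComponent_mem_irreducibleComponents _, fun h => hx (h ▸ mem_irreducibleComponent)⟩, mem_irreducibleComponent⟩
      · rintro ⟨W, ⟨hW, hne⟩, hxW⟩ hxZ
        exact hne (huniq x W hW Z hZ hxW hxZ)
    rw [this, Set.sUnion_eq_biUnion]
    exact Set.Finite.isClosed_biUnion (hfin.subset fun W h => h.1) fun W hW => isClosed_of_mem_irreducibleComponents _ hW.1
  have hclopen : IsClopen Z := ⟨isClosed_irreducibleComponent, by rwa [← isClosed_compl_iff]⟩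
  rcases isClopen_iff.1 hclopen with h | h
  · exact absurd (h ▸ mem_irreducibleComponent : (1 : H) ∈ (∅ : Set H)) (Set.notMem_empty _)
  · rw [← h]; exact hZ.1.2

lemma good_cr (hcl : IsClosed (H : Set (GL (Fin n) F))) (hconn : IsPreconnected (H : Set (GL (Fin n) F))) : Good (cr H) where
  comul := cr_comul
  inv := cr_inv
  fg := cr_fg
  points := cr_points hcl
  dom := by
    intro f g hfg
    have := isPreirreducible_iff_isClosed_union_isClosed.1 (irred_of_conn hconn) _ _ (closedH_zero f.2) (closedH_zero g.2)
      (by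
        intro x _
        have := congrArg (fun q : cr H => q.1 x) hfg
        exact mul_eq_zero.1 this)
    rcases this with h | h
    · left; exact R_ext fun x => h (Set.mem_univ x)
    · right; exact R_ext fun x => h (Set.mem_univ x)

end zar
end RG

namespace RG
open Module Polynomial
section reps
variable {F : Type} [Field F] {n m : ℕ} {H : Subgroup (GL (Fin n) F)}

/-- Representation attached to a matrix representation. -/
def repOf (ρ : H →* GL (Fin m) F) : Representation F H (Fin m → F) where
  toFun h := ((ρ h : GL (Fin m) F) : Matrix (Fin m) (Fin m) F).mulVecLin
  map_one' := by ext v; simp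
  map_mul' a b := by
    ext v; simp

lemma repOf_apply (ρ : H →* GL (Fin m) F) (h : H) (v : Fin m → F) :
    repOf ρ h v = ((ρ h : GL (Fin m) F) : Matrix (Fin m) (Fin m) F).mulVec v := rfl

lemma rat_repOf (ρ : H →* GL (Fin m) F)
    (h : ∀ i j, (fun h => ((ρ h : GL (Fin m) F) : Matrix (Fin m) (Fin m) F) i j) ∈ cr H) : Rat (cr H) (repOf ρ) := by
  intro ξ v
  have : (fun γ => ξ (repOf ρ γ v)) =
      ∑ i, ∑ j, (ξ (Pi.single i 1) * v j) • (fun h => ((ρ h : GL (Fin m) F) : Matrix (Fin m) (Fin m) F) i j) := by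
    funext γ
    rw [repOf_apply]
    have hsing : ∀ i : Fin m, (fun j => if i = j then (1 : F) else 0) = Pi.single i 1 := by
      intro i; funext j; simp [Pi.single_apply, eq_comm]
    conv_lhs => rw [LinearMap.pi_apply_eq_sum_univ ξ]
    simp only [Finset.sum_apply, Pi.smul_apply, Matrix.mulVec, dotProduct, smul_eq_mul, Finset.sum_mul]
    refine Finset.sum_congr rfl fun i _ => Finset.sum_congr rfl fun j _ => ?_
    rw [← hsing i]
    ring
  rw [this]
  exact (cr H).sum_mem fun i _ => (cr H).sum_mem fun j _ => (cr H).smul_mem (h i j) _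

variable (H) in
/-- the standard representation -/
def std : Representation F H (Fin n → F) := repOf H.subtype

variable (H) in
lemma rat_std : Rat (cr H) (std H) := rat_repOf _ fun i j => (enH i j).2

lemma coef_std (i j : Fin n) : coef (rat_std H) (LinearMap.proj i) (Pi.single j 1) = enH i j := by
  refine R_ext fun γ => ?_
  simp [std, repOf_apply, enH, en]

lemma hd (i j : Fin n) : (∑ k, enH i k * enH' k j : cr H) = if i = j then 1 else 0 := by
  refine R_ext fun γ => ?_
  have h1 := congrArg (fun u : GL (Fin n) F => (u : Matrix (Fin n) (Fin n) F) i j) (mul_inv_cancel (γ : GL (Fin n) F))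
  beta_reduce at h1
  rw [Units.val_mul, Matrix.mul_apply, Units.val_one, Matrix.one_apply] at h1
  have : (∑ k, enH i k * enH' k j : cr H).1 γ = ∑ k, en i k γ * en' k j γ := by
    simp [enH, enH']
  rw [this]
  refine Eq.trans h1 ?_
  split_ifs <;> rfl

lemma hd' (i j : Fin n) : (∑ k, enH' i k * enH k j : cr H) = if i = j then 1 else 0 := by
  refine R_ext fun γ => ?_
  have h1 := congrArg (fun u : GL (Fin n) F => (u : Matrix (Fin n) (Fin n) F) i j) (inv_mul_cancel (γ : GL (Fin n) F))
  beta_reduce at h1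
  rw [Units.val_mul, Matrix.mul_apply, Units.val_one, Matrix.one_apply] at h1
  have : (∑ k, enH' i k * enH k j : cr H).1 γ = ∑ k, en' i k γ * en k j γ := by
    simp [enH, enH']
  rw [this]
  refine Eq.trans h1 ?_
  split_ifs <;> rfl

lemma der_eq_zero (D : Derivation F (cr H) (cr H)) (h : ∀ i j, D (enH i j) = 0) (f : cr H) : D f = 0 := by
  have h' : ∀ l j, D (enH' l j) = 0 := by
    intro l j
    have e1 : ∀ i, ∑ k, enH i k * D (enH' k j) = 0 := by
      intro i
      have := congrArg D (hd (H := H) i j)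
      rw [map_sum] at this
      simp only [Derivation.leibniz, h, smul_eq_mul, mul_zero, add_zero] at this
      rw [this]; split_ifs <;> simp
    have e2 : ∑ i, enH' l i * ∑ k, enH i k * D (enH' k j) = 0 := by simp [e1]
    simp only [Finset.mul_sum] at e2
    rw [Finset.sum_comm] at e2
    simp only [← mul_assoc, ← Finset.sum_mul, hd'] at e2
    simpa using e2
  let S : Subalgebra F (cr H) :=
    { carrier := {f | D f = 0}
      mul_mem' := by intro a b ha hb; simp only [Set.mem_setOf_eq] at *; simp [ha, hb]
      add_mem' := by intro a b ha hb; simp only [Set.mem_setOf_eq] at *; simp [ha, hb]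
      algebraMap_mem' := fun r => D.map_algebraMap r }
  exact cr_ind (S := S) h h' f

lemma faith_std : Function.Injective (dg (rat_std H)) := by
  rw [injective_iff_map_eq_zero]
  intro D hD
  refine Lg_ext fun f => ?_
  rw [der_zero]
  refine der_eq_zero (der D) (fun i j => ?_) f
  rw [← coef_std, ← coef_dg, hD]
  exact R_ext fun γ => by simp

/-- Restricting algebraic representations. -/
lemma rat_alg {G : Subgroup (GL (Fin n) F)} (hle : H ≤ G) (ρ : G →* GL (Fin m) F) (h : IsAlgebraicRep G ρ) :
    Rat (cr H) (repOf (ρ.comp (Subgroup.inclusion hle))) := by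
  refine rat_repOf _ fun i j => ?_
  obtain ⟨p, hp⟩ := h i j
  let φ : MvPolynomial ((Fin n × Fin n) ⊕ (Fin n × Fin n)) F →ₐ[F] cr H :=
    MvPolynomial.aeval (Sum.elim (fun q => enH q.1 q.2) (fun q => enH' q.1 q.2))
  have : (fun h => (((ρ.comp (Subgroup.inclusion hle)) h : GL (Fin m) F) : Matrix (Fin m) (Fin m) F) i j) = (φ p).1 := by
    funext x
    refine (hp (Subgroup.inclusion hle x)).trans ?_
    let ev : cr H →ₐ[F] F :=
      { toFun := fun f => f.1 x, map_one' := rfl, map_mul' := fun _ _ => rfl, map_zero' := rfl,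
        map_add' := fun _ _ => rfl, commutes' := fun _ => rfl }
    change _ = ev (φ p)
    have e : ev.comp φ = MvPolynomial.aeval (fun s => ev (Sum.elim (fun q => enH q.1 q.2) (fun q => enH' q.1 q.2) s)) := by
      ext s; simp [φ]
    have e2 := congrArg (fun ψ => ψ p) e
    simp only [AlgHom.comp_apply] at e2
    rw [e2, MvPolynomial.aeval_eq_eval]
    congr 2
    funext s
    rcases s with q | q
    · rfl
    · change (((x : GL (Fin n) F) : Matrix (Fin n) (Fin n) F)⁻¹) q.1 q.2 = (((x : GL (Fin n) F)⁻¹ : GL (Fin n) F) : Matrix (Fin n) (Fin n) F) q.1 q.2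
      rw [Matrix.coe_units_inv]
  rw [this]; exact (φ p).2

/-! ### curves -/

lemma curve_closed [Infinite F] (c : F → GL (Fin n) F) (P : Fin n → Fin n → F[X])
    (hc : ∀ s i j, (c s : Matrix (Fin n) (Fin n) F) i j = (P i j).eval s) {S : Set (GL (Fin n) F)} (hS : IsClosed S)
    (hinf : (c ⁻¹' S).Infinite) (s : F) : c s ∈ S := by
  rw [← zclosed_iff] at hS
  obtain ⟨I, rfl⟩ := hS
  intro p hp
  let q : F[X] := MvPolynomial.aeval (fun x : Fin n × Fin n => P x.1 x.2) p
  have hq : ∀ s, q.eval s = MvPolynomial.eval (fun x => (c s : Matrix (Fin n) (Fin n) F) x.1 x.2) p := by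
    intro s
    have e : (Polynomial.aeval s).comp (MvPolynomial.aeval (R := F) (fun x : Fin n × Fin n => P x.1 x.2)) =
        MvPolynomial.aeval (fun x => (c s : Matrix (Fin n) (Fin n) F) x.1 x.2) := by
      ext x; simp [hc]
    have e2 := congrArg (fun ψ => ψ p) e
    simp only [AlgHom.comp_apply] at e2
    rw [MvPolynomial.aeval_eq_eval] at e2
    simpa [q] using e2
  have : q = 0 := Polynomial.eq_zero_of_infinite_isRoot q (hinf.mono fun s hs => by
    change q.eval s = 0
    rw [hq]; exact hs p hp)
  change MvPolynomial.eval (fun x => (c s : Matrix (Fin n) (Fin n) F) x.1 x.2) p = 0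
  rw [← hq, this]; simp

lemma curve_conn [Infinite F] (c : F → GL (Fin n) F) (P : Fin n → Fin n → F[X])
    (hc : ∀ s i j, (c s : Matrix (Fin n) (Fin n) F) i j = (P i j).eval s) : IsPreconnected (Set.range c) := by
  rw [isPreconnected_closed_iff]
  intro t t' ht ht' hcov h1 h2
  have hu : (c ⁻¹' t ∪ c ⁻¹' t').Infinite := by
    have : c ⁻¹' t ∪ c ⁻¹' t' = Set.univ := by
      ext s; simpa using hcov ⟨s, rfl⟩
    rw [this]; exact Set.infinite_univ
  rw [Set.infinite_union] at hu
  rcases hu with h | h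
  · obtain ⟨_, ⟨s, rfl⟩, hs⟩ := h2
    exact ⟨_, ⟨s, rfl⟩, curve_closed c P hc ht h s, hs⟩
  · obtain ⟨_, ⟨s, rfl⟩, hs⟩ := h1
    exact ⟨_, ⟨s, rfl⟩, hs, curve_closed c P hc ht' h s⟩

lemma unip_curve [CharZero F] (u : GL (Fin n) F) (hu : ((u : Matrix (Fin n) (Fin n) F) - 1) ^ n = 0) :
    ∃ (c : F → GL (Fin n) F) (P : Fin n → Fin n → F[X]),
      (∀ s i j, (c s : Matrix (Fin n) (Fin n) F) i j = (P i j).eval s) ∧ ∀ k : ℕ, c k = u ^ k := by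
  let N := (u : Matrix (Fin n) (Fin n) F) - 1
  let M : F → Matrix (Fin n) (Fin n) F := fun s => ∑ k ∈ Finset.range n, ((k.factorial : F)⁻¹ * (descPochhammer F k).eval s) • N ^ k
  have hM : ∀ k : ℕ, M k = u ^ k := by
    intro k
    have : (u : Matrix (Fin n) (Fin n) F) = N + 1 := by simp [N]
    have e : ∀ j : ℕ, (j.factorial : F)⁻¹ * (descPochhammer F j).eval (k : F) = (k.choose j : F) := by
      intro j
      rw [descPochhammer_eval_eq_descFactorial, Nat.descFactorial_eq_factorial_mul_choose]
      push_cast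
      rw [inv_mul_cancel_left₀]
      exact_mod_cast Nat.factorial_ne_zero j
    simp only [M, e]
    rw [this, (Commute.one_right N).add_pow]
    have big : ∀ j, n ≤ j → N ^ j = 0 := fun j hj => pow_eq_zero_of_le hj hu
    have h1 : ∑ x ∈ Finset.range n, (k.choose x : F) • N ^ x = ∑ x ∈ Finset.range (max n (k + 1)), (k.choose x : F) • N ^ x :=
      Finset.sum_subset (Finset.range_subset_range.2 (le_max_left n (k + 1))) (by
        intro j _ hj
        rw [big j (by simpa using hj), smul_zero])
    have h2 : ∑ x ∈ Finset.range (k + 1), (k.choose x : F) • N ^ x = ∑ x ∈ Finset.range (max n (k + 1)), (k.choose x : F) • N ^ x :=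
      Finset.sum_subset (Finset.range_subset_range.2 (le_max_right n (k + 1))) (by
        intro j _ hj
        rw [Nat.choose_eq_zero_of_lt (by simpa using hj)]; simp)
    rw [h1, ← h2]
    refine Finset.sum_congr rfl fun j _ => ?_
    rw [one_pow, mul_one, ← nsmul_eq_mul', Nat.cast_smul_eq_nsmul]
  have hunit : ∀ s, IsUnit (M s) := by
    intro s
    rcases Nat.eq_zero_or_pos n with h0 | hpos
    · subst h0; exact isUnit_of_subsingleton _
    let q : F[X] := ∑ k ∈ Finset.range n, Polynomial.C ((k.factorial : F)⁻¹ * (descPochhammer F k).eval s) * X ^ k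
    have hq : Polynomial.aeval N q = M s := by
      simp only [q, M, map_sum, map_mul, map_pow, Polynomial.aeval_C, Polynomial.aeval_X]
      refine Finset.sum_congr rfl fun j _ => ?_
      rw [Algebra.smul_def, map_mul]
    have hq0 : q.coeff 0 = 1 := by
      simp only [q, Polynomial.finset_sum_coeff, Polynomial.coeff_C_mul, Polynomial.coeff_X_pow]
      rw [Finset.sum_eq_single 0]
      · simp
      · intro j _ hj; simp [hj.symm]
      · intro h; exact absurd (Finset.mem_range.2 hpos) h
    rw [← hq, ← Polynomial.divX_mul_X_add q, hq0]
    simp only [map_add, map_mul, Polynomial.aeval_X, map_one]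
    have hc : Commute (Polynomial.aeval N q.divX) N := by
      have := Polynomial.aeval_X (R := F) N
      rw [commute_iff_eq]
      nth_rewrite 2 [← this]
      nth_rewrite 3 [← this]
      rw [← map_mul, ← map_mul, mul_comm]
    have hn : IsNilpotent (Polynomial.aeval N q.divX * N) := hc.isNilpotent_mul_left ⟨n, hu⟩
    exact hn.isUnit_add_one
  refine ⟨fun s => (hunit s).unit, fun i j => ∑ k ∈ Finset.range n,
    Polynomial.C ((k.factorial : F)⁻¹ * (N ^ k) i j) * descPochhammer F k, ?_, ?_⟩
  · intro s i j
    change M s i j = _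
    simp only [M, Matrix.sum_apply, Matrix.smul_apply, smul_eq_mul, Polynomial.eval_finset_sum, Polynomial.eval_mul,
      Polynomial.eval_C]
    refine Finset.sum_congr rfl fun k _ => by ring
  · intro k
    refine Units.ext ?_
    rw [IsUnit.unit_spec, hM]
    rfl
end reps
end RG

namespace RG
open Module Polynomial
section reps
variable {F : Type} [Field F] {Γ : Type} [Group Γ] {R : Subalgebra F (Γ → F)}
variable {W : Type} [AddCommGroup W] [Module F W] [FiniteDimensional F W]
variable {ρ₀ : Representation F Γ W} {h₀ : Rat R ρ₀}

open Finset Nat in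
lemma leibniz_iter (D : Derivation F R R) (n : ℕ) (a b : R) :
    D^[n] (a * b) = ∑ ij ∈ antidiagonal n, choose n ij.1 • (D^[ij.1] a * D^[ij.2] b) := by
  induction n with
  | zero => simp
  | succ n ih =>
    rw [sum_antidiagonal_choose_succ_nsmul (M := R) (fun i j => D^[i] a * D^[j] b) n]
    simp only [Function.iterate_succ_apply', ih, map_sum, map_nsmul, Derivation.leibniz, smul_eq_mul, nsmul_add, sum_add_distrib]
    congr 1
    refine sum_congr rfl fun ij hij => ?_
    rw [n.choose_symm_of_eq_add (mem_antidiagonal.1 hij).symm, mul_comm]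

lemma loc_nilp [IsAlgClosed F] [CharZero F] [Good R] (hf : Function.Injective (dg h₀)) (D : Lg R) (hD : IsNilpotent (dg h₀ D)) (f : R) :
    ∃ k : ℕ, (der D)^[k] f = 0 := by
  have hE : ph D (AddMonoidHom.id F) = 0 := by
    apply hf
    rw [map_zero]
    ext v
    obtain ⟨k, hk⟩ := hD
    exact ph_kill h₀ D _ v k (by rw [hk]; rfl)
  have key : (⊤ : Submodule F R) ≤ End.maxGenEigenspace (der D : R →ₗ[F] R) 0 := by
    rw [← iSup_genEig_R (der_linv D : LInv (der D : R →ₗ[F] R))]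
    refine iSup_le fun μ f hf => ?_
    have h1 := der_ph D (AddMonoidHom.id F) μ f hf
    rw [hE, der_zero] at h1
    rcases smul_eq_zero.1 h1.symm with h | h
    · have : μ = 0 := h
      rwa [← this]
    · rw [h]; exact Submodule.zero_mem _
  have h2 := key (Submodule.mem_top : f ∈ ⊤)
  rw [End.mem_maxGenEigenspace] at h2
  obtain ⟨k, hk⟩ := h2
  refine ⟨k, ?_⟩
  have e : ((der D : R →ₗ[F] R) - (0 : F) • (1 : End F R)) = (der D : R →ₗ[F] R) := by
    refine LinearMap.ext fun x => ?_
    simp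
  have hk' : ((der D : R →ₗ[F] R) ^ k) f = 0 := by
    rw [← e]; exact hk
  rw [Module.End.pow_apply] at hk'
  exact hk'

lemma exp_point [CharZero F] [hR : Good R] (D : Lg R) (hD : ∀ f, ∃ k : ℕ, (der D)^[k] f = 0) :
    ∃ γ : Γ, ∀ (f : R) (k : ℕ), (der D)^[k] f = 0 →
      f.1 γ = ∑ j ∈ Finset.range k, (j.factorial : F)⁻¹ * ((der D)^[j] f).1 1 := by
  let ε : R →ₐ[F] F :=
    { toFun := fun f => f.1 1, map_one' := rfl, map_mul' := fun _ _ => rfl, map_zero' := rfl,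
      map_add' := fun _ _ => rfl, commutes' := fun _ => rfl }
  have hadd : ∀ j a b, (der D)^[j] (a + b) = (der D)^[j] a + (der D)^[j] b := fun j a b => by
    induction j with
    | zero => rfl
    | succ j ih => simp only [Function.iterate_succ_apply', ih, map_add]
  have hsm : ∀ j (c : F) a, (der D)^[j] (c • a) = c • (der D)^[j] a := fun j a b => by
    induction j with
    | zero => rfl
    | succ j ih => simp only [Function.iterate_succ_apply', ih, Derivation.map_smul]
  have h1 : ∀ j, (der D)^[j + 1] (1 : R) = 0 := fun j => by
    induction j with
    | zero => simp
    | succ j ih => rw [Function.iterate_succ_apply', ih, map_zero]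
  let φ : R →ₗ[F] PowerSeries F :=
    { toFun := fun f => PowerSeries.mk fun j => (j.factorial : F)⁻¹ * ε ((der D)^[j] f)
      map_add' := by intro a b; ext j; simp [hadd, mul_add]
      map_smul' := by intro c a; ext j; simp [hsm]; ring }
  have hφ1 : φ 1 = 1 := by
    ext j
    rcases j with _ | j
    · simp [φ]
    · simp only [φ, LinearMap.coe_mk, AddHom.coe_mk, PowerSeries.coeff_mk, h1, map_zero, mul_zero]
      rw [PowerSeries.coeff_one]; simp
  have hφm : ∀ a b, φ (a * b) = φ a * φ b := by
    intro a b
    ext j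
    rw [PowerSeries.coeff_mul]
    simp only [φ, LinearMap.coe_mk, AddHom.coe_mk, PowerSeries.coeff_mk, leibniz_iter, map_sum, map_nsmul, map_mul,
      Finset.mul_sum]
    refine Finset.sum_congr rfl fun ij hij => ?_
    replace hij := Finset.HasAntidiagonal.mem_antidiagonal.1 hij
    obtain rfl : ij.1 + ij.2 = j := hij
    have hf1 := Nat.add_choose_mul_factorial_mul_factorial ij.1 ij.2
    rw [Nat.choose_symm_add.symm] at hf1
    have hf2 : (((ij.1 + ij.2).choose ij.1 : ℕ) : F) * (ij.1.factorial : F) * (ij.2.factorial : F) = ((ij.1 + ij.2).factorial : F) := by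
      exact_mod_cast hf1
    have n1 : (ij.1.factorial : F) ≠ 0 := by exact_mod_cast Nat.factorial_ne_zero _
    have n2 : (ij.2.factorial : F) ≠ 0 := by exact_mod_cast Nat.factorial_ne_zero _
    have n3 : ((ij.1 + ij.2).factorial : F) ≠ 0 := by exact_mod_cast Nat.factorial_ne_zero _
    rw [nsmul_eq_mul]
    field_simp
    rw [← hf2]; ring
  let Φ : R →ₐ[F] PowerSeries F := AlgHom.ofLinearMap φ hφ1 hφm
  let ι : F[X] →ₐ[F] PowerSeries F := Polynomial.coeToPowerSeries.algHom F
  have hι : Function.Injective ι := by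
    intro a b h
    apply Polynomial.coe_injective F
    simpa [ι, Polynomial.coeToPowerSeries.algHom_apply] using h
  have htr : ∀ f k, (der D)^[k] f = 0 → ι (∑ j ∈ Finset.range k, Polynomial.C ((j.factorial : F)⁻¹ * ε ((der D)^[j] f)) * X ^ j) = Φ f := by
    intro f k hk
    ext j
    have : (PowerSeries.coeff j) (Φ f) = (j.factorial : F)⁻¹ * ε ((der D)^[j] f) := by
      simp [Φ, φ]
    rw [this]
    simp only [ι, Polynomial.coeToPowerSeries.algHom_apply, Algebra.algebraMap_self, PowerSeries.map_id, RingHom.id_apply, id,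
      Polynomial.coeff_coe, Polynomial.finset_sum_coeff, Polynomial.coeff_C_mul, Polynomial.coeff_X_pow]
    by_cases hj : j < k
    · rw [Finset.sum_eq_single j]
      · simp
      · intro i _ hi; simp [hi.symm]
      · intro h; exact absurd (Finset.mem_range.2 hj) h
    · have : (der D)^[j] f = 0 := by
        obtain ⟨l, rfl⟩ := Nat.exists_eq_add_of_le (not_lt.1 hj)
        rw [add_comm, Function.iterate_add_apply, hk]
        clear this hj
        induction l with
        | zero => rfl
        | succ l ih => rw [Function.iterate_succ_apply', ih, map_zero]
      rw [this, map_zero, mul_zero]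
      refine Finset.sum_eq_zero fun i hi => ?_
      rw [if_neg, mul_zero]
      rintro rfl
      exact hj (Finset.mem_range.1 hi)
  let e := AlgEquiv.ofInjective ι hι
  let Φ' : R →ₐ[F] ι.range := Φ.codRestrict ι.range (fun f => by
    obtain ⟨k, hk⟩ := hD f
    exact ⟨_, htr f k hk⟩)
  let θ : R →ₐ[F] F := (Polynomial.aeval (1 : F)).comp (e.symm.toAlgHom.comp Φ')
  obtain ⟨γ, hγ⟩ := hR.points θ
  refine ⟨γ, fun f k hk => ?_⟩
  rw [← hγ]
  have : e.symm (Φ' f) = ∑ j ∈ Finset.range k, Polynomial.C ((j.factorial : F)⁻¹ * ε ((der D)^[j] f)) * X ^ j := by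
    rw [AlgEquiv.symm_apply_eq]
    exact Subtype.ext (htr f k hk).symm
  change Polynomial.aeval (1 : F) (e.symm (Φ' f)) = _
  rw [this]
  simp only [map_sum, map_mul, Polynomial.aeval_C, map_pow, Polynomial.aeval_X, one_pow, mul_one]
  exact Finset.sum_congr rfl fun _ _ => rfl

lemma exp_rep [CharZero F] [hR : Good R] (D : Lg R) (hD : ∀ f, ∃ k : ℕ, (der D)^[k] f = 0) :
    ∃ γ : Γ, ∀ v k, (dg h₀ D ^ k) v = 0 → ρ₀ γ v = ∑ j ∈ Finset.range k, (j.factorial : F)⁻¹ • (dg h₀ D ^ j) v := by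
  obtain ⟨γ, hγ⟩ := exp_point D hD
  refine ⟨γ, fun v k hv => ?_⟩
  have key : ∀ ξ j, (der D)^[j] (coef h₀ ξ v) = coef h₀ ξ ((dg h₀ D ^ j) v) := by
    intro ξ j
    induction j with
    | zero => rfl
    | succ j ih => rw [Function.iterate_succ_apply', ih, ← coef_dg, pow_succ', End.mul_apply]
  rw [← sub_eq_zero, ← Module.forall_dual_apply_eq_zero_iff F]
  intro ξ
  have h1 := hγ (coef h₀ ξ v) k (by rw [key, hv]; exact R_ext fun γ => by simp)
  rw [map_sub, sub_eq_zero]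
  rw [coef_apply] at h1
  rw [h1, map_sum]
  refine Finset.sum_congr rfl fun j _ => ?_
  rw [key, coef_apply, map_smul, smul_eq_mul, map_one]
  rfl

/-- Consecutive stable subspaces. -/
def Adj (ρ : Representation F Γ W) (A B : Submodule F W) : Prop :=
  Stab ρ A ∧ Stab ρ B ∧ A < B ∧ ∀ C, Stab ρ C → A ≤ C → C ≤ B → C = A ∨ C = B

lemma exists_adj (B : Submodule F W) (hB : B ≠ ⊥) (hs : Stab ρ₀ B) : ∃ A, Adj ρ₀ A B := by
  obtain ⟨A, ⟨h1, h2⟩, hmax⟩ := WellFounded.has_min (wellFounded_gt (α := Submodule F W))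
    {A | A < B ∧ Stab ρ₀ A} ⟨⊥, bot_lt_iff_ne_bot.2 hB, fun γ v hv => by
      rw [Submodule.mem_bot] at hv; rw [hv, map_zero]; exact Submodule.zero_mem _⟩
  refine ⟨A, h2, hs, h1, fun C hC hAC hCB => ?_⟩
  by_contra hcon
  push Not at hcon
  exact hmax C ⟨lt_of_le_of_ne hCB hcon.2, hC⟩ (lt_of_le_of_ne hAC (Ne.symm hcon.1))

lemma unip_of_adj (γ : Γ) (h : ∀ A B, Adj ρ₀ A B → ∀ b ∈ B, ρ₀ γ b - b ∈ A) (k : ℕ) :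
    ∀ B : Submodule F W, Stab ρ₀ B → finrank F B ≤ k → ∀ b ∈ B, ((ρ₀ γ - 1) ^ k) b = 0 := by
  induction k with
  | zero =>
    intro B _ hk b hb
    have : B = ⊥ := Submodule.finrank_eq_zero.1 (by omega)
    rw [this, Submodule.mem_bot] at hb
    simp [hb]
  | succ k ih =>
    intro B hs hk b hb
    by_cases hB : B = ⊥
    · rw [hB, Submodule.mem_bot] at hb
      simp [hb]
    obtain ⟨A, hA⟩ := exists_adj B hB hs
    rw [pow_succ, End.mul_apply]
    refine ih A hA.1 ?_ _ (h A B hA b hb)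
    have := Submodule.finrank_lt_finrank_of_lt hA.2.2.1
    omega

lemma lie_adj [Good R] (i : Submodule F (Lg R)) (hi : ∀ a ∈ i, ∀ b ∈ i, ⁅a, b⁆ ∈ i) (had : Stab (Ad R) i)
    (hn : ∀ a ∈ i, IsNilpotent (dg h₀ a)) (A B : Submodule F W) (hAB : Adj ρ₀ A B) :
    ∀ D ∈ i, ∀ b ∈ B, dg h₀ D b ∈ A := by
  obtain ⟨hA, hB, hlt, hadj⟩ := hAB
  let K : Submodule F W :=
    { carrier := {b | b ∈ B ∧ ∀ D ∈ i, dg h₀ D b ∈ A}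
      zero_mem' := ⟨B.zero_mem, fun D _ => by rw [map_zero]; exact A.zero_mem⟩
      add_mem' := fun ha hb => ⟨B.add_mem ha.1 hb.1, fun D hD => by rw [map_add]; exact A.add_mem (ha.2 D hD) (hb.2 D hD)⟩
      smul_mem' := fun c a ha => ⟨B.smul_mem c ha.1, fun D hD => by rw [map_smul]; exact A.smul_mem c (ha.2 D hD)⟩ }
  have hK : Stab ρ₀ K := by
    intro γ v hv
    refine ⟨hB γ v hv.1, fun D hD => ?_⟩
    have h1 := dg_ad h₀ γ⁻¹ D v
    rw [inv_inv] at h1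
    have h2 : dg h₀ D (ρ₀ γ v) = ρ₀ γ (dg h₀ (Ad R γ⁻¹ D) v) := by
      rw [h1, rho_inv0']
    rw [h2]
    exact hA γ _ (hv.2 _ (had _ D hD))
  have hAK : A ≤ K := fun a ha => ⟨hlt.le ha, fun D hD => dg_mem h₀ A hA D a ha⟩
  rcases hadj K hK hAK (fun b hb => hb.1) with h | h
  · exfalso
    -- use Engel on (B / A)
    let ρB := subRep ρ₀ B hB
    let A' : Submodule F B := A.comap B.subtype
    have hA' : Stab ρB A' := fun γ v hv => hA γ _ hv
    let hρB := h₀.sub B hB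
    let hQ := hρB.quo A' hA'
    haveI : Nontrivial (B ⧸ A') := by
      rw [Submodule.Quotient.nontrivial_iff]
      intro htop
      obtain ⟨b, hb, hbA⟩ := SetLike.exists_of_lt hlt
      have : (⟨b, hb⟩ : B) ∈ A' := htop ▸ Submodule.mem_top
      exact hbA this
    have hdgk : ∀ D k (b : B), (dg hQ D ^ k) (Submodule.Quotient.mk b) = Submodule.Quotient.mk ((dg hρB D ^ k) b) := by
      intro D k b
      induction k with
      | zero => rfl
      | succ k ih => rw [pow_succ', End.mul_apply, ih, dg_quo hρB A' hA', pow_succ', End.mul_apply]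
    have hdgk' : ∀ D k (b : B), ((dg hρB D ^ k) b : W) = (dg h₀ D ^ k) b := by
      intro D k b
      induction k with
      | zero => rfl
      | succ k ih => rw [pow_succ', End.mul_apply, dg_sub h₀ B hB, ih, pow_succ', End.mul_apply]
    obtain ⟨v, hv, hv0⟩ := engel_lie hQ i hi (by
      intro D hD
      obtain ⟨k, hk⟩ := hn D hD
      refine ⟨k, ?_⟩
      refine LinearMap.ext fun v => ?_
      obtain ⟨b, rfl⟩ := Submodule.Quotient.mk_surjective _ v
      have : (dg hρB D ^ k) b = 0 := Subtype.ext (by rw [hdgk', hk]; rfl)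
      change (dg hQ D ^ k) (Submodule.Quotient.mk b) = 0
      rw [hdgk, this]; rfl)
    obtain ⟨b, rfl⟩ := Submodule.Quotient.mk_surjective _ v
    apply hv
    rw [Submodule.Quotient.mk_eq_zero]
    change (b : W) ∈ A
    rw [← h]
    refine ⟨b.2, fun D hD => ?_⟩
    have h3 := hv0 D hD
    rw [dg_quo hρB A' hA', Submodule.Quotient.mk_eq_zero] at h3
    have h4 : ((dg hρB D b : B) : W) ∈ A := h3
    rwa [dg_sub h₀ B hB] at h4
  · intro D hD b hb
    rw [← h] at hb
    exact hb.2 D hD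

/-- The abstract criterion for `Red`. -/
lemma red_of [IsAlgClosed F] [CharZero F] [Good R] (hf : Function.Injective (dg h₀))
    (hN : ∀ γ : Γ, (∀ A B, Adj ρ₀ A B → ∀ b ∈ B, ρ₀ γ b - b ∈ A) → γ = 1) : Red h₀ := by
  refine ⟨hf, fun i hi had hn => ?_⟩
  rw [eq_bot_iff]
  intro D hD
  rw [Submodule.mem_bot]
  apply hf
  rw [map_zero]
  obtain ⟨γ, hγ⟩ := exp_rep (h₀ := h₀) D (loc_nilp hf D (hn D hD))
  obtain ⟨K, hK⟩ := hn D hD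
  have hγ1 : γ = 1 := by
    refine hN γ fun A B hAB b hb => ?_
    rw [hγ b (K + 1) (by rw [pow_succ, hK]; simp), Finset.sum_range_succ']
    have : (((Nat.factorial 0 : ℕ) : F)⁻¹ • (dg h₀ D ^ 0) b) = b := by simp
    rw [this, add_sub_cancel_right]
    refine A.sum_mem fun j hj => A.smul_mem _ ?_
    have h1 := lie_adj i hi had hn A B hAB D hD b hb
    rw [pow_succ, End.mul_apply]
    generalize dg h₀ D b = w at h1
    clear hj
    induction j with
    | zero => exact h1
    | succ j ih => rw [pow_succ', End.mul_apply]; exact dg_mem h₀ A hAB.1 D _ ih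
  have h2 : ∀ v, dg h₀ D (dg h₀ D v) = 0 → dg h₀ D v = 0 := by
    intro v hv
    have := hγ v 2 (by rw [pow_two, End.mul_apply, hv])
    rw [hγ1, map_one] at this
    simpa [Finset.sum_range_succ] using this
  have h3 : ∀ k v, (dg h₀ D ^ (k + 1)) v = 0 → dg h₀ D v = 0 := by
    intro k
    induction k with
    | zero => intro v hv; simpa using hv
    | succ k ih =>
      intro v hv
      rw [pow_succ, End.mul_apply] at hv
      exact h2 v (ih _ hv)
  ext v
  exact h3 K v (by rw [pow_succ, hK]; simp)

end reps
end RG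

namespace RG
open Module Polynomial
section reps
variable {F : Type} [Field F] {n : ℕ} {G G0 : Subgroup (GL (Fin n) F)}

/-- natural action -/
abbrev mv (g : GL (Fin n) F) (v : Fin n → F) : Fin n → F := (g : Matrix (Fin n) (Fin n) F).mulVec v

lemma mv_mul (g h : GL (Fin n) F) (v : Fin n → F) : mv (g * h) v = mv g (mv h v) := by simp [mv]
lemma mv_one (v : Fin n → F) : mv (1 : GL (Fin n) F) v = v := by simp [mv]
lemma mv_sub (g : GL (Fin n) F) (v w : Fin n → F) : mv g (v - w) = mv g v - mv g w := Matrix.mulVec_sub _ _ _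
lemma mv_inv (g : GL (Fin n) F) (v : Fin n → F) : mv g⁻¹ (mv g v) = v := by rw [← mv_mul, inv_mul_cancel, mv_one]
lemma mv_inv' (g : GL (Fin n) F) (v : Fin n → F) : mv g (mv g⁻¹ v) = v := by rw [← mv_mul, mul_inv_cancel, mv_one]
lemma std_mv (γ : G0) (v : Fin n → F) : std G0 γ v = mv γ.1 v := rfl

lemma g0_normal (h0 : IsIdentityComponent G0 G) (g : GL (Fin n) F) (hg : g ∈ G) (h : GL (Fin n) F) (hh : h ∈ G0) :
    g * h * g⁻¹ ∈ G0 := by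
  obtain ⟨h1, h2, h3, h4⟩ := h0
  let K : Subgroup (GL (Fin n) F) := G0.map (MulAut.conj g).toMonoidHom
  have hK : (K : Set (GL (Fin n) F)) = (fun x => g * x * g⁻¹) '' (G0 : Set (GL (Fin n) F)) := by
    ext x; simp [K]
  have hK' : (K : Set (GL (Fin n) F)) = (fun x => g⁻¹ * x * (g⁻¹)⁻¹) ⁻¹' (G0 : Set (GL (Fin n) F)) := by
    rw [hK]
    ext x
    simp only [Set.mem_image, Set.mem_preimage, SetLike.mem_coe]
    constructor
    · rintro ⟨y, hy, rfl⟩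
      convert hy using 1; group
    · intro hx
      exact ⟨_, hx, by group⟩
  refine h4 K ?_ ?_ ?_ ⟨h, hh, rfl⟩
  · rintro _ ⟨x, hx, rfl⟩
    exact G.mul_mem (G.mul_mem hg (h1 hx)) (G.inv_mem hg)
  · rw [zclosed_iff] at h2 ⊢
    rw [hK']
    exact h2.preimage (cont_conj g⁻¹)
  · rw [zconn_iff] at h3 ⊢
    rw [hK]
    exact h3.image _ (cont_conj g).continuousOn

/-- pullback of subspaces -/
def pb (g : GL (Fin n) F) (A : Submodule F (Fin n → F)) : Submodule F (Fin n → F) :=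
  A.comap (g : Matrix (Fin n) (Fin n) F).mulVecLin

lemma mem_pb (g : GL (Fin n) F) (A : Submodule F (Fin n → F)) (v) : v ∈ pb g A ↔ mv g v ∈ A := Iff.rfl

lemma pb_pb (g : GL (Fin n) F) (A : Submodule F (Fin n → F)) : pb g (pb g⁻¹ A) = A := by
  ext v; rw [mem_pb, mem_pb, mv_inv]
lemma pb_pb' (g : GL (Fin n) F) (A : Submodule F (Fin n → F)) : pb g⁻¹ (pb g A) = A := by
  ext v; rw [mem_pb, mem_pb, mv_inv']

lemma pb_mono (g : GL (Fin n) F) {A B : Submodule F (Fin n → F)} (h : A ≤ B) : pb g A ≤ pb g B := Submodule.comap_mono h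

lemma pb_stab (h0 : IsIdentityComponent G0 G) (g : GL (Fin n) F) (hg : g ∈ G) (A : Submodule F (Fin n → F))
    (hA : Stab (std G0) A) : Stab (std G0) (pb g A) := by
  intro γ v hv
  rw [mem_pb] at hv ⊢
  have := hA ⟨g * γ.1 * g⁻¹, g0_normal h0 g hg γ.1 γ.2⟩ _ hv
  rw [std_mv] at this ⊢
  rw [mv_mul, mv_mul, mv_inv] at this
  exact this

lemma pb_adj (h0 : IsIdentityComponent G0 G) (g : GL (Fin n) F) (hg : g ∈ G) (A B : Submodule F (Fin n → F))
    (hA : Adj (std G0) A B) : Adj (std G0) (pb g A) (pb g B) := by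
  obtain ⟨h1, h2, h3, h4⟩ := hA
  refine ⟨pb_stab h0 g hg A h1, pb_stab h0 g hg B h2, lt_of_le_of_ne (pb_mono g h3.le) fun h => h3.ne ?_, fun C hC hAC hCB => ?_⟩
  · rw [← pb_pb' g A, h, pb_pb']
  · have := h4 (pb g⁻¹ C) (pb_stab h0 _ (G.inv_mem hg) C hC) (by rw [← pb_pb' g A]; exact pb_mono _ hAC)
      (by rw [← pb_pb' g B]; exact pb_mono _ hCB)
    rcases this with h | h
    · left; rw [← h, pb_pb]
    · right; rw [← h, pb_pb]

variable (G0) in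
/-- the unipotent radical candidate -/
def NN : Subgroup (GL (Fin n) F) where
  carrier := {g | g ∈ G0 ∧ ∀ A B, Adj (std G0) A B → ∀ b ∈ B, mv g b - b ∈ A}
  one_mem' := ⟨G0.one_mem, fun A B _ b _ => by rw [mv_one, sub_self]; exact A.zero_mem⟩
  mul_mem' := by
    rintro g h ⟨hg, hg'⟩ ⟨hh, hh'⟩
    refine ⟨G0.mul_mem hg hh, fun A B hAB b hb => ?_⟩
    have : mv (g * h) b - b = mv g (mv h b - b) + (mv g b - b) := by rw [mv_mul, mv_sub]; abel
    rw [this]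
    exact A.add_mem (hAB.1 ⟨g, hg⟩ _ (hh' A B hAB b hb)) (hg' A B hAB b hb)
  inv_mem' := by
    rintro g ⟨hg, hg'⟩
    refine ⟨G0.inv_mem hg, fun A B hAB b hb => ?_⟩
    have : mv g⁻¹ b - b = - mv g⁻¹ (mv g b - b) := by rw [mv_sub, mv_inv]; abel
    rw [this]
    exact A.neg_mem (hAB.1 ⟨g⁻¹, G0.inv_mem hg⟩ _ (hg' A B hAB b hb))

lemma NN_closed (hcl : IsClosed (G0 : Set (GL (Fin n) F))) : IsClosed (NN G0 : Set (GL (Fin n) F)) := by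
  have : (NN G0 : Set (GL (Fin n) F)) = (G0 : Set (GL (Fin n) F)) ∩
      ⋂ x : {x : Submodule F (Fin n → F) × Submodule F (Fin n → F) × (Fin n → F) × (Dual F (Fin n → F)) //
        Adj (std G0) x.1 x.2.1 ∧ x.2.2.1 ∈ x.2.1 ∧ x.2.2.2 ∈ x.1.dualAnnihilator},
        {g | x.1.2.2.2 (mv g x.1.2.2.1 - x.1.2.2.1) = 0} := by
    ext g
    simp only [Set.mem_inter_iff, Set.mem_iInter, Set.mem_setOf_eq]
    constructor
    · rintro ⟨h1, h2⟩
      refine ⟨h1, ?_⟩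
      rintro ⟨⟨A, B, b, ξ⟩, hAB, hb, hξ⟩
      exact (Submodule.mem_dualAnnihilator _).1 hξ _ (h2 A B hAB b hb)
    · rintro ⟨h1, h2⟩
      refine ⟨h1, fun A B hAB b hb => ?_⟩
      rw [← Subspace.forall_mem_dualAnnihilator_apply_eq_zero_iff]
      intro ξ hξ
      exact h2 ⟨⟨A, B, b, ξ⟩, hAB, hb, hξ⟩
  rw [this]
  refine hcl.inter (isClosed_iInter fun x => ?_)
  apply closed_zero
  obtain ⟨⟨A, B, b, ξ⟩, h⟩ := x
  have e : (fun g : GL (Fin n) F => ξ (mv g b - b)) =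
      fun g => (∑ i, (ξ (fun j => if i = j then 1 else 0)) * ∑ j, en i j g * b j) - ξ b := by
    funext g
    rw [map_sub]
    congr 1
    rw [LinearMap.pi_apply_eq_sum_univ ξ (mv g b)]
    refine Finset.sum_congr rfl fun i _ => ?_
    rw [smul_eq_mul, mul_comm]
    rfl
  have e2 : (fun g : GL (Fin n) F => (∑ i, (ξ (fun j => if i = j then 1 else 0)) * ∑ j, en i j g * b j) - ξ b) =
    (fun g : GL (Fin n) F => (∑ i, (ξ (fun j => if i = j then 1 else 0)) * ∑ j, en i j g * b j)) - fun _ => ξ b := rfl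
  change (fun g : GL (Fin n) F => ξ (mv g b - b)) ∈ OO F n
  rw [e, e2]
  refine (OO F n).sub_mem (sum_fun_mem _ _ fun i _ => ?_) (const_mem _)
  exact (OO F n).mul_mem (const_mem _) (sum_fun_mem _ _ fun j _ => (OO F n).mul_mem (en_mem i j) (const_mem _))

lemma NN_unip (u) (hu : u ∈ NN G0) : ((u : Matrix (Fin n) (Fin n) F) - 1) ^ n = 0 := by
  have h := unip_of_adj (ρ₀ := std G0) ⟨u, hu.1⟩ (fun A B hAB b hb => hu.2 A B hAB b hb) n ⊤ (fun _ _ _ => trivial)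
    (by simp)
  have e : ∀ k v, ((std G0 ⟨u, hu.1⟩ - 1) ^ k) v = (((u : Matrix (Fin n) (Fin n) F) - 1) ^ k).mulVec v := by
    intro k
    induction k with
    | zero => intro v; simp
    | succ k ih =>
      intro v
      rw [pow_succ, End.mul_apply, ih, pow_succ, ← Matrix.mulVec_mulVec]
      congr 1
      rw [Matrix.sub_mulVec, Matrix.one_mulVec]; rfl
  apply Matrix.mulVec_injective
  funext v
  rw [← e, h v trivial, Matrix.zero_mulVec]

lemma NN_conn [CharZero F] (hcl : IsClosed (G0 : Set (GL (Fin n) F))) : IsPreconnected (NN G0 : Set (GL (Fin n) F)) := by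
  refine isPreconnected_of_forall 1 fun u hu => ?_
  obtain ⟨c, P, hc, hk⟩ := unip_curve u (NN_unip u hu)
  refine ⟨Set.range c, ?_, ⟨0, by simpa using hk 0⟩, ⟨1, by simpa using hk 1⟩, curve_conn c P hc⟩
  rintro _ ⟨s, rfl⟩
  refine curve_closed c P hc (NN_closed hcl) ?_ s
  refine (Set.infinite_range_of_injective (Nat.cast_injective (R := F))).mono ?_
  rintro _ ⟨k, rfl⟩
  rw [Set.mem_preimage, hk]
  exact (NN G0).pow_mem hu k

lemma red_std [IsAlgClosed F] [CharZero F] (hGred : IsReductive G) (h0 : IsIdentityComponent G0 G) [Good (cr G0)] :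
    Red (rat_std G0) := by
  have hcl := (zclosed_iff _).1 h0.2.1
  have hN : NN G0 = ⊥ := by
    refine hGred (NN G0) (fun g hg => h0.1 hg.1) ((zclosed_iff _).2 (NN_closed hcl)) ((zconn_iff _).2 (NN_conn hcl))
      NN_unip ?_
    intro g hg h hh
    refine ⟨g0_normal h0 g hg h hh.1, fun A B hAB b hb => ?_⟩
    have := hh.2 _ _ (pb_adj h0 g hg A B hAB) (mv g⁻¹ b) (by rw [mem_pb, mv_inv']; exact hb)
    rw [mem_pb, mv_sub, mv_inv'] at this
    rwa [mv_mul, mv_mul]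
  refine red_of faith_std fun γ hγ => ?_
  have : γ.1 ∈ NN G0 := ⟨γ.2, hγ⟩
  rw [hN, Subgroup.mem_bot] at this
  exact Subtype.ext this

end reps
end RG

namespace RG
open Module Polynomial
section reps
variable {F : Type} [Field F] {n : ℕ} {G0 T : Subgroup (GL (Fin n) F)}

lemma exists_P {ι : Type} (N : ι → Submodule F (Fin n → F)) (h1 : iSupIndep N) (h2 : iSup N = ⊤) :
    ∃ P : GL (Fin n) F, ∀ j, ∃ i, mv P (Pi.single j 1) ∈ N i := by
  classical
  have hI := DirectSum.isInternal_submodule_of_iSupIndep_of_iSup_eq_top h1 h2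
  let b0 := hI.collectedBasis (fun i => Module.Free.chooseBasis F (N i))
  let b := b0.reindex (b0.indexEquiv (Pi.basisFun F (Fin n)))
  let e := Pi.basisFun F (Fin n)
  refine ⟨⟨e.toMatrix b, b.toMatrix e, e.toMatrix_mul_toMatrix_flip b, b.toMatrix_mul_toMatrix_flip e⟩, fun j => ?_⟩
  have : mv (⟨e.toMatrix b, b.toMatrix e, e.toMatrix_mul_toMatrix_flip b, b.toMatrix_mul_toMatrix_flip e⟩ : GL (Fin n) F)
      (Pi.single j 1) = b j := by
    ext i
    simp [mv, e, Basis.toMatrix_apply]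
  rw [this, Basis.reindex_apply]
  exact ⟨_, hI.collectedBasis_mem _ _⟩

lemma isDiag_of (P g : GL (Fin n) F) (h : ∀ j, ∃ c : F, mv g (mv P (Pi.single j 1)) = c • mv P (Pi.single j 1)) :
    Matrix.IsDiag ((P⁻¹ * g * P : GL (Fin n) F) : Matrix (Fin n) (Fin n) F) := by
  intro i j hij
  obtain ⟨c, hc⟩ := h j
  have : mv (P⁻¹ * g * P) (Pi.single j 1) = c • Pi.single j 1 := by
    rw [mv_mul, mv_mul, hc]
    rw [show mv P⁻¹ (c • mv P (Pi.single j 1)) = c • mv P⁻¹ (mv P (Pi.single j 1)) from Matrix.mulVec_smul _ _ _, mv_inv]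
  have h2 := congrFun this i
  simpa [mv, Matrix.mulVec_single, Pi.single_apply, hij] using h2

/-- operator -/
abbrev op (g : GL (Fin n) F) : End F (Fin n → F) := (g : Matrix (Fin n) (Fin n) F).mulVecLin

lemma ss_of_eig (g : GL (Fin n) F) (h : ⨆ μ, (op g).eigenspace μ = ⊤) : IsSemisimpleElem g := by
  obtain ⟨P, hP⟩ := exists_P _ (End.eigenspaces_iSupIndep (op g)) h
  refine ⟨P, isDiag_of P g fun j => ?_⟩
  obtain ⟨i, hi⟩ := hP j
  exact ⟨i, End.mem_eigenspace_iff.1 hi⟩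

lemma diag_apply {M : Matrix (Fin n) (Fin n) F} (h : M.IsDiag) (j : Fin n) : M.mulVec (Pi.single j 1) = M j j • Pi.single j 1 := by
  ext i
  by_cases hij : i = j
  · subst hij; simp [Matrix.mulVec_single]
  · simp [Matrix.mulVec_single, Pi.single_apply, hij, h hij]

lemma eig_of_ss (g : GL (Fin n) F) (h : IsSemisimpleElem g) : ⨆ μ, (op g).eigenspace μ = ⊤ := by
  obtain ⟨P, hP⟩ := h
  rw [eq_top_iff]
  intro v _
  have hv : v = ∑ j, (mv P⁻¹ v j) • mv P (Pi.single j 1) := by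
    conv_lhs => rw [← mv_inv' P v]
    have : mv P⁻¹ v = ∑ j, (mv P⁻¹ v j) • Pi.single j (1 : F) := by
      ext i; simp [Pi.single_apply]
    conv_lhs => rw [this]
    change (op P) _ = _
    rw [map_sum]
    exact Finset.sum_congr rfl fun j _ => map_smul (op P) _ _
  rw [hv]
  refine Submodule.sum_mem _ fun j _ => Submodule.smul_mem _ _ ?_
  refine Submodule.mem_iSup_of_mem (((P⁻¹ * g * P : GL (Fin n) F) : Matrix (Fin n) (Fin n) F) j j) ?_
  rw [End.mem_eigenspace_iff]
  have h1 := diag_apply hP j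
  change mv g (mv P (Pi.single j 1)) = _
  have h2 : mv P (mv (P⁻¹ * g * P) (Pi.single j 1)) = mv g (mv P (Pi.single j 1)) := by
    rw [← mv_mul, ← mv_mul]; congr 1; group
  rw [← h2]
  change (op P) (mv (P⁻¹ * g * P) (Pi.single j 1)) = _
  change mv (P⁻¹ * g * P) (Pi.single j 1) = _ at h1
  rw [h1, map_smul]; rfl

lemma op_mul (g h : GL (Fin n) F) : op (g * h) = op g * op h := by
  refine LinearMap.ext fun v => mv_mul g h v

lemma simdiag [IsAlgClosed F] (S : Set (GL (Fin n) F)) (hc : ∀ a ∈ S, ∀ b ∈ S, a * b = b * a) (hs : ∀ a ∈ S, IsSemisimpleElem a) :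
    ∃ P : GL (Fin n) F, ∀ g ∈ S, Matrix.IsDiag ((P⁻¹ * g * P : GL (Fin n) F) : Matrix (Fin n) (Fin n) F) := by
  have hcm : ∀ i j : S, Commute (op i.1) (op j.1) := fun i j => by
    rw [commute_iff_eq, ← op_mul, ← op_mul, hc i i.2 j j.2]
  have hm : ∀ (i j : S) φ, Set.MapsTo (op i.1) ((op j.1).maxGenEigenspace φ) ((op j.1).maxGenEigenspace φ) :=
    fun i j φ => End.mapsTo_maxGenEigenspace_of_comm (hcm j i) φ
  obtain ⟨P, hP⟩ := exists_P _ (End.independent_iInf_maxGenEigenspace_of_forall_mapsTo (fun s : S => op s.1) hm)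
    (End.iSup_iInf_maxGenEigenspace_eq_top_of_forall_mapsTo (fun s : S => op s.1) hm (fun t => End.iSup_maxGenEigenspace_eq_top _))
  refine ⟨P, fun g hg => isDiag_of P g fun j => ?_⟩
  obtain ⟨c, hcc⟩ := hP j
  rw [Submodule.mem_iInf] at hcc
  refine ⟨c ⟨g, hg⟩, ?_⟩
  have := genEig_le_of_diag _ (eig_of_ss g (hs g hg)) _ (hcc ⟨g, hg⟩)
  exact End.mem_eigenspace_iff.1 this

/-- eigenvectors of algebra endomorphisms -/
def eigAlg {R : Type} [CommRing R] [Algebra F R] (θ : R →ₐ[F] R) : Subalgebra F R where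
  carrier := ((⨆ μ, End.eigenspace θ.toLinearMap μ : Submodule F R) : Set R)
  add_mem' := fun a b => Submodule.add_mem _ a b
  algebraMap_mem' := fun c => Submodule.mem_iSup_of_mem 1 (by rw [End.mem_eigenspace_iff]; simp)
  mul_mem' := by
    intro a b ha hb
    simp only [SetLike.mem_coe] at *
    induction ha using Submodule.iSup_induction' with
    | zero => rw [zero_mul]; exact Submodule.zero_mem _
    | add x y _ _ hx hy => rw [add_mul]; exact Submodule.add_mem _ hx hy
    | mem μ x hx =>
      induction hb using Submodule.iSup_induction' with
      | zero => rw [mul_zero]; exact Submodule.zero_mem _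
      | add y z _ _ hy hz => rw [mul_add]; exact Submodule.add_mem _ hy hz
      | mem ν y hy =>
        refine Submodule.mem_iSup_of_mem (μ * ν) ?_
        rw [End.mem_eigenspace_iff] at *
        simp only [AlgHom.toLinearMap_apply, map_mul] at *
        rw [hx, hy, smul_mul_smul_comm]

lemma mem_eigAlg {R : Type} [CommRing R] [Algebra F R] (θ : R →ₐ[F] R) (x : R) :
    x ∈ eigAlg θ ↔ x ∈ ⨆ μ, End.eigenspace θ.toLinearMap μ := Iff.rfl

/-- linear combinations of entries -/
noncomputable def aa (M : Matrix (Fin n) (Fin n) F) (i j : Fin n) : cr G0 := ∑ k, M k j • enH i k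
noncomputable def aa' (M : Matrix (Fin n) (Fin n) F) (i j : Fin n) : cr G0 := ∑ k, M i k • enH' k j

lemma sum_val {ι : Type} (s : Finset ι) (c : ι → F) (f : ι → cr G0) (γ : G0) : (∑ k ∈ s, c k • f k : cr G0).1 γ = ∑ k ∈ s, c k * (f k).1 γ := by
  rw [AddSubmonoidClass.coe_finset_sum, Finset.sum_apply]
  rfl

lemma aa_val (M : Matrix (Fin n) (Fin n) F) (i j : Fin n) (γ : G0) :
    (aa M i j : cr G0).1 γ = ((γ.1 : Matrix (Fin n) (Fin n) F) * M) i j := by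
  rw [aa, sum_val, Matrix.mul_apply]
  exact Finset.sum_congr rfl fun k _ => mul_comm _ _

lemma aa_val' (M : Matrix (Fin n) (Fin n) F) (i j : Fin n) (γ : G0) :
    (aa' M i j : cr G0).1 γ = (M * ((γ.1⁻¹ : GL (Fin n) F) : Matrix (Fin n) (Fin n) F)) i j := by
  rw [aa', sum_val, Matrix.mul_apply]
  exact Finset.sum_congr rfl fun k _ => rfl

lemma aa_eig [Good (cr G0)] (t : G0) (M d : Matrix (Fin n) (Fin n) F) (hd : d.IsDiag) (h : (t.1 : Matrix (Fin n) (Fin n) F) * M = M * d) (i j) :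
    (aa M i j : cr G0) ∈ eigAlg (rt t : cr G0 →ₐ[F] cr G0) := by
  rw [mem_eigAlg]
  refine Submodule.mem_iSup_of_mem (d j j) ?_
  rw [End.mem_eigenspace_iff]
  refine R_ext fun γ => ?_
  change (aa M i j : cr G0).1 (γ * t) = d j j * (aa M i j : cr G0).1 γ
  rw [aa_val, aa_val, Subgroup.coe_mul, Units.val_mul, Matrix.mul_assoc, h, ← Matrix.mul_assoc, Matrix.mul_apply,
    Finset.sum_eq_single j, mul_comm]
  · intro k _ hk; rw [hd hk, mul_zero]
  · intro h; exact absurd (Finset.mem_univ _) h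

lemma aa_eig' [Good (cr G0)] (t : G0) (M d : Matrix (Fin n) (Fin n) F) (hd : d.IsDiag)
    (h : M * ((t.1⁻¹ : GL (Fin n) F) : Matrix (Fin n) (Fin n) F) = d * M) (i j) :
    (aa' M i j : cr G0) ∈ eigAlg (rt t : cr G0 →ₐ[F] cr G0) := by
  rw [mem_eigAlg]
  refine Submodule.mem_iSup_of_mem (d i i) ?_
  rw [End.mem_eigenspace_iff]
  refine R_ext fun γ => ?_
  change (aa' M i j : cr G0).1 (γ * t) = d i i * (aa' M i j : cr G0).1 γ
  rw [aa_val', aa_val', Subgroup.coe_mul, mul_inv_rev, Units.val_mul, ← Matrix.mul_assoc, h, Matrix.mul_assoc, Matrix.mul_apply,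
    Finset.sum_eq_single i]
  · intro k _ hk; rw [hd (Ne.symm hk), zero_mul]
  · intro h; exact absurd (Finset.mem_univ _) h

lemma inv_diag (d d' : Matrix (Fin n) (Fin n) F) (hd' : d' * d = 1) (hP : d.IsDiag) : d'.IsDiag := by
  intro i j hij
  have h1 := congrFun (congrFun hd' i) j
  rw [Matrix.mul_apply, Finset.sum_eq_single j, Matrix.one_apply_ne hij] at h1
  · have h2 := congrFun (congrFun hd' j) j
    rw [Matrix.mul_apply, Finset.sum_eq_single j, Matrix.one_apply_eq] at h2
    · have : d j j ≠ 0 := fun h => by rw [h, mul_zero] at h2; exact zero_ne_one h2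
      exact (mul_eq_zero.1 h1).resolve_right this
    · intro k _ hk; rw [hP hk, mul_zero]
    · intro h; exact absurd (Finset.mem_univ _) h
  · intro k _ hk; rw [hP hk, mul_zero]
  · intro h; exact absurd (Finset.mem_univ _) h

lemma diag_cr [Good (cr G0)] (t : G0) (ht : IsSemisimpleElem t.1) :
    ⨆ μ, End.eigenspace (rt t : cr G0 →ₐ[F] cr G0).toLinearMap μ = ⊤ := by
  obtain ⟨P, hP⟩ := ht
  have hdd : ((P⁻¹ * (t.1)⁻¹ * P : GL (Fin n) F) : Matrix (Fin n) (Fin n) F).IsDiag := by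
    refine inv_diag _ _ ?_ hP
    rw [← Units.val_mul]
    have : (P⁻¹ * (t.1)⁻¹ * P) * (P⁻¹ * t.1 * P) = 1 := by group
    rw [this, Units.val_one]
  have ha := aa_eig t (P : Matrix (Fin n) (Fin n) F) _ hP (by
    rw [← Units.val_mul, ← Units.val_mul]; congr 1; group)
  have ha' := aa_eig' t ((P⁻¹ : GL (Fin n) F) : Matrix (Fin n) (Fin n) F) _ hdd (by
    rw [← Units.val_mul, ← Units.val_mul]; congr 1; group)
  rw [eq_top_iff]
  intro f _
  rw [← mem_eigAlg]
  apply cr_ind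
  · intro i j
    have : enH i j = ∑ k, ((P⁻¹ : GL (Fin n) F) : Matrix (Fin n) (Fin n) F) k j • (aa (P : Matrix (Fin n) (Fin n) F) i k : cr G0) := by
      refine R_ext fun γ => ?_
      have h1 : ((γ.1 : GL (Fin n) F) : Matrix (Fin n) (Fin n) F) = ((γ.1 : Matrix (Fin n) (Fin n) F) * (P : Matrix (Fin n) (Fin n) F)) * ((P⁻¹ : GL (Fin n) F) : Matrix (Fin n) (Fin n) F) := by
        rw [← Units.val_mul, ← Units.val_mul]; congr 1; group
      rw [sum_val]
      change (γ.1 : Matrix (Fin n) (Fin n) F) i j = _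
      rw [h1, Matrix.mul_apply]
      exact Finset.sum_congr rfl fun k _ => by rw [aa_val, mul_comm]
    rw [this]
    exact Subalgebra.sum_mem _ fun k _ => Subalgebra.smul_mem _ (ha i k) _
  · intro i j
    have : enH' i j = ∑ k, (P : Matrix (Fin n) (Fin n) F) i k • (aa' ((P⁻¹ : GL (Fin n) F) : Matrix (Fin n) (Fin n) F) k j : cr G0) := by
      refine R_ext fun γ => ?_
      have h1 : ((γ.1⁻¹ : GL (Fin n) F) : Matrix (Fin n) (Fin n) F) = (P : Matrix (Fin n) (Fin n) F) * (((P⁻¹ : GL (Fin n) F) : Matrix (Fin n) (Fin n) F) * ((γ.1⁻¹ : GL (Fin n) F) : Matrix (Fin n) (Fin n) F)) := by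
        rw [← Units.val_mul, ← Units.val_mul]; congr 1; group
      rw [sum_val]
      change ((γ.1⁻¹ : GL (Fin n) F) : Matrix (Fin n) (Fin n) F) i j = _
      rw [h1, Matrix.mul_apply]
      exact Finset.sum_congr rfl fun k _ => by rw [aa_val']
    rw [this]
    exact Subalgebra.sum_mem _ fun k _ => Subalgebra.smul_mem _ (ha' k j) _

lemma tf_cr (hTc : IsPreconnected (T : Set (GL (Fin n) F))) (hTG : T ≤ G0) (f : cr G0) (h1 : f.1 1 = 1) (k : ℕ) (hk : k ≠ 0)
    (h : ∀ t : G0, t.1 ∈ T → f.1 t ^ k = 1) : ∀ t : G0, t.1 ∈ T → f.1 t = 1 := by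
  classical
  obtain ⟨f', hf', hff⟩ := mem_cr.1 f.2
  intro t ht
  by_contra hne
  let p : F[X] := ∏ ζ ∈ (nthRootsFinset k (1 : F)).erase 1, (X - C ζ)
  have hp : ∀ x : F, p.eval x = 0 ↔ ∃ ζ ∈ (nthRootsFinset k (1 : F)).erase 1, x = ζ := by
    intro x
    simp only [p, eval_prod, Finset.prod_eq_zero_iff, eval_sub, eval_X, eval_C, sub_eq_zero]
  have hroot : ∀ x : F, x ^ k = 1 → x ≠ 1 → p.eval x = 0 := fun x hx hx1 =>
    (hp x).2 ⟨x, Finset.mem_erase.2 ⟨hx1, (mem_nthRootsFinset (Nat.pos_of_ne_zero hk) _).2 hx⟩, rfl⟩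
  have c1 : IsClosed {g | (f' - 1) g = 0} := closed_zero ((OO F n).sub_mem hf' (OO F n).one_mem)
  have c2 : IsClosed {g | (aeval f' p) g = 0} := closed_zero (by
    have := (aeval (⟨f', hf'⟩ : OO F n) p).2
    rwa [← Subalgebra.aeval_coe] at this)
  have hev : ∀ g, (aeval f' p) g = p.eval (f' g) := fun g => by
    have := (Polynomial.aeval_algHom_apply (Pi.evalAlgHom F (fun _ : GL (Fin n) F => F) g) f' p)
    simpa using this.symm
  rw [isPreconnected_closed_iff] at hTc
  obtain ⟨g, hgT, hg1, hg2⟩ := hTc _ _ c1 c2 (by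
    intro g hg
    by_cases hx : f' g = 1
    · left; simp [hx]
    · right
      change (aeval f' p) g = 0
      rw [hev]
      refine hroot _ ?_ hx
      have := h ⟨g, hTG hg⟩ hg
      rwa [← hff] at this) ⟨1, T.one_mem, by
        have := hff 1
        rw [h1] at this
        change f' 1 - 1 = 0
        rw [sub_eq_zero]; exact this⟩ ⟨t.1, ht, by
        change (aeval f' p) t.1 = 0
        rw [hev]
        refine hroot _ ?_ ?_
        · rw [hff]; exact h t ht
        · rw [hff]; exact hne⟩
  change (aeval f' p) g = 0 at hg2
  have hg1' : f' g = 1 := sub_eq_zero.1 hg1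
  rw [hev, hg1', hp] at hg2
  obtain ⟨ζ, hζ, rfl⟩ := hg2
  exact (Finset.mem_erase.1 hζ).1 rfl

end reps
end RG

namespace RG
open Module Polynomial
section reps
variable {F : Type} [Field F]

lemma exists_tau [IsAlgClosed F] [CharZero F] (x : F) (hx : x ≠ 0) :
    ∃ τ : F →+ Additive Fˣ, ((Additive.toMul (τ x) : Fˣ) : F) = 2 := by
  letI : DivisibleBy (Additive Fˣ) ℕ := divisibleByOfSMulRightSurj _ _ (by
    intro k hk a
    obtain ⟨z, hz⟩ := IsAlgClosed.exists_pow_nat_eq ((Additive.toMul a : Fˣ) : F) (Nat.pos_of_ne_zero hk)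
    have hz0 : z ≠ 0 := by
      rintro rfl
      rw [zero_pow hk] at hz
      exact (Additive.toMul a).ne_zero hz.symm
    refine ⟨Additive.ofMul (Units.mk0 z hz0), ?_⟩
    apply Additive.toMul.injective
    ext
    simpa using hz)
  letI : DivisibleBy (Additive Fˣ) ℤ := AddGroup.divisibleByIntOfDivisibleByNat _
  have h2 : (2 : F) ≠ 0 := two_ne_zero
  obtain ⟨τ, hτ⟩ := (Module.Baer.of_divisible (Additive Fˣ)).extension_property_addMonoidHom (zmultiplesHom F x) (by
    intro a b hab
    simpa [hx] using hab) (zmultiplesHom _ (Additive.ofMul (Units.mk0 2 h2)))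
  refine ⟨τ, ?_⟩
  have := DFunLike.congr_fun hτ 1
  simp only [AddMonoidHom.comp_apply, zmultiplesHom_apply, one_smul] at this
  rw [this]; rfl

section ab
variable {Γ : Type} [Group Γ] {R : Subalgebra F (Γ → F)}

lemma tau_point [IsAlgClosed F] [hR : Good R] (D : Lg R) (τ : F →+ Additive Fˣ) :
    ∃ γ : Γ, ∀ μ, ∀ f ∈ End.maxGenEigenspace (der D : R →ₗ[F] R) μ, rt γ f = ((Additive.toMul (τ μ) : Fˣ) : F) • f := by
  obtain ⟨Q, hQ⟩ := exists_diag _ (End.independent_maxGenEigenspace (der D : R →ₗ[F] R))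
    (iSup_genEig_R (der_linv D)) (fun μ => ((Additive.toMul (τ μ) : Fˣ) : F))
  have ind : ∀ (p : R → Prop), (∀ μ, ∀ f ∈ End.maxGenEigenspace (der D : R →ₗ[F] R) μ, p f) →
      p 0 → (∀ f g, p f → p g → p (f + g)) → ∀ f, p f := by
    intro p h1 h2 h3 f
    have hf : f ∈ ⨆ μ, End.maxGenEigenspace (der D : R →ₗ[F] R) μ := by
      rw [iSup_genEig_R (der_linv D)]; trivial
    exact Submodule.iSup_induction _ (motive := p) hf h1 h2 h3
  have hQ1 : Q 1 = 1 := by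
    rw [hQ 0 1]
    · simp
    · rw [End.mem_maxGenEigenspace]
      refine ⟨1, ?_⟩
      simp
  have hQm : ∀ f g, Q (f * g) = Q f * Q g := by
    intro f g
    revert g
    refine ind (fun f => ∀ g : R, Q (f * g) = Q f * Q g) ?_ ?_ ?_ f
    · intro μ f hf
      refine ind _ ?_ ?_ ?_
      · intro ν g hg
        rw [hQ _ _ (genEig_mul (der D) hf hg), hQ _ _ hf, hQ _ _ hg, smul_mul_smul_comm, map_add, toMul_add, Units.val_mul]
      · simp
      · intro a b ha hb; rw [mul_add, map_add, ha, hb, map_add, mul_add]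
    · intro g; simp
    · intro a b ha hb g; rw [add_mul, map_add, ha, hb, map_add, add_mul]
  let ε : R →ₐ[F] F :=
    { toFun := fun f => f.1 1, map_one' := rfl, map_mul' := fun _ _ => rfl, map_zero' := rfl,
      map_add' := fun _ _ => rfl, commutes' := fun _ => rfl }
  obtain ⟨γ, hγ⟩ := hR.points (ε.comp (AlgHom.ofLinearMap Q hQ1 hQm))
  refine ⟨γ, fun μ f hf => R_ext fun h => ?_⟩
  have hl : ∀ k, ∀ f, (((der D : R →ₗ[F] R) - μ • (1 : End F R)) ^ k) (lt h f) = lt h ((((der D : R →ₗ[F] R) - μ • (1 : End F R)) ^ k) f) := by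
    intro k
    induction k with
    | zero => intro f; rfl
    | succ k ih =>
      intro f
      rw [pow_succ, End.mul_apply, End.mul_apply, ← ih]
      congr 1
      have := (der_linv D).lt h f
      change der D (lt h f) - μ • lt h f = lt h (der D f - μ • f)
      rw [map_sub, map_smul, this]
  have hlf : lt h f ∈ End.maxGenEigenspace (der D : R →ₗ[F] R) μ := by
    rw [End.mem_maxGenEigenspace] at hf ⊢
    obtain ⟨k, hk⟩ := hf
    exact ⟨k, by rw [hl, hk, map_zero]⟩
  have h1 := hγ (lt h f)
  change (Q (lt h f)).1 1 = f.1 (h * γ) at h1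
  rw [hQ μ _ hlf] at h1
  change f.1 (h * γ) = _ * f.1 h
  rw [← h1]
  change _ * f.1 (h * 1) = _
  rw [mul_one]

lemma rt_genEig [Good R] (D : Lg R) (t : Γ) (ht : Ad R t D = D) (μ : F) (f : R)
    (hf : f ∈ End.maxGenEigenspace (der D : R →ₗ[F] R) μ) : rt t f ∈ End.maxGenEigenspace (der D : R →ₗ[F] R) μ := by
  have hc : ∀ f, der D (rt t f) = rt t (der D f) := by
    intro f
    conv_lhs => rw [← ht]
    rw [Ad_apply, ← rt_mul, inv_mul_cancel, rt_one]
  have hl : ∀ k, ∀ f, (((der D : R →ₗ[F] R) - μ • (1 : End F R)) ^ k) (rt t f) = rt t ((((der D : R →ₗ[F] R) - μ • (1 : End F R)) ^ k) f) := by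
    intro k
    induction k with
    | zero => intro f; rfl
    | succ k ih =>
      intro f
      rw [pow_succ, End.mul_apply, End.mul_apply, ← ih]
      congr 1
      change der D (rt t f) - μ • rt t f = rt t (der D f - μ • f)
      rw [map_sub, map_smul, hc]
  rw [End.mem_maxGenEigenspace] at hf ⊢
  obtain ⟨k, hk⟩ := hf
  exact ⟨k, by rw [hl, hk, map_zero]⟩

lemma tau_comm [IsAlgClosed F] [Good R] (D : Lg R) (t γ : Γ) (ht : Ad R t D = D) (c : F → F)
    (hγ : ∀ μ, ∀ f ∈ End.maxGenEigenspace (der D : R →ₗ[F] R) μ, rt γ f = c μ • f) (f : R) : f.1 (γ * t) = f.1 (t * γ) := by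
  have key : rt γ (rt t f) = rt t (rt γ f) := by
    have hf : f ∈ ⨆ μ, End.maxGenEigenspace (der D : R →ₗ[F] R) μ := by
      rw [iSup_genEig_R (der_linv D)]; trivial
    refine Submodule.iSup_induction _ (motive := fun f => rt γ (rt t f) = rt t (rt γ f)) hf ?_ ?_ ?_
    · intro μ f hf
      rw [hγ μ _ (rt_genEig D t ht μ f hf), hγ μ f hf, map_smul]
    · simp
    · intro a b ha hb; rw [map_add, map_add, ha, hb, map_add, map_add]
  have := congrArg (fun f : R => f.1 1) key
  simpa using this

lemma rho_eig [IsAlgClosed F] [Good R] {V : Type} [AddCommGroup V] [Module F V] [FiniteDimensional F V] {ρ : Representation F Γ V}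
    (hρ : Rat R ρ) (γ : Γ) (hd : ⨆ μ, End.eigenspace (rt γ : R →ₐ[F] R).toLinearMap μ = ⊤) :
    ⨆ μ, End.eigenspace (ρ γ) μ = ⊤ := by
  rw [eq_top_iff, ← End.iSup_maxGenEigenspace_eq_top (ρ γ)]
  refine iSup_mono fun μ v hv => ?_
  rw [End.mem_eigenspace_iff]
  rw [← act_rt hρ γ] at hv
  refine eq_of_coef hρ fun ξ => ?_
  have h1 := coef_genEig hρ (linv_rt γ) μ hv ξ
  have h2 := genEig_le_of_diag _ hd μ h1
  rw [End.mem_eigenspace_iff] at h2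
  rw [← act_rt hρ γ, coef_act hρ (linv_rt γ), h2]
  exact ((coefL hρ ξ).map_smul μ v).symm

end ab

variable {n : ℕ} {G0 T : Subgroup (GL (Fin n) F)}

/-- the diagonal torus w.r.t. `P` -/
def Dg (P : GL (Fin n) F) : Subgroup (GL (Fin n) F) where
  carrier := {g | Matrix.IsDiag ((P⁻¹ * g * P : GL (Fin n) F) : Matrix (Fin n) (Fin n) F)}
  one_mem' := by
    change Matrix.IsDiag ((P⁻¹ * 1 * P : GL (Fin n) F) : Matrix (Fin n) (Fin n) F)
    rw [mul_one, inv_mul_cancel, Units.val_one]; exact Matrix.isDiag_one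
  mul_mem' := by
    intro a b ha hb
    change Matrix.IsDiag ((P⁻¹ * (a * b) * P : GL (Fin n) F) : Matrix (Fin n) (Fin n) F)
    have : (P⁻¹ * (a * b) * P : GL (Fin n) F) = (P⁻¹ * a * P) * (P⁻¹ * b * P) := by group
    rw [this, Units.val_mul]
    change Matrix.IsDiag _ at ha
    change Matrix.IsDiag _ at hb
    rw [← ha.diagonal_diag, ← hb.diagonal_diag, Matrix.diagonal_mul_diagonal]
    exact Matrix.isDiag_diagonal _
  inv_mem' := by
    intro a ha
    change Matrix.IsDiag ((P⁻¹ * a⁻¹ * P : GL (Fin n) F) : Matrix (Fin n) (Fin n) F)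
    refine inv_diag _ _ ?_ ha
    rw [← Units.val_mul]
    have : (P⁻¹ * a⁻¹ * P) * (P⁻¹ * a * P) = 1 := by group
    rw [this, Units.val_one]

lemma Dg_closed (P : GL (Fin n) F) : IsClosed (Dg P : Set (GL (Fin n) F)) := by
  have : (Dg P : Set (GL (Fin n) F)) = ⋂ q : {q : Fin n × Fin n // q.1 ≠ q.2}, {g | ((en q.1.1 q.1.2 ∘ fun g => g * P) ∘ fun g => P⁻¹ * g) g = 0} := by
    ext g
    rw [Set.mem_iInter]
    constructor
    · rintro h ⟨⟨i, j⟩, hij⟩; exact h hij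
    · intro h i j hij; exact h ⟨⟨i, j⟩, hij⟩
  rw [this]
  exact isClosed_iInter fun q => closed_zero (comp_left _ _ (comp_right _ _ (en_mem _ _)))

lemma diag_comm (a b : Matrix (Fin n) (Fin n) F) (ha : a.IsDiag) (hb : b.IsDiag) : a * b = b * a := by
  rw [← ha.diagonal_diag, ← hb.diagonal_diag, Matrix.diagonal_mul_diagonal, Matrix.diagonal_mul_diagonal]
  simp only [mul_comm]

lemma Dg_comm (P a b : GL (Fin n) F) (ha : a ∈ Dg P) (hb : b ∈ Dg P) : a * b = b * a := by
  have h := diag_comm _ _ ha hb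
  rw [← Units.val_mul, ← Units.val_mul] at h
  have h2 := Units.ext h
  have e1 : a * b = P * ((P⁻¹ * a * P) * (P⁻¹ * b * P)) * P⁻¹ := by group
  have e2 : b * a = P * ((P⁻¹ * b * P) * (P⁻¹ * a * P)) * P⁻¹ := by group
  rw [e1, e2, h2]

lemma mtor_cr [IsAlgClosed F] [CharZero F] [Good (cr G0)] (hcl : IsClosed (G0 : Set (GL (Fin n) F))) (hT : IsMaximalTorus G0 T) :
    MTor (cr G0) (T.subgroupOf G0) := by
  obtain ⟨hTG, ⟨hTcl, hTcn, hTss, hTcm⟩, hmax⟩ := hT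
  have hTcn' := (zconn_iff _).1 hTcn
  refine ⟨fun a ha b hb => Subtype.ext (hTcm a.1 ha b.1 hb), fun t ht => diag_cr t (hTss _ ht), ?_, ?_⟩
  · intro f hm k hk h t ht
    refine tf_cr hTcn' hTG f ?_ k hk h t ht
    have h0 := h 1 (one_mem _)
    have h1 := hm 1 (one_mem _) 1 (one_mem _)
    rw [mul_one] at h1
    have h2 : f.1 1 ≠ 0 := fun h' => by rw [h', zero_pow hk] at h0; exact zero_ne_one h0
    exact mul_left_cancel₀ h2 (by rw [← h1, mul_one])
  · intro D hD f f' χ μ μ' hf hf' hχ hχ' hμ hμ'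
    by_contra hne
    obtain ⟨τ, hτ⟩ := exists_tau (μ - μ') (sub_ne_zero.2 hne)
    obtain ⟨γ, hγ⟩ := tau_point D τ
    have hcomm : ∀ t : G0, t.1 ∈ T → γ.1 * t.1 = t.1 * γ.1 := by
      intro t ht
      refine Units.ext (Matrix.ext fun i j => ?_)
      exact tau_comm D t γ (hD t ht) _ hγ (enH i j)
    have hγd : ⨆ μ, End.eigenspace (rt γ : cr G0 →ₐ[F] cr G0).toLinearMap μ = ⊤ := by
      rw [eq_top_iff, ← iSup_genEig_R (der_linv D : LInv (der D : cr G0 →ₗ[F] cr G0))]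
      refine iSup_le fun μ f hf => Submodule.mem_iSup_of_mem ((Additive.toMul (τ μ) : Fˣ) : F) ?_
      rw [End.mem_eigenspace_iff]
      exact hγ μ f hf
    have hγs : IsSemisimpleElem γ.1 := ss_of_eig γ.1 (rho_eig (rat_std G0) γ hγd)
    obtain ⟨P, hP⟩ := simdiag (insert γ.1 (T : Set (GL (Fin n) F))) (by
      rintro a (rfl | ha) b (rfl | hb)
      · rfl
      · exact hcomm ⟨b, hTG hb⟩ hb
      · exact (hcomm ⟨a, hTG ha⟩ ha).symm
      · exact hTcm a ha b hb) (by
      rintro a (rfl | ha)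
      · exact hγs
      · exact hTss a ha)
    let C := G0 ⊓ Dg P
    have hC : IsClosed (C : Set (GL (Fin n) F)) := hcl.inter (Dg_closed P)
    obtain ⟨C0, h1, h2, h3, h4, h5⟩ := lemmaL C hC
    have hTC : T ≤ C := fun t ht => ⟨hTG ht, hP t (Or.inr ht)⟩
    have hC0 : C0 = T := by
      refine hmax C0 (fun c hc => (h1 hc).1) ⟨(zclosed_iff _).2 h2, (zconn_iff _).2 h3, fun t ht => ⟨P, (h1 ht).2⟩,
        fun a ha b hb => Dg_comm P a b (h1 ha).2 (h1 hb).2⟩ (h4 T hTC hTcn')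
    obtain ⟨k, hk, hkT⟩ := h5 γ.1 ⟨γ.2, hP _ (Or.inl rfl)⟩
    rw [hC0] at hkT
    let t : T.subgroupOf G0 := ⟨γ ^ k, hkT⟩
    have hpow : ∀ (f : cr G0) (c : F), rt γ f = c • f → ∀ k, rt (γ ^ k) f = c ^ k • f := by
      intro f c h k
      induction k with
      | zero => simp
      | succ k ih => rw [pow_succ, rt_mul, h, map_smul, ih, smul_smul, pow_succ, mul_comm]
    have hev : ∀ (f : cr G0) (μ : F), der D f = μ • f → rt γ f = ((Additive.toMul (τ μ) : Fˣ) : F) • f := by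
      intro f μ h
      refine hγ μ f ?_
      rw [End.mem_maxGenEigenspace]
      refine ⟨1, ?_⟩
      rw [pow_one]
      change der D f - μ • f = 0
      rw [h, sub_self]
    have q : ∀ (f : cr G0) (μ : F), f ≠ 0 → rt (t : G0) f = (χ t : F) • f → der D f = μ • f →
        ((Additive.toMul (τ μ) : Fˣ) : F) ^ k = χ t := by
      intro f μ hf hχ hμ
      have e := hpow f _ (hev f μ hμ) k
      have e2 : rt (γ ^ k) f = (χ t : F) • f := hχ
      rw [e, ← sub_eq_zero, ← sub_smul, smul_eq_zero] at e2
      exact sub_eq_zero.1 (e2.resolve_right hf)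
    have e1 := q f μ hf (hχ t) hμ
    have e2 := q f' μ' hf' (hχ' t) hμ'
    have e3 : Additive.toMul (τ μ) = Additive.toMul (τ (μ - μ')) * Additive.toMul (τ μ') := by
      rw [← toMul_add, ← map_add, sub_add_cancel]
    rw [← e2, e3, Units.val_mul, hτ, mul_pow] at e1
    have e4 : ((Additive.toMul (τ μ') : Fˣ) : F) ^ k ≠ 0 := pow_ne_zero _ (Units.ne_zero _)
    have e5 : (2 : F) ^ k = 1 := by
      refine mul_right_cancel₀ e4 ?_
      rw [e1, one_mul]
    have e6 : (2 : ℕ) ^ k = 1 := by exact_mod_cast e5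
    exact absurd e6 (Nat.one_lt_two_pow hk.ne').ne'

end reps
end RG

namespace RG
open Module Polynomial
section reps
variable {F : Type} [Field F]

section abs
variable {Γ : Type} [Group Γ] {V : Type} [AddCommGroup V] [Module F V] [FiniteDimensional F V]
  {ρ : Representation F Γ V}

def CRd (ρ : Representation F Γ V) : Prop := ∀ U : Submodule F V, Stab ρ U →
  ∃ q : V →ₗ[F] V, (∀ γ v, q (ρ γ v) = ρ γ (q v)) ∧ (∀ v, q v ∈ U) ∧ ∀ u ∈ U, q u = u

lemma stab_ker_inf {q : V →ₗ[F] V} (hq : ∀ γ v, q (ρ γ v) = ρ γ (q v)) {U : Submodule F V} (hU : Stab ρ U) :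
    Stab ρ (U ⊓ LinearMap.ker q) := by
  rintro γ v ⟨h1, h2⟩
  refine ⟨hU γ v h1, ?_⟩
  have h2 : q v = 0 := h2
  show q _ = 0
  rw [hq, h2, map_zero]

lemma exists_irr_ne (hc : CRd ρ) {W : Type} [AddCommGroup W] [Module F W] (f : V →ₗ[F] W) (hf : f ≠ 0) :
    ∃ U, Irr ρ U ∧ ∃ u ∈ U, f u ≠ 0 := by
  obtain ⟨U, ⟨h1, u, hu, hfu⟩, hmin⟩ := WellFounded.has_min (wellFounded_lt (α := Submodule F V))
    {L | Stab ρ L ∧ ∃ u ∈ L, f u ≠ 0} ⟨⊤, fun _ _ _ => trivial, by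
      by_contra! h
      exact hf (LinearMap.ext fun v => h v trivial)⟩
  refine ⟨U, ⟨?_, h1, ?_⟩, u, hu, hfu⟩
  · rintro rfl
    rw [(Submodule.mem_bot F).1 hu, map_zero] at hfu
    exact hfu rfl
  intro U' hU' hs'
  by_contra! hne
  obtain ⟨q, hq, hqU, hqid⟩ := hc U' hs'
  have k1 : ∀ w ∈ U', f w = 0 := by
    by_contra! h
    exact hmin U' ⟨hs', h⟩ (lt_of_le_of_ne hU' hne.2)
  have k2 : ∀ w ∈ U ⊓ LinearMap.ker q, f w = 0 := by
    by_contra! h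
    refine hmin _ ⟨stab_ker_inf hq h1, h⟩ (lt_of_le_of_ne inf_le_left ?_)
    intro e
    apply hne.1
    rw [eq_bot_iff]
    intro w hw
    have h3 : w ∈ U ⊓ LinearMap.ker q := e.ge (hU' hw)
    have h4 : q w = 0 := h3.2
    rw [hqid w hw] at h4
    exact (Submodule.mem_bot F).2 h4
  apply hfu
  have h5 := k1 _ (hqU u)
  have h6 := k2 (u - q u) ⟨U.sub_mem hu (hU' (hqU u)), by
    show q _ = 0
    rw [map_sub, hqid _ (hqU u), sub_self]⟩
  rw [map_sub, h5, sub_zero] at h6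
  exact h6

lemma exists_irr_proj (hc : CRd ρ) {W : Type} [AddCommGroup W] [Module F W] (g : W →ₗ[F] V) (hg : g ≠ 0) :
    ∃ U, Irr ρ U ∧ ∃ p : V →ₗ[F] V, (∀ γ v, p (ρ γ v) = ρ γ (p v)) ∧ (∀ v, p v ∈ U) ∧ ∃ w, p (g w) ≠ 0 := by
  obtain ⟨Z, ⟨h1, w, hw⟩, hmax⟩ := WellFounded.has_min (wellFounded_gt (α := Submodule F V))
    {L | Stab ρ L ∧ ∃ w, g w ∉ L} ⟨⊥, fun γ v hv => by
      rw [(Submodule.mem_bot F).1 hv, map_zero]; exact Submodule.zero_mem _, by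
      by_contra! h
      exact hg (LinearMap.ext fun v => (Submodule.mem_bot F).1 (h v))⟩
  obtain ⟨q, hq, hqZ, hqid⟩ := hc Z h1
  have key : ∀ L, Stab ρ L → L ≤ LinearMap.ker q → L ≠ ⊥ → g w ∈ Z ⊔ L := by
    intro L hL hLk hLb
    by_contra h
    refine hmax (Z ⊔ L) ⟨?_, w, h⟩ ?_
    · intro γ v hv
      obtain ⟨a, ha, b, hb, rfl⟩ := Submodule.mem_sup.1 hv
      rw [map_add]
      exact Submodule.add_mem_sup (h1 γ a ha) (hL γ b hb)
    · refine lt_of_le_of_ne le_sup_left fun e => hLb ?_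
      rw [eq_bot_iff]
      intro x hx
      have hxZ : x ∈ Z := e ▸ Submodule.mem_sup_right hx
      have h4 : q x = 0 := hLk hx
      rw [hqid x hxZ] at h4
      exact (Submodule.mem_bot F).2 h4
  have hsk : Stab ρ (LinearMap.ker q) := by
    intro γ v hv
    have hv : q v = 0 := hv
    show q _ = 0
    rw [hq, hv, map_zero]
  have hpm : ∀ v, v - q v ∈ LinearMap.ker q := fun v => by
    show q _ = 0
    rw [map_sub, hqid _ (hqZ v), sub_self]
  have hpw : g w - q (g w) ≠ 0 := fun e => hw (by rw [sub_eq_zero.1 e]; exact hqZ _)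
  refine ⟨LinearMap.ker q, ⟨?_, hsk, ?_⟩, LinearMap.id - q, ?_, hpm, w, hpw⟩
  · intro e
    exact hpw ((Submodule.mem_bot F).1 (e ▸ hpm (g w)))
  · intro U' hU' hs'
    by_contra! hne
    obtain ⟨q', hq', hqU, hqid'⟩ := hc U' hs'
    have m1 := key U' hs' hU' hne.1
    have m2 := key _ (stab_ker_inf hq' hsk) inf_le_left (by
      intro e
      apply hne.2
      refine le_antisymm hU' fun x hx => ?_
      have : x - q' x ∈ LinearMap.ker q ⊓ LinearMap.ker q' := ⟨Submodule.sub_mem _ hx (hU' (hqU x)), by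
        show q' _ = 0
        rw [map_sub, hqid' _ (hqU x), sub_self]⟩
      rw [e, Submodule.mem_bot, sub_eq_zero] at this
      rw [this]; exact hqU x)
    obtain ⟨a, ha, b, hb, e1⟩ := Submodule.mem_sup.1 m1
    obtain ⟨a', ha', b', hb', e2⟩ := Submodule.mem_sup.1 m2
    have c1 : q (g w) = a := by
      rw [← e1, map_add, hqid a ha, show q b = 0 from hU' hb, add_zero]
    have c2 : q (g w) = a' := by
      rw [← e2, map_add, hqid a' ha', show q b' = 0 from hb'.1, add_zero]
    have c3 : b = b' := by
      rw [← c1] at e1; rw [← c2] at e2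
      exact add_left_cancel (e1.trans e2.symm)
    have c4 : q' b' = 0 := hb'.2
    rw [← c3, hqid' b hb] at c4
    rw [c4, add_zero] at e1
    exact hw (e1 ▸ ha)
  · intro γ v
    simp [hq]

lemma irr_sub {U : Submodule F V} (h : Irr ρ U) : Irr (subRep ρ U h.2.1) ⊤ := by
  refine ⟨?_, fun _ _ _ => trivial, ?_⟩
  · intro e
    apply h.1
    rw [eq_bot_iff]
    intro x hx
    have : (⟨x, hx⟩ : U) ∈ (⊤ : Submodule F U) := trivial
    rw [e, Submodule.mem_bot] at this
    exact (Submodule.mem_bot F).2 (congrArg Subtype.val this)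
  · intro L _ hL
    rcases h.2.2 (L.map U.subtype) (Submodule.map_subtype_le _ _) (by
      rintro γ _ ⟨x, hx, rfl⟩
      exact ⟨_, hL γ x hx, rfl⟩) with e | e
    · left
      rw [eq_bot_iff]
      intro x hx
      have : (x : V) ∈ L.map U.subtype := ⟨x, hx, rfl⟩
      rw [e, Submodule.mem_bot] at this
      exact (Submodule.mem_bot F).2 (Subtype.ext this)
    · right
      rw [eq_top_iff]
      intro x _
      have : (x : V) ∈ L.map U.subtype := e.ge x.2
      obtain ⟨y, hy, hyx⟩ := this
      rwa [← Subtype.ext hyx]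
end abs

section conc
variable {n m m' : ℕ} {G0 T : Subgroup (GL (Fin n) F)}

open Classical in
noncomputable def cf (hTG : T ≤ G0) (χ : T.subgroupOf G0 →* Fˣ) : GL (Fin n) F → F := fun g =>
  if h : g ∈ T then (χ ⟨⟨g, hTG h⟩, h⟩ : Fˣ) else 0

lemma cf_apply (hTG : T ≤ G0) (χ : T.subgroupOf G0 →* Fˣ) (g : GL (Fin n) F) (h : g ∈ T) :
    cf hTG χ g = (χ ⟨⟨g, hTG h⟩, h⟩ : Fˣ) := dif_pos h

lemma isWeight (hTG : T ≤ G0) (χ : T.subgroupOf G0 →* Fˣ) (ρ : G0 →* GL (Fin m) F)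
    {U : Submodule F (Fin m → F)} (hU : Stab (repOf ρ) U)
    (hw : wt (T.subgroupOf G0) (subRep (repOf ρ) U hU) χ ≠ ⊥) : ∃ v, IsWeightVector T ρ U (cf hTG χ) v := by
  obtain ⟨v, hv, hv0⟩ := (Submodule.ne_bot_iff _).1 hw
  refine ⟨v, v.2, fun e => hv0 (Subtype.ext e), fun t ht => ?_⟩
  rw [cf_apply hTG χ _ ht]
  exact congrArg Subtype.val (hv ⟨t, ht⟩)

lemma wt_transfer (hTG : T ≤ G0) (ρ : G0 →* GL (Fin m) F) (ρ' : G0 →* GL (Fin m') F)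
    {U : Submodule F (Fin m → F)} (hU : Stab (repOf ρ) U)
    {U' : Submodule F (Fin m' → F)} (hU' : Stab (repOf ρ') U') (hmin : IsMinusculeOn G0 T ρ U)
    {χ : T.subgroupOf G0 →* Fˣ} (hw : wt (T.subgroupOf G0) (subRep (repOf ρ) U hU) χ ≠ ⊥)
    (hw' : wt (T.subgroupOf G0) (subRep (repOf ρ') U' hU') χ ≠ ⊥) {ψ : T.subgroupOf G0 →* Fˣ}
    (hψ : wt (T.subgroupOf G0) (subRep (repOf ρ) U hU) ψ ≠ ⊥) :
    wt (T.subgroupOf G0) (subRep (repOf ρ') U' hU') ψ ≠ ⊥ := by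
  obtain ⟨v, hv⟩ := isWeight hTG χ ρ hU hw
  obtain ⟨v', hv'⟩ := isWeight hTG ψ ρ hU hψ
  obtain ⟨w, hwG, hwN, hww⟩ := hmin _ _ _ _ hv hv'
  obtain ⟨x, hx, hx0⟩ := (Submodule.ne_bot_iff _).1 hw'
  set σ := subRep (repOf ρ') U' hU'
  let w0 : G0 := ⟨w, hwG⟩
  have hback : σ w0 (σ w0⁻¹ x) = x := by
    rw [← Module.End.mul_apply, ← map_mul, mul_inv_cancel, map_one]; rfl
  refine (Submodule.ne_bot_iff _).2 ⟨σ w0⁻¹ x, ?_, fun e => hx0 (by rw [← hback, e, map_zero])⟩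
  intro t
  have htT : (t : GL (Fin n) F) ∈ T := t.2
  have hc : w * t * w⁻¹ ∈ T := (Subgroup.mem_normalizer_iff.1 hwN _).1 htT
  have e1 : σ (t : G0) (σ w0⁻¹ x) = σ w0⁻¹ (σ (w0 * t * w0⁻¹) x) := by
    rw [← Module.End.mul_apply, ← map_mul, ← Module.End.mul_apply, ← map_mul]
    congr 2; group
  have e2 : σ (w0 * t * w0⁻¹) x = (χ ⟨⟨_, hTG hc⟩, hc⟩ : F) • x := hx ⟨⟨_, hTG hc⟩, hc⟩
  have e3 := hww t htT
  rw [cf_apply hTG _ _ htT, cf_apply hTG _ _ hc] at e3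
  rw [e1, e2, map_smul, ← e3]
end conc
end reps

section fin
variable {F : Type} [Field F]

theorem main_thm [IsAlgClosed F] [CharZero F] {n m₁ m₂ : ℕ}
    (G G0 T : Subgroup (GL (Fin n) F))
    (hGred : IsReductive G)
    (hG0 : IsIdentityComponent G0 G) (hle : G0 ≤ G)
    (hT : IsMaximalTorus G0 T)
    (ρ₁ : G →* GL (Fin m₁) F) (ρ₂ : G →* GL (Fin m₂) F)
    (halg₁ : IsAlgebraicRep G ρ₁) (halg₂ : IsAlgebraicRep G ρ₂)
    (hmin₁ : IsMinuscule G0 T (ρ₁.comp (Subgroup.inclusion hle)))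
    (hmin₂ : IsMinuscule G0 T (ρ₂.comp (Subgroup.inclusion hle)))
    (f : (Fin m₁ → F) →ₗ[F] (Fin m₂ → F)) (hf : f ≠ 0)
    (hfT : ∀ t : G, (t : GL (Fin n) F) ∈ T → ∀ v : Fin m₁ → F,
      f (Matrix.mulVec ((ρ₁ t : GL (Fin m₁) F) : Matrix (Fin m₁) (Fin m₁) F) v) =
        Matrix.mulVec ((ρ₂ t : GL (Fin m₂) F) : Matrix (Fin m₂) (Fin m₂) F) (f v)) :
    ∃ f' : (Fin m₁ → F) →ₗ[F] (Fin m₂ → F), f' ≠ 0 ∧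
      ∀ g : G, (g : GL (Fin n) F) ∈ G0 → ∀ v : Fin m₁ → F,
        f' (Matrix.mulVec ((ρ₁ g : GL (Fin m₁) F) : Matrix (Fin m₁) (Fin m₁) F) v) =
          Matrix.mulVec ((ρ₂ g : GL (Fin m₂) F) : Matrix (Fin m₂) (Fin m₂) F) (f' v) := by
  have hcl := (zclosed_iff _).1 hG0.2.1
  haveI : Good (cr G0) := good_cr hcl ((zconn_iff _).1 hG0.2.2.1)
  have hr := red_std hGred hG0
  have hM := mtor_cr hcl hT
  have hTG := hT.1
  have h1 := rat_alg hle ρ₁ halg₁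
  have h2 := rat_alg hle ρ₂ halg₂
  set r₁ := ρ₁.comp (Subgroup.inclusion hle)
  set r₂ := ρ₂.comp (Subgroup.inclusion hle)
  have c1 : CRd (repOf r₁) := fun U hU => hr.exists_proj h1 U hU
  have c2 : CRd (repOf r₂) := fun U hU => hr.exists_proj h2 U hU
  have hfT' : ∀ t : G0, (t : GL (Fin n) F) ∈ T → ∀ v, f (repOf r₁ t v) = repOf r₂ t (f v) :=
    fun t ht v => hfT (Subgroup.inclusion hle t) ht v
  obtain ⟨U1, i1, u, hu, hfu⟩ := exists_irr_ne c1 f hf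
  obtain ⟨U2, i2, p, hp, hpU, w, hpw⟩ := exists_irr_proj c2 (f ∘ₗ U1.subtype) (by
    intro e
    exact hfu (LinearMap.congr_fun e ⟨u, hu⟩))
  have com : ∃ χ, wt (T.subgroupOf G0) (subRep (repOf r₁) U1 i1.2.1) χ ≠ ⊥ ∧
      wt (T.subgroupOf G0) (subRep (repOf r₂) U2 i2.2.1) χ ≠ ⊥ := by
    by_contra! hno
    have htop := iSup_wt hM (h1.sub U1 i1.2.1)
    have : (⨆ χ, wt (T.subgroupOf G0) (subRep (repOf r₁) U1 i1.2.1) χ) ≤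
        LinearMap.ker (p ∘ₗ f ∘ₗ U1.subtype) := by
      refine iSup_le fun χ v hv => ?_
      by_contra hne
      have hne : p (f v) ≠ 0 := hne
      have hv0 : v ≠ 0 := by rintro rfl; simp at hne
      have hb := hno χ ((Submodule.ne_bot_iff _).2 ⟨v, hv, hv0⟩)
      have : (⟨p (f v), hpU _⟩ : U2) ∈ wt (T.subgroupOf G0) (subRep (repOf r₂) U2 i2.2.1) χ := by
        intro t
        apply Subtype.ext
        have e : repOf r₁ (t : G0) (v : Fin m₁ → F) = (χ t : F) • (v : Fin m₁ → F) := congrArg Subtype.val (hv t)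
        show repOf r₂ (t : G0) (p (f v)) = (χ t : F) • p (f v)
        rw [← hp, ← hfT' t t.2, e, map_smul, map_smul]
      rw [hb, Submodule.mem_bot] at this
      exact hne (congrArg Subtype.val this)
    rw [htop] at this
    exact hpw (this (x := w) trivial)
  obtain ⟨χ, hχ1, hχ2⟩ := com
  have m1 := hmin₁ U1 i1
  have m2 := hmin₂ U2 i2
  obtain ⟨φ, hφ, hφe⟩ := highest_weight hr hM (h1.sub U1 i1.2.1) (h2.sub U2 i2.2.1) (irr_sub i1) (irr_sub i2)
    (fun ψ => ⟨fun h => wt_transfer hTG r₁ r₂ i1.2.1 i2.2.1 m1 hχ1 hχ2 h,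
      fun h => wt_transfer hTG r₂ r₁ i2.2.1 i1.2.1 m2 hχ2 hχ1 h⟩)
  obtain ⟨q, hq, hqU, hqid⟩ := c1 U1 i1.2.1
  refine ⟨U2.subtype ∘ₗ φ ∘ₗ q.codRestrict U1 hqU, ?_, ?_⟩
  · intro e
    apply hφ
    ext1 x
    have := LinearMap.congr_fun e (x : Fin m₁ → F)
    apply Subtype.ext
    have hx : q.codRestrict U1 hqU x = x := Subtype.ext (hqid x x.2)
    simp only [LinearMap.comp_apply, hx] at this
    exact this
  · intro g hg v
    let γ : G0 := ⟨g, hg⟩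
    have e1 : q.codRestrict U1 hqU (repOf r₁ γ v) = subRep (repOf r₁) U1 i1.2.1 γ (q.codRestrict U1 hqU v) :=
      Subtype.ext (hq γ v)
    have e2 := hφe γ (q.codRestrict U1 hqU v)
    rw [← e1] at e2
    exact congrArg Subtype.val e2
end fin
end RG

/-- `G` reductive (possibly disconnected) acting on `V₁, V₂`, `T` a
maximal torus of the identity component `G⁰`.  If `Hom(V₁,V₂)` has a nonzero
`T`-invariant element and `V₁, V₂` are minuscule as `G⁰`-representations, then there is
a nonzero `G⁰`-equivariant homomorphism `V₁ → V₂`. -/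
theorem stmt_16 {F : Type} [Field F] [IsAlgClosed F] [CharZero F] {n m₁ m₂ : ℕ}
    (G G0 T : Subgroup (GL (Fin n) F))
    (hGcl : IsZClosed (G : Set (GL (Fin n) F)))
    (hGred : IsReductive G)
    (hG0 : IsIdentityComponent G0 G) (hle : G0 ≤ G)
    (hT : IsMaximalTorus G0 T)
    (ρ₁ : G →* GL (Fin m₁) F) (ρ₂ : G →* GL (Fin m₂) F)
    (halg₁ : IsAlgebraicRep G ρ₁) (halg₂ : IsAlgebraicRep G ρ₂)
    -- `V₁`, `V₂` are minuscule as `G⁰`-representations: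
    (hmin₁ : IsMinuscule G0 T (ρ₁.comp (Subgroup.inclusion hle)))
    (hmin₂ : IsMinuscule G0 T (ρ₂.comp (Subgroup.inclusion hle)))
    -- a nonzero `T`-invariant element of `Hom(V₁, V₂)`:
    (f : (Fin m₁ → F) →ₗ[F] (Fin m₂ → F)) (hf : f ≠ 0)
    (hfT : ∀ t : G, (t : GL (Fin n) F) ∈ T → ∀ v : Fin m₁ → F,
      f (Matrix.mulVec ((ρ₁ t : GL (Fin m₁) F) : Matrix (Fin m₁) (Fin m₁) F) v) =
        Matrix.mulVec ((ρ₂ t : GL (Fin m₂) F) : Matrix (Fin m₂) (Fin m₂) F) (f v)) :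
    -- then there is a nonzero `G⁰`-equivariant homomorphism:
    ∃ f' : (Fin m₁ → F) →ₗ[F] (Fin m₂ → F), f' ≠ 0 ∧
      ∀ g : G, (g : GL (Fin n) F) ∈ G0 → ∀ v : Fin m₁ → F,
        f' (Matrix.mulVec ((ρ₁ g : GL (Fin m₁) F) : Matrix (Fin m₁) (Fin m₁) F) v) =
          Matrix.mulVec ((ρ₂ g : GL (Fin m₂) F) : Matrix (Fin m₂) (Fin m₂) F) (f' v) := by
  exact RG.main_thm G G0 T hGred hG0 hle hT ρ₁ ρ₂ halg₁ halg₂ hmin₁ hmin₂ f hf hfT
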